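/- Let V₁,…,V_r ⊂ ℙⁿ (r ≥ 2) be pure dimensional projective varieties over an algebraically closed field. Then ∏_{i=1}^r deg(V_i) ≥ Σ_C deg(C), where C runs through all irreducible components of V₁ ∩ ⋯ ∩ V_r. -/

import Mathlib

open MvPolynomial
open scoped LinearAlgebra.Projectivization

noncomputable section

/-- A polynomial vanishes at a point of projective space if it vanishes at every
representative. -/
def PVanish {F : Type*} [Field F] {n : ℕ} (f : MvPolynomial (Fin (n + 1)) F)
    (x : ℙ F (Fin (n + 1) → F)) : Prop :=
  ∀ (v : Fin (n + 1) → F) (hv : v ≠ 0), Projectivization.mk F v hv = x →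
    MvPolynomial.eval v f = 0

/-- A projective algebraic set: the common zero locus of a set of homogeneous
polynomials. -/
def IsAlgSet {F : Type*} [Field F] {n : ℕ} (V : Set (ℙ F (Fin (n + 1) → F))) : Prop :=
  ∃ S : Set (MvPolynomial (Fin (n + 1)) F),
    (∀ f ∈ S, ∃ d, MvPolynomial.IsHomogeneous f d) ∧
    V = {x | ∀ f ∈ S, PVanish f x}

/-- An irreducible projective algebraic set. -/
def IsIrredAlg {F : Type*} [Field F] {n : ℕ} (V : Set (ℙ F (Fin (n + 1) → F))) : Prop :=
  IsAlgSet V ∧ V.Nonempty ∧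
    ∀ A B, IsAlgSet A → IsAlgSet B → V ⊆ A ∪ B → V ⊆ A ∨ V ⊆ B

/-- An irreducible component of a set `W`: a maximal irreducible algebraic subset
of `W`. -/
def IsComp {F : Type*} [Field F] {n : ℕ} (W C : Set (ℙ F (Fin (n + 1) → F))) : Prop :=
  IsIrredAlg C ∧ C ⊆ W ∧ ∀ C', IsIrredAlg C' → C' ⊆ W → C ⊆ C' → C' = C

/-- The dimension of a projective set: the Krull dimension of the poset of
irreducible algebraic subsets contained in it. -/
def projDim {F : Type*} [Field F] {n : ℕ} (V : Set (ℙ F (Fin (n + 1) → F))) :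
    WithBot ℕ∞ :=
  Order.krullDim {C : Set (ℙ F (Fin (n + 1) → F)) // IsIrredAlg C ∧ C ⊆ V}

/-- The projective linear subspace cut out by `d` linear forms. -/
def linSlice {F : Type*} [Field F] {n d : ℕ} (c : Fin d → Fin (n + 1) → F) :
    Set (ℙ F (Fin (n + 1) → F)) :=
  {x | ∀ i : Fin d, ∀ (v : Fin (n + 1) → F) (hv : v ≠ 0),
    Projectivization.mk F v hv = x → ∑ j, c i j * v j = 0}

/-- The degree of a `d`-dimensional projective set: the maximal finite number of
points in its intersection with a linear subspace of complementary dimension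
(cut out by `d` linear forms). -/
def projDeg {F : Type*} [Field F] {n : ℕ} (V : Set (ℙ F (Fin (n + 1) → F)))
    (d : ℕ) : ℕ∞ :=
  sSup {N : ℕ∞ | ∃ c : Fin d → Fin (n + 1) → F,
    (V ∩ linSlice c).Finite ∧ N = Nat.card ↥(V ∩ linSlice c)}

theorem le_of_mul_choose_le {a b e ρ : ℕ}
    (h : ∀ m, a * (m + ρ).choose ρ ≤ b * (m + e + ρ).choose ρ) : a ≤ b := by
  have key : ∀ m : ℕ, ((m + e + ρ).choose ρ : ℝ) ≤
      (((m : ℝ) + 1 + e) / (m + 1)) ^ ρ * ((m + ρ).choose ρ : ℝ) := by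
    intro m
    clear h
    induction ρ with
    | zero => simp
    | succ ρ ih =>
      have h1 := Nat.add_one_mul_choose_eq (m + e + ρ) ρ
      have h2 := Nat.add_one_mul_choose_eq (m + ρ) ρ
      have h1' : ((m : ℝ) + e + ρ + 1) * ((m + e + ρ).choose ρ : ℝ) =
        ((m + e + (ρ + 1)).choose (ρ + 1) : ℝ) * (ρ + 1) := by exact_mod_cast h1
      have h2' : ((m : ℝ) + ρ + 1) * ((m + ρ).choose ρ : ℝ) =
        ((m + (ρ + 1)).choose (ρ + 1) : ℝ) * (ρ + 1) := by exact_mod_cast h2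
      set t : ℝ := ((m : ℝ) + 1 + e) / (m + 1) with ht
      have hm : (0 : ℝ) < m + 1 := by positivity
      have ht0 : 0 ≤ t := by positivity
      have h3 : (m : ℝ) + e + ρ + 1 ≤ t * (m + ρ + 1) := by
        rw [ht, div_mul_eq_mul_div, le_div_iff₀ hm]
        have : (0 : ℝ) ≤ e * ρ := by positivity
        nlinarith
      have h4 : (0 : ℝ) < ρ + 1 := by positivity
      refine le_of_mul_le_mul_right ?_ h4
      calc ((m + e + (ρ + 1)).choose (ρ + 1) : ℝ) * (ρ + 1)
          = ((m : ℝ) + e + ρ + 1) * ((m + e + ρ).choose ρ : ℝ) := h1'.symm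
        _ ≤ (t * (m + ρ + 1)) * (t ^ ρ * ((m + ρ).choose ρ : ℝ)) := by gcongr
        _ = t ^ (ρ + 1) * (((m : ℝ) + ρ + 1) * ((m + ρ).choose ρ : ℝ)) := by ring
        _ = _ := by rw [h2']; ring
  have h5 : ∀ m : ℕ, (a : ℝ) ≤ b * (((m : ℝ) + 1 + e) / (m + 1)) ^ ρ := by
    intro m
    have hc : (0 : ℝ) < ((m + ρ).choose ρ : ℝ) := by
      exact_mod_cast Nat.choose_pos (Nat.le_add_left ρ m)
    refine le_of_mul_le_mul_right ?_ hc
    calc (a : ℝ) * ((m + ρ).choose ρ : ℝ) ≤ b * ((m + e + ρ).choose ρ : ℝ) := by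
          exact_mod_cast h m
      _ ≤ b * ((((m : ℝ) + 1 + e) / (m + 1)) ^ ρ * ((m + ρ).choose ρ : ℝ)) := by
          gcongr; exact key m
      _ = _ := by ring
  have h6 : Filter.Tendsto (fun m : ℕ => (b : ℝ) * (((m : ℝ) + 1 + e) / (m + 1)) ^ ρ)
      Filter.atTop (nhds (b * (1 + 0) ^ ρ)) := by
    have h7 : Filter.Tendsto (fun m : ℕ => (e : ℝ) * (1 / ((m : ℝ) + 1))) Filter.atTop
        (nhds (e * 0)) := tendsto_one_div_add_atTop_nhds_zero_nat.const_mul _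
    rw [mul_zero] at h7
    refine Filter.Tendsto.const_mul _ (Filter.Tendsto.pow ?_ _)
    refine (tendsto_const_nhds.add h7).congr fun m => ?_
    have hm : (m : ℝ) + 1 ≠ 0 := by positivity
    field_simp
  have := ge_of_tendsto' h6 h5
  simpa using this

/-- The span of `1` and a family of elements of an algebra. -/
def linSpan (F : Type*) {R ι : Type*} [Field F] [CommRing R] [Algebra F R] (x : ι → R) :
    Submodule F R :=
  Submodule.span F (insert 1 (Set.range x))

section linSpan

variable {F R R' ι : Type*} [Field F] [CommRing R] [Algebra F R] [CommRing R'] [Algebra F R']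

theorem one_mem_linSpan (x : ι → R) : 1 ∈ linSpan F x :=
  Submodule.subset_span (Set.mem_insert _ _)

theorem mem_linSpan (x : ι → R) (i : ι) : x i ∈ linSpan F x :=
  Submodule.subset_span (Set.mem_insert_of_mem _ ⟨i, rfl⟩)

theorem linSpan_le {x : ι → R} {W : Submodule F R} (h1 : 1 ∈ W) (h : ∀ i, x i ∈ W) :
    linSpan F x ≤ W := by
  refine Submodule.span_le.2 ?_
  rintro _ (rfl | ⟨i, rfl⟩)
  exacts [h1, h i]

theorem map_linSpan (f : R →ₐ[F] R') (x : ι → R) :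
    (linSpan F x).map f.toLinearMap = linSpan F (f ∘ x) := by
  rw [linSpan, linSpan, Submodule.map_span, Set.image_insert_eq, Set.range_comp]
  simp

theorem map_linSpan_pow (f : R →ₐ[F] R') (x : ι → R) (m : ℕ) :
    (linSpan F x ^ m).map f.toLinearMap = linSpan F (f ∘ x) ^ m := by
  rw [Submodule.map_pow, map_linSpan]

instance finiteDimensional_linSpan [Finite ι] (x : ι → R) : FiniteDimensional F (linSpan F x) :=
  FiniteDimensional.span_of_finite F ((Set.finite_range x).insert 1)

instance finiteDimensional_linSpan_pow [Finite ι] (x : ι → R) (m : ℕ) :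
    FiniteDimensional F ↥(linSpan F x ^ m) := by
  rw [FiniteDimensional, Module.Finite.iff_fg]
  exact ((Module.Finite.iff_fg).1 (finiteDimensional_linSpan x)).pow m

theorem pow_le_pow_of_one_mem {W : Submodule F R} (h1 : 1 ∈ W) {m k : ℕ} (h : m ≤ k) :
    W ^ m ≤ W ^ k :=
  pow_le_pow_right₀ (Submodule.one_le.2 h1) h

theorem finrank_linSpan_pow_of_injective [Finite ι] (f : R →ₐ[F] R') (hf : Function.Injective f)
    (x : ι → R) (m : ℕ) : Module.finrank F ↥(linSpan F (f ∘ x) ^ m) = Module.finrank F ↥(linSpan F x ^ m) := by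
  rw [← map_linSpan_pow]
  exact (Submodule.equivMapOfInjective f.toLinearMap hf _).finrank_eq.symm

theorem linSpan_X_pow {σ : Type*} (m : ℕ) :
    linSpan F (X : σ → MvPolynomial σ F) ^ m = restrictTotalDegree σ F m := by
  classical
  apply le_antisymm
  · induction m with
    | zero =>
      rw [pow_zero, Submodule.one_le, mem_restrictTotalDegree]
      simp
    | succ m ih =>
      rw [pow_succ, Submodule.mul_le]
      intro f hf g hg
      have h1 := ih hf
      have h2 : g ∈ restrictTotalDegree σ F 1 := by
        refine linSpan_le (W := restrictTotalDegree σ F 1) ?_ (fun i => ?_) hg <;>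
          rw [mem_restrictTotalDegree] <;> simp
      rw [mem_restrictTotalDegree] at *
      exact (totalDegree_mul f g).trans (add_le_add h1 h2)
  · rw [restrictTotalDegree, restrictSupport_eq_span, Submodule.span_le]
    rintro _ ⟨s, hs, rfl⟩
    have hs' : s.degree ≤ m := hs
    refine pow_le_pow_of_one_mem (one_mem_linSpan _) hs' ?_
    clear hs hs'
    induction s using Finsupp.induction_linear with
    | zero => simp; exact ⟨1, C_1⟩
    | add f g hf hg =>
      have : monomial (f + g) (1 : F) = monomial f 1 * monomial g 1 := by simp
      dsimp only at *
      rw [this, map_add, pow_add]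
      exact Submodule.mul_mem_mul hf hg
    | single i k =>
      dsimp only
      rw [Finsupp.degree_single, ← X_pow_eq_monomial]
      exact Submodule.pow_mem_pow _ (mem_linSpan _ i) k

theorem exists_mem_linSpan_X_pow {σ : Type*} (f : MvPolynomial σ F) :
    ∃ m, f ∈ linSpan F (X : σ → MvPolynomial σ F) ^ m :=
  ⟨f.totalDegree, by rw [linSpan_X_pow, mem_restrictTotalDegree]⟩

theorem finrank_restrictTotalDegree (ρ m : ℕ) :
    Module.finrank F (restrictTotalDegree (Fin ρ) F m) = (m + ρ).choose ρ := by
  classical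
  have hb := Module.finrank_eq_nat_card_basis
    (basisRestrictSupport F { n : Fin ρ →₀ ℕ | (n.sum fun _ e => e) ≤ m })
  rw [restrictTotalDegree, hb, ← Nat.sum_range_multichoose]
  have hset : { n : Fin ρ →₀ ℕ | (n.sum fun _ e => e) ≤ m } =
      ((Finset.range (m + 1)).biUnion fun i => Finset.univ.finsuppAntidiag i :
        Finset (Fin ρ →₀ ℕ)) := by
    ext n
    simp [Finset.mem_finsuppAntidiag, Finsupp.sum_fintype]
  rw [Nat.card_coe_set_eq, hset, Set.ncard_coe_finset, Finset.card_biUnion]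
  · simp [Finset.card_finsuppAntidiag_nat_eq_multichoose]
  · intro i _ j _ hij
    refine Finset.disjoint_left.2 ?_
    intro n hi hj
    simp only [Finset.mem_finsuppAntidiag] at hi hj
    exact hij (hi.1.symm.trans hj.1)

theorem finrank_linSpan_pow {ρ : ℕ} {y : Fin ρ → R} (hy : AlgebraicIndependent F y) (m : ℕ) :
    Module.finrank F ↥(linSpan F y ^ m) = (m + ρ).choose ρ := by
  have h : y = aeval (R := F) y ∘ X := by ext i; simp
  rw [h, finrank_linSpan_pow_of_injective _ hy, linSpan_X_pow, finrank_restrictTotalDegree]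

end linSpan

/-- The Hilbert function `m ↦ dim ⟨1, x⟩ ^ m` grows like `δ` times that of a polynomial ring
in `ρ` variables. -/
def HasDeg (F : Type*) {R ι : Type*} [Field F] [CommRing R] [Algebra F R] (x : ι → R)
    (ρ δ : ℕ) : Prop :=
  ∃ e, ∀ m, δ * (m + ρ).choose ρ ≤ Module.finrank F ↥(linSpan F x ^ (m + e)) ∧
    Module.finrank F ↥(linSpan F x ^ m) ≤ δ * (m + e + ρ).choose ρ

section

variable {F R R' K ι : Type*} [Field F] [CommRing R] [Algebra F R] [CommRing R'] [Algebra F R']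
  [Field K] [Algebra F K]

theorem HasDeg.le {x : ι → R} {ρ δ δ' : ℕ} (h : HasDeg F x ρ δ) (h' : HasDeg F x ρ δ') :
    δ ≤ δ' := by
  obtain ⟨e, he⟩ := h
  obtain ⟨e', he'⟩ := h'
  refine le_of_mul_choose_le (e := e + e') (ρ := ρ) fun m => ?_
  rw [← add_assoc]
  exact (he m).1.trans (he' (m + e)).2

theorem HasDeg.of_injective [Finite ι] {x : ι → R} {ρ δ : ℕ} (f : R →ₐ[F] R')
    (hf : Function.Injective f) (h : HasDeg F (f ∘ x) ρ δ) : HasDeg F x ρ δ := by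
  simpa only [HasDeg, finrank_linSpan_pow_of_injective f hf] using h

theorem aeval_mem_linSpan_pow (y : ι → R) (p : MvPolynomial ι F) :
    aeval y p ∈ linSpan F y ^ p.totalDegree := by
  have h : y = aeval (R := F) y ∘ X := by ext i; simp
  have h2 := map_linSpan_pow (aeval (R := F) y) X p.totalDegree
  rw [← h] at h2
  rw [← h2, linSpan_X_pow]
  exact ⟨p, (mem_restrictTotalDegree _ _ _).2 le_rfl, rfl⟩

theorem linSpan_pow_subset_adjoin (y : ι → K) (m : ℕ) :
    ∀ u ∈ linSpan F y ^ m, u ∈ IntermediateField.adjoin F (Set.range y) := by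
  have h : linSpan F y ≤
      Subalgebra.toSubmodule (IntermediateField.adjoin F (Set.range y)).toSubalgebra :=
    linSpan_le (Subalgebra.one_mem _) fun i => IntermediateField.subset_adjoin _ _ ⟨i, rfl⟩
  induction m with
  | zero =>
    intro u hu
    rw [pow_zero] at hu
    obtain ⟨a, rfl⟩ := Submodule.mem_one.1 hu
    exact algebraMap_mem _ a
  | succ m ih =>
    intro u hu
    rw [pow_succ] at hu
    refine Submodule.mul_induction_on hu (fun a ha b hb => mul_mem (ih a ha) (h hb))
      fun a b ha hb => add_mem ha hb

theorem exists_common_denominator (y : ι → K) (s : Finset K)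
    (hs : ∀ c ∈ s, c ∈ IntermediateField.adjoin F (Set.range y)) :
    ∃ k, ∃ q ∈ linSpan F y ^ k, q ≠ 0 ∧ ∀ c ∈ s, q * c ∈ linSpan F y ^ k := by
  classical
  induction s using Finset.induction_on with
  | empty => exact ⟨0, 1, by simp [Submodule.one_le.1 le_rfl], one_ne_zero, by simp⟩
  | insert c s _ ih =>
    obtain ⟨k, q, hq, hq0, hqs⟩ := ih fun c hc => hs c (Finset.mem_insert_of_mem hc)
    have hfrac : ∃ j, ∃ p ∈ linSpan F y ^ j, ∃ r ∈ linSpan F y ^ j, r ≠ 0 ∧ r * c = p := by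
      obtain ⟨p, r, rfl⟩ := (IntermediateField.mem_adjoin_range_iff F y c).1
        (hs c (Finset.mem_insert_self _ _))
      by_cases hr : aeval y r = 0
      · exact ⟨0, 0, zero_mem _, 1, by simp [Submodule.one_le.1 le_rfl], one_ne_zero, by simp [hr]⟩
      · exact ⟨max p.totalDegree r.totalDegree, aeval y p,
          pow_le_pow_of_one_mem (one_mem_linSpan y) (le_max_left _ _) (aeval_mem_linSpan_pow y p),
          aeval y r,
          pow_le_pow_of_one_mem (one_mem_linSpan y) (le_max_right _ _) (aeval_mem_linSpan_pow y r),
          hr, mul_div_cancel₀ _ hr⟩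
    obtain ⟨j, p, hp, r, hr, hr0, hrc⟩ := hfrac
    refine ⟨k + j, q * r, ?_, mul_ne_zero hq0 hr0, ?_⟩
    · rw [pow_add]; exact Submodule.mul_mem_mul hq hr
    · intro c' hc'
      rw [pow_add]
      rcases Finset.mem_insert.1 hc' with rfl | h
      · rw [mul_assoc, hrc]; exact Submodule.mul_mem_mul hq hp
      · rw [mul_right_comm]; exact Submodule.mul_mem_mul (hqs c' h) hr

end

section

variable {F K ι : Type*} [Field F] [Field K] [Algebra F K]

theorem pow_add_le_pow_mul {R : Type*} [CommRing R] [Algebra F R] {U W : Submodule F R} {N : ℕ}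
    (hN : W ^ (N + 1) ≤ U * W ^ N) (m : ℕ) : W ^ (N + m) ≤ U ^ m * W ^ N := by
  induction m with
  | zero => simp
  | succ m ih =>
    calc W ^ (N + (m + 1)) = W ^ (N + m) * W := by rw [← add_assoc, pow_succ]
      _ ≤ U ^ m * W ^ N * W := mul_le_mul_left ih _
      _ = U ^ m * W ^ (N + 1) := by rw [mul_assoc, ← pow_succ]
      _ ≤ U ^ m * (U * W ^ N) := mul_le_mul_right hN _
      _ = U ^ (m + 1) * W ^ N := by rw [← mul_assoc, ← pow_succ]

theorem span_pow_eq_top {x : ι → K} {κ : Type*} {y : κ → K} {N : ℕ}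
    (hN : linSpan F x ^ (N + 1) ≤ linSpan F y * linSpan F x ^ N) [Finite ι]
    (htop : IntermediateField.adjoin F (Set.range x) = ⊤) :
    Submodule.span (IntermediateField.adjoin F (Set.range y))
      ((linSpan F x ^ N : Submodule F K) : Set K) = ⊤ := by
  set E := IntermediateField.adjoin F (Set.range y) with hE
  set M : Submodule E K := Submodule.span E ((linSpan F x ^ N : Submodule F K) : Set K) with hM
  have hUE : ∀ u ∈ linSpan F y, u ∈ E := fun u hu =>
    linSpan_pow_subset_adjoin y 1 u (by rwa [pow_one])
  have h1 : (1 : K) ∈ M := Submodule.subset_span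
    (pow_le_pow_of_one_mem (one_mem_linSpan x) (Nat.zero_le N)
      (by simp [Submodule.one_le.1 le_rfl]))
  have hfin : FiniteDimensional E M := by
    obtain ⟨s, hs⟩ := (Module.Finite.iff_fg).1 (finiteDimensional_linSpan_pow (F := F) x N)
    rw [FiniteDimensional, Module.Finite.iff_fg]
    refine ⟨s, ?_⟩
    rw [hM, ← hs, Submodule.span_span_of_tower]
  have hmul : ∀ i, ∀ a ∈ M, x i * a ∈ M := by
    intro i a ha
    induction ha using Submodule.span_induction with
    | mem w hw =>
      have h2 : x i * w ∈ linSpan F y * linSpan F x ^ N := by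
        apply hN
        rw [pow_succ']
        exact Submodule.mul_mem_mul (mem_linSpan x i) hw
      refine Submodule.mul_induction_on h2 (fun u hu w hw => ?_) fun a b ha hb => add_mem ha hb
      exact M.smul_mem (⟨u, hUE u hu⟩ : E) (Submodule.subset_span hw)
    | zero => simp
    | add a b _ _ ha hb => rw [mul_add]; exact add_mem ha hb
    | smul c a _ ha => rw [mul_smul_comm]; exact M.smul_mem c ha
  have hadj : Subalgebra.toSubmodule (Algebra.adjoin E (Set.range x)) ≤ M := by
    have h3 : ∀ a ∈ Algebra.adjoin E (Set.range x), ∀ c ∈ M, a * c ∈ M := by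
      intro a ha
      induction ha using Algebra.adjoin_induction with
      | mem a ha => obtain ⟨i, rfl⟩ := ha; exact hmul i
      | algebraMap r => intro c hc; rw [← Algebra.smul_def]; exact M.smul_mem r hc
      | add a b _ _ ha hb => intro c hc; rw [add_mul]; exact add_mem (ha c hc) (hb c hc)
      | mul a b _ _ ha hb => intro c hc; rw [mul_assoc]; exact ha _ (hb c hc)
    intro a ha
    simpa using h3 a ha 1 h1
  have hfin' : FiniteDimensional E (Algebra.adjoin E (Set.range x)) :=
    Submodule.finiteDimensional_of_le hadj
  have halg : ∀ a ∈ Set.range x, IsAlgebraic E a := by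
    intro a ha
    have h4 : IsAlgebraic E (⟨a, Algebra.subset_adjoin ha⟩ : Algebra.adjoin E (Set.range x)) :=
      Algebra.IsAlgebraic.isAlgebraic _
    exact h4.algebraMap (A := K)
  have h5 := IntermediateField.adjoin_toSubalgebra_of_isAlgebraic halg
  have h6 : IntermediateField.adjoin E (Set.range x) = ⊤ := by
    rw [eq_top_iff]
    intro a _
    have h7 : (IntermediateField.adjoin F (Set.range x)) ≤
        (IntermediateField.adjoin E (Set.range x)).restrictScalars F :=
      IntermediateField.adjoin_le_iff.2 (IntermediateField.subset_adjoin _ _)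
    exact h7 (by rw [htop]; trivial)
  rw [eq_top_iff]
  intro a _
  apply hadj
  change a ∈ Algebra.adjoin E (Set.range x)
  rw [← h5, h6]
  trivial

/-- The pairing of a family of elements with coefficients in a subspace. -/
def combine {κ : Type*} [Fintype κ] (U : Submodule F K) (b : κ → K) : (κ → U) →ₗ[F] K :=
  ∑ i, LinearMap.mulRight F (b i) ∘ₗ U.subtype ∘ₗ LinearMap.proj i

theorem combine_apply {κ : Type*} [Fintype κ] (U : Submodule F K) (b : κ → K) (u : κ → U) :
    combine U b u = ∑ i, (u i : K) * b i := by
  simp [combine, LinearMap.sum_apply]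

theorem combine_injective {κ : Type*} [Fintype κ] {U : Submodule F K} {b : κ → K}
    {E : IntermediateField F K} (hU : ∀ u ∈ U, u ∈ E) (hb : LinearIndependent E b) :
    Function.Injective (combine U b) := by
  rw [← LinearMap.ker_eq_bot, LinearMap.ker_eq_bot']
  intro u hu
  rw [combine_apply] at hu
  have h := Fintype.linearIndependent_iff.1 hb (fun i => ⟨u i, hU _ (u i).2⟩) hu
  ext i
  simpa using congrArg Subtype.val (h i)

theorem hasDeg_of_reduction [Finite ι] {ρ : ℕ} {x : ι → K} {y : Fin ρ → K}
    (hy : AlgebraicIndependent F y) (hUW : linSpan F y ≤ linSpan F x) {N : ℕ}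
    (hN : linSpan F x ^ (N + 1) ≤ linSpan F y * linSpan F x ^ N)
    (htop : IntermediateField.adjoin F (Set.range x) = ⊤) :
    FiniteDimensional (IntermediateField.adjoin F (Set.range y)) K ∧
      HasDeg F x ρ (Module.finrank (IntermediateField.adjoin F (Set.range y)) K) := by
  classical
  have hspan := span_pow_eq_top hN htop
  set E := IntermediateField.adjoin F (Set.range y) with hE
  obtain ⟨s, hs⟩ := (Module.Finite.iff_fg).1 (finiteDimensional_linSpan_pow (F := F) x N)
  have hfin : FiniteDimensional E K := by
    rw [FiniteDimensional, Module.finite_def]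
    refine ⟨s, ?_⟩
    rw [← hspan, ← hs, Submodule.span_span_of_tower]
  refine ⟨hfin, ?_⟩
  let b := Module.Basis.ofSpan hspan.ge
  have hbW : ∀ i, b i ∈ linSpan F x ^ N := fun i =>
    Module.Basis.ofSpan_subset hspan.ge ⟨i, rfl⟩
  have : Fintype (↑(LinearIndepOn.extend (linearIndepOn_empty E id) (Set.empty_subset
    ((linSpan F x ^ N : Submodule F K) : Set K)))) := FiniteDimensional.fintypeBasisIndex b
  have hcard := Module.finrank_eq_card_basis b
  have hrank : ∀ m, Module.finrank F (LinearMap.range (combine (linSpan F y ^ m) b)) =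
      Module.finrank E K * (m + ρ).choose ρ := by
    intro m
    rw [LinearMap.finrank_range_of_inj
      (combine_injective (linSpan_pow_subset_adjoin y m) b.linearIndependent),
      Module.finrank_pi_fintype]
    simp [finrank_linSpan_pow hy, hcard]
  obtain ⟨k, q, hq, hq0, hqs⟩ := exists_common_denominator y
    (s.biUnion fun a => Finset.univ.image fun i => ((b.repr a i : E) : K)) (by
      intro c hc
      simp only [Finset.mem_biUnion, Finset.mem_image] at hc
      obtain ⟨a, _, i, _, rfl⟩ := hc
      exact (b.repr a i).2)
  have hlow : ∀ m, LinearMap.range (combine (linSpan F y ^ m) b) ≤ linSpan F x ^ (m + N) := by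
    rintro m _ ⟨u, rfl⟩
    rw [combine_apply, pow_add]
    exact sum_mem fun i _ => Submodule.mul_mem_mul (pow_le_pow_left' hUW m (u i).2) (hbW i)
  have hupp : ∀ m, (linSpan F x ^ m).map (LinearMap.mulLeft F q) ≤
      LinearMap.range (combine (linSpan F y ^ (m + k)) b) := by
    intro m
    rw [Submodule.map_le_iff_le_comap]
    refine ((pow_le_pow_of_one_mem (one_mem_linSpan x) (Nat.le_add_left m N)).trans
      (pow_add_le_pow_mul hN m)).trans ?_
    rw [Submodule.mul_le]
    intro u hu w hw
    replace hw := hs.ge hw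
    induction hw using Submodule.span_induction with
    | mem a ha =>
      have hmem : ∀ i, u * (q * ((b.repr a i : E) : K)) ∈ linSpan F y ^ (m + k) := by
        intro i
        rw [pow_add]
        refine Submodule.mul_mem_mul hu (hqs _ ?_)
        exact Finset.mem_biUnion.2 ⟨a, ha, Finset.mem_image.2 ⟨i, Finset.mem_univ _, rfl⟩⟩
      refine ⟨fun i => ⟨_, hmem i⟩, ?_⟩
      rw [combine_apply, LinearMap.mulLeft_apply]
      conv_rhs => rw [← b.sum_repr a, Finset.mul_sum, Finset.mul_sum]
      refine Finset.sum_congr rfl fun i _ => ?_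
      rw [Algebra.smul_def]
      change u * (q * _) * _ = q * (u * (((b.repr a i : E) : K) * b i))
      ring
    | zero => simp
    | add a c _ _ ha hc => rw [mul_add]; exact add_mem ha hc
    | smul c a _ ha => rw [mul_smul_comm]; exact Submodule.smul_mem _ c ha
  refine ⟨N + k, fun m => ⟨?_, ?_⟩⟩
  · rw [← hrank]
    refine Submodule.finrank_mono ((hlow m).trans ?_)
    exact pow_le_pow_of_one_mem (one_mem_linSpan x) (by omega)
  · have h1 : Module.finrank F ↥(linSpan F x ^ m) =
        Module.finrank F ↥((linSpan F x ^ m).map (LinearMap.mulLeft F q)) :=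
      (Submodule.equivMapOfInjective _ (mul_right_injective₀ hq0) _).finrank_eq
    rw [h1]
    refine (Submodule.finrank_mono (hupp m)).trans ?_
    rw [hrank]
    exact Nat.mul_le_mul_left _ (Nat.choose_le_choose _ (by omega))

end

section

variable {F K ι : Type*} [Field F] [Field K] [Algebra F K]

theorem eval_smul_of_isHomogeneous {σ : Type*} [Fintype σ] {p : MvPolynomial σ F} {d : ℕ}
    (hp : p.IsHomogeneous d) (c : F) (v : σ → F) : eval (c • v) p = c ^ d * eval v p := by
  rw [eval_eq', eval_eq', Finset.mul_sum]
  refine Finset.sum_congr rfl fun α hα => ?_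
  have h1 : ∑ i, α i = d := by
    rw [← hp (mem_support_iff.1 hα), Finsupp.weight_apply, Finsupp.sum_fintype] <;> simp
  simp only [Pi.smul_apply, smul_eq_mul, mul_pow, Finset.prod_mul_distrib,
    Finset.prod_pow_eq_pow_sum,
    h1]
  ring

theorem totalDegree_pderiv_lt {σ : Type*} {f : MvPolynomial σ F} {k : σ} (h : pderiv k f ≠ 0) :
    (pderiv k f).totalDegree < f.totalDegree := by
  obtain ⟨m, hm, hdeg⟩ := Finset.exists_mem_eq_sup _ (support_nonempty.2 h)
    (fun s : σ →₀ ℕ => s.sum fun _ e => e)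
  have h1 : m + Finsupp.single k 1 ∈ f.support := by
    rw [mem_support_iff] at hm ⊢
    intro h0
    rw [coeff_pderiv, h0, zero_mul] at hm
    exact hm rfl
  have h2 := le_totalDegree h1
  rw [Finsupp.sum_add_index' (by simp) (by simp), Finsupp.sum_single_index rfl] at h2
  have h3 : (pderiv k f).totalDegree = m.sum fun _ e => e := hdeg
  omega

theorem exists_relation [PerfectField F] {y : ι → K} (h : ¬ AlgebraicIndependent F y) :
    ∃ f : MvPolynomial ι F, f ≠ 0 ∧ aeval y f = 0 ∧ ∃ k, aeval y (pderiv k f) ≠ 0 := by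
  set S := {f : MvPolynomial ι F | f ≠ 0 ∧ aeval y f = 0} with hS
  have hne : S.Nonempty := by
    rw [algebraicIndependent_iff] at h
    push Not at h
    obtain ⟨f, h1, h2⟩ := h
    exact ⟨f, h2, h1⟩
  set f := totalDegree.argminOn S hne with hf
  obtain ⟨hf0, hfa⟩ : f ∈ S := totalDegree.argminOn_mem ..
  have hmin : ∀ g : MvPolynomial ι F, g ≠ 0 → aeval y g = 0 → f.totalDegree ≤ g.totalDegree :=
    fun g h1 h2 => totalDegree.argminOn_le S ⟨h1, h2⟩
  refine ⟨f, hf0, hfa, ?_⟩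
  suffices h : ∃ k, pderiv k f ≠ 0 by
    obtain ⟨k, hk⟩ := h
    refine ⟨k, fun h0 => ?_⟩
    exact absurd (hmin _ hk h0) (not_le.2 (totalDegree_pderiv_lt hk))
  suffices h : ∃ k, ∃ α ∈ f.support, ((α k : ℕ) : F) ≠ 0 by
    obtain ⟨k, α, hα, hk⟩ := h
    have hk0 : α k ≠ 0 := fun h0 => hk (by simp [h0])
    refine ⟨k, fun h0 => ?_⟩
    set β : ι →₀ ℕ := α - Finsupp.single k 1 with hβ
    have h1 := coeff_pderiv (i := k) f β
    have h2 : β + Finsupp.single k 1 = α :=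
      tsub_add_cancel_of_le (Finsupp.single_le_iff.2 (Nat.one_le_iff_ne_zero.2 hk0))
    rw [h0, h2] at h1
    have h3 : β k + 1 = α k := by
      have := DFunLike.congr_fun h2 k
      simpa using this
    have h4 : ((β k : ℕ) : F) + 1 = ((α k : ℕ) : F) := by
      exact_mod_cast congrArg (Nat.cast (R := F)) h3
    rw [h4] at h1
    exact mul_ne_zero (mem_support_iff.1 hα) hk (by simpa using h1.symm)
  obtain _ | ⟨p, hp, hpk⟩ := CharP.exists' F
  · by_contra! hcon
    have : f = C (coeff 0 f) := by
      rw [← totalDegree_eq_zero_iff_eq_C, totalDegree_eq_zero_iff]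
      intro α hα k
      exact_mod_cast hcon k α hα
    rw [this, aeval_C, map_eq_zero] at hfa
    rw [hfa, map_zero] at this
    exact hf0 this
  · have : ExpChar F p := .prime hp.out
    have : CharP K p := .of_ringHom_of_ne_zero (algebraMap F K) p hp.out.ne_zero
    have : ExpChar K p := .prime hp.out
    obtain ⟨k, α, hα, hk⟩ := exists_mem_support_not_dvd_of_forall_totalDegree_le p hp.out
      (a := y) (F := f) (fun s hs => by
        refine hs.map_of_injective_injective (frobeniusEquiv F p).symm
          (frobenius K p).toAddMonoidHom (by simp) (by simp) fun r m => ?_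
        change (((frobeniusEquiv F p).symm r • m) ^ p : K) = r • m ^ p
        have hr : (frobeniusEquiv F p).symm r ^ p = r := (frobeniusEquiv F p).apply_symm_apply r
        rw [smul_pow, hr])
      hmin hf0 hfa
    exact ⟨k, α, hα, fun h0 => hk ((CharP.cast_eq_zero_iff F p _).1 h0)⟩

theorem derivative_aeval {A : Type*} [CommRing A] [Algebra F A] [Fintype ι]
    (h : ι → Polynomial A) (f : MvPolynomial ι F) :
    Polynomial.derivative (aeval h f) =
      ∑ k, aeval h (pderiv k f) * Polynomial.derivative (h k) := by
  classical
  induction f using MvPolynomial.induction_on with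
  | C a =>
    simp only [algHom_C, pderiv_C, map_zero, zero_mul, Finset.sum_const_zero]
    exact Polynomial.derivative_C
  | add p q hp hq => simp [hp, hq, add_mul, Finset.sum_add_distrib]
  | mul_X p i hp =>
    rw [map_mul, aeval_X, Polynomial.derivative_mul, hp, Finset.sum_mul]
    have h1 : ∀ k, aeval h (pderiv k (p * X i)) * Polynomial.derivative (h k) =
        aeval h (pderiv k p) * Polynomial.derivative (h k) * h i +
          (if k = i then aeval h p * Polynomial.derivative (h k) else 0) := by
      intro k
      rw [pderiv_mul, map_add, map_mul, map_mul, aeval_X]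
      split_ifs with hk
      · subst hk; rw [pderiv_X_self, map_one]; ring
      · rw [pderiv_X_of_ne (Ne.symm hk), map_zero]; ring
    simp only [h1, Finset.sum_add_distrib, Finset.sum_ite_eq', Finset.mem_univ, if_true]

theorem isSeparable_of_aeval_derivative_ne_zero {E : Type*} [Field E] [Algebra E K] {t : K}
    {g : Polynomial E} (h0 : Polynomial.aeval t g = 0)
    (h1 : Polynomial.aeval t (Polynomial.derivative g) ≠ 0) : IsSeparable E t := by
  have hg : g ≠ 0 := by rintro rfl; simp at h1
  have hInt : IsIntegral E t := (IsAlgebraic.isIntegral ⟨g, hg, h0⟩)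
  rw [IsSeparable, Polynomial.separable_iff_derivative_ne_zero (minpoly.irreducible hInt)]
  intro h2
  obtain ⟨q, rfl⟩ := minpoly.dvd E t h0
  simp [h2] at h1

end

section

variable {F R ι : Type*} [Field F] [CommRing R] [Algebra F R]

theorem aeval_monomial_sub_mem {y : ι → R} {a : ι → F} {t : R} {W' W : Submodule F R}
    (hW : W' ≤ W) (ht : t ∈ W) (hy : ∀ i, y i - a i • t ∈ W') (d : ℕ) (α : ι →₀ ℕ)
    (hα : α.degree = d + 1) :
    aeval y (monomial α (1 : F)) - eval a (monomial α 1) • t ^ (d + 1) ∈ W' * W ^ d := by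
  classical
  induction d generalizing α with
  | zero =>
    obtain ⟨i, rfl⟩ := (Finsupp.sum_eq_one_iff α).1 hα
    have := hy i
    simpa [aeval_monomial, eval_monomial] using this
  | succ d ih =>
    have h0 : α ≠ 0 := by rintro rfl; simp at hα
    obtain ⟨i, hi⟩ := Finsupp.support_nonempty_iff.2 h0
    have h1 : Finsupp.single i 1 + (α - Finsupp.single i 1) = α :=
      add_tsub_cancel_of_le (Finsupp.single_le_iff.2
        (Nat.one_le_iff_ne_zero.2 (Finsupp.mem_support_iff.1 hi)))
    set β : ι →₀ ℕ := α - Finsupp.single i 1 with hβ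
    have h2 : β.degree = d + 1 := by
      have := congrArg Finsupp.degree h1
      rw [map_add, Finsupp.degree_single, hα] at this
      omega
    have h3 := ih β h2
    have h4 : monomial α (1 : F) = X i * monomial β 1 := by
      rw [← h1, X, monomial_mul, one_mul]
    rw [h4, map_mul, map_mul, aeval_X, eval_X]
    set A := aeval y (monomial β (1 : F))
    set c := eval a (monomial β (1 : F))
    have h5 : y i * A - (a i * c) • t ^ (d + 1 + 1) =
        y i * (A - c • t ^ (d + 1)) + c • ((y i - a i • t) * t ^ (d + 1)) := by
      simp only [Algebra.smul_def, map_mul]; ring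
    have hyW : y i ∈ W := by
      have := W.add_mem (hW (hy i)) (W.smul_mem (a i) ht)
      rwa [sub_add_cancel] at this
    rw [h5]
    refine add_mem ?_ (Submodule.smul_mem _ _ (Submodule.mul_mem_mul (hy i)
      (Submodule.pow_mem_pow _ ht _)))
    have h6 := Submodule.mul_mem_mul hyW h3
    rwa [mul_left_comm, ← pow_succ'] at h6

theorem aeval_sub_mem {y : ι → R} {a : ι → F} {t : R} {W' W : Submodule F R}
    (hW : W' ≤ W) (ht : t ∈ W) (hy : ∀ i, y i - a i • t ∈ W') {d : ℕ} {p : MvPolynomial ι F}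
    (hp : p.IsHomogeneous (d + 1)) :
    aeval y p - eval a p • t ^ (d + 1) ∈ W' * W ^ d := by
  have h1 : aeval y p - eval a p • t ^ (d + 1) = ∑ α ∈ p.support, coeff α p •
      (aeval y (monomial α (1 : F)) - eval a (monomial α 1) • t ^ (d + 1)) := by
    conv_lhs => rw [← p.support_sum_monomial_coeff]
    simp only [map_sum, Finset.sum_smul, ← Finset.sum_sub_distrib]
    refine Finset.sum_congr rfl fun α _ => ?_
    simp only [aeval_monomial, eval_monomial, Algebra.smul_def, map_mul, map_one]
    ring
  rw [h1]
  refine sum_mem fun α hα => Submodule.smul_mem _ _ (aeval_monomial_sub_mem hW ht hy d α ?_)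
  rw [← hp (mem_support_iff.1 hα), Finsupp.degree_eq_weight_one]
  rfl

theorem pow_succ_le_sup {W' W : Submodule F R} {t : R} (hW : W ≤ W' ⊔ Submodule.span F {t})
    (ht : t ∈ W) (d : ℕ) : W ^ (d + 1) ≤ W' * W ^ d ⊔ Submodule.span F {t ^ (d + 1)} := by
  induction d with
  | zero => simpa using hW
  | succ d ih =>
    have htd : Submodule.span F {t ^ (d + 1)} ≤ W ^ (d + 1) :=
      (Submodule.span_singleton_le_iff_mem _ _).2 (Submodule.pow_mem_pow _ ht _)
    calc W ^ (d + 1 + 1) = W * W ^ (d + 1) := pow_succ' _ _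
      _ ≤ W * (W' * W ^ d ⊔ Submodule.span F {t ^ (d + 1)}) := mul_le_mul_right ih _
      _ = W' * W ^ (d + 1) ⊔ W * Submodule.span F {t ^ (d + 1)} := by
        rw [Submodule.mul_sup, mul_left_comm, ← pow_succ']
      _ ≤ W' * W ^ (d + 1) ⊔ (W' ⊔ Submodule.span F {t}) * Submodule.span F {t ^ (d + 1)} :=
        sup_le_sup_left (mul_le_mul_left hW _) _
      _ ≤ _ := by
        rw [Submodule.sup_mul, Submodule.span_mul_span, Set.singleton_mul_singleton, ← pow_succ']
        exact sup_le le_sup_left (sup_le_sup_right (mul_le_mul_right htd _) _)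

/-- A projection from a point off the tangent cone at infinity is a reduction. -/
theorem pow_le_of_relation {n : ℕ} {y : Fin (n + 1) → R} {a : Fin (n + 1) → F}
    {W' W : Submodule F R} (hWy : W = linSpan F y) (h1 : 1 ∈ W') (hW : W' ≤ W)
    (hy : ∀ i, y i - a i • y (Fin.last n) ∈ W')
    {f : MvPolynomial (Fin (n + 1)) F} {e : ℕ} (hfe : f.totalDegree = e + 1) (hf : aeval y f = 0)
    (ha : eval a (homogeneousComponent (e + 1) f) ≠ 0) : W ^ (e + 1) ≤ W' * W ^ e := by
  set t := y (Fin.last n) with htdef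
  have ht : t ∈ W := hWy ▸ mem_linSpan y _
  have h1W : 1 ∈ W := hW h1
  have hWW : W ^ e ≤ W' * W ^ e := by
    simpa using mul_le_mul_left (Submodule.one_le.2 h1) (W ^ e)
  have hsup : W ≤ W' ⊔ Submodule.span F {t} := by
    rw [hWy]
    refine linSpan_le (Submodule.mem_sup_left h1) fun i => ?_
    rw [← sub_add_cancel (y i) (a i • t)]
    exact add_mem (Submodule.mem_sup_left (hy i))
      (Submodule.mem_sup_right (Submodule.smul_mem _ _ (Submodule.mem_span_singleton_self t)))
  have hmem : t ^ (e + 1) ∈ W' * W ^ e := by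
    have h2 := aeval_sub_mem hW ht hy (homogeneousComponent_isHomogeneous (e + 1) f)
    have h3 : aeval y (homogeneousComponent (e + 1) f) ∈ W' * W ^ e := by
      have h4 := sum_homogeneousComponent f
      rw [hfe, Finset.sum_range_succ] at h4
      have h5 := congrArg (aeval y) h4
      rw [hf, map_add, add_comm, map_sum] at h5
      rw [eq_neg_of_add_eq_zero_left h5]
      refine neg_mem (sum_mem fun i hi => hWW ?_)
      have h6 := aeval_mem_linSpan_pow y (homogeneousComponent i f)
      rw [← hWy] at h6
      refine pow_le_pow_of_one_mem h1W ?_ h6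
      exact (homogeneousComponent_isHomogeneous i f).totalDegree_le.trans
        (Nat.lt_succ_iff.1 (Finset.mem_range.1 hi))
    have h7 := sub_mem h3 h2
    rw [sub_sub_cancel] at h7
    have h8 := Submodule.smul_mem _ (eval a (homogeneousComponent (e + 1) f))⁻¹ h7
    rwa [smul_smul, inv_mul_cancel₀ ha, one_smul] at h8
  exact (pow_succ_le_sup hsup ht e).trans
    (sup_le le_rfl ((Submodule.span_singleton_le_iff_mem _ _).2 hmem))

theorem reduction_trans {U V W : Submodule F R} (hVW : V ≤ W) {N e : ℕ}
    (h1 : W ^ (N + 1) ≤ V * W ^ N) (h2 : V ^ (e + 1) ≤ U * V ^ e) :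
    W ^ (N + e + 1) ≤ U * W ^ (N + e) :=
  calc W ^ (N + e + 1) ≤ V ^ (e + 1) * W ^ N := by
        rw [add_assoc]; exact pow_add_le_pow_mul h1 (e + 1)
    _ ≤ U * V ^ e * W ^ N := mul_le_mul_left h2 _
    _ ≤ U * W ^ e * W ^ N := mul_le_mul_left (mul_le_mul_right (pow_le_pow_left' hVW e) _) _
    _ = U * W ^ (N + e) := by rw [mul_assoc, ← pow_add, add_comm e]

end

section

variable {F K ι : Type*} [Field F] [Field K] [Algebra F K]

/-- A finite linear projection that is separable over its image. -/
structure IsReduction (F : Type*) {K ι κ : Type*} [Field F] [Field K] [Algebra F K] (x : ι → K)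
    (y : κ → K) : Prop where
  le : linSpan F y ≤ linSpan F x
  pow_le : ∃ N, linSpan F x ^ (N + 1) ≤ linSpan F y * linSpan F x ^ N
  separable : Algebra.IsSeparable (IntermediateField.adjoin F (Set.range y)) K

theorem isSeparable_adjoin_of_isSeparable {κ κ' : Type*} {y : κ → K} {y' : κ' → K}
    [Algebra.IsSeparable (IntermediateField.adjoin F (Set.range y)) K]
    (h : ∀ i, IsSeparable (IntermediateField.adjoin F (Set.range y')) (y i)) :
    Algebra.IsSeparable (IntermediateField.adjoin F (Set.range y')) K := by
  set E := IntermediateField.adjoin F (Set.range y)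
  set E' := IntermediateField.adjoin F (Set.range y')
  have hle : E ≤ (separableClosure E' K).restrictScalars F := by
    refine IntermediateField.adjoin_le_iff.2 ?_
    rintro _ ⟨i, rfl⟩
    exact mem_separableClosure_iff.2 (h i)
  let L := separableClosure E' K
  let _ : Algebra E L := (IntermediateField.inclusion hle).toRingHom.toAlgebra
  have : IsScalarTower E L K := .of_algebraMap_eq fun _ => rfl
  refine ⟨fun a => ?_⟩
  have h1 : IsSeparable L a := (Algebra.IsSeparable.isSeparable E a).tower_top L
  exact IsSeparable.of_algebra_isSeparable_of_isSeparable (E := L) E' h1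

/-- The conditions on a point that make the projection from it a separable reduction. -/
theorem exists_good_polynomial [PerfectField F] {n : ℕ} {y : Fin (n + 1) → K}
    (h : ¬ AlgebraicIndependent F y) :
    ∃ (f : MvPolynomial (Fin (n + 1)) F) (e : ℕ) (g : MvPolynomial (Fin (n + 1)) F),
      f.totalDegree = e + 1 ∧ aeval y f = 0 ∧ g ≠ 0 ∧
      ∀ a : Fin (n + 1) → F, eval a g ≠ 0 → eval a (homogeneousComponent (e + 1) f) ≠ 0 ∧
        ∑ k, a k • aeval y (pderiv k f) ≠ 0 := by
  obtain ⟨f, hf0, hf, k, hk⟩ := exists_relation h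
  have hdeg : f.totalDegree ≠ 0 := by
    intro h0
    have := totalDegree_eq_zero_iff_eq_C.1 h0
    rw [this, aeval_C, map_eq_zero] at hf
    rw [hf, map_zero] at this
    exact hf0 this
  obtain ⟨e, he⟩ := Nat.exists_eq_succ_of_ne_zero hdeg
  obtain ⟨l, hl⟩ := Module.Projective.exists_dual_ne_zero F hk
  have hcomp : homogeneousComponent (e + 1) f ≠ 0 := by
    obtain ⟨m, hm, hmd⟩ := Finset.exists_mem_eq_sup _ (support_nonempty.2 hf0)
      (fun s : Fin (n + 1) →₀ ℕ => s.sum fun _ e => e)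
    intro h0
    have h1 := coeff_homogeneousComponent (e + 1) f m
    have h2 : m.degree = e + 1 := hmd.symm.trans he
    rw [h0, if_pos h2, coeff_zero] at h1
    exact mem_support_iff.1 hm h1.symm
  have hlin : (∑ i, C (l (aeval y (pderiv i f))) * X i : MvPolynomial (Fin (n + 1)) F) ≠ 0 := by
    intro h0
    have h1 := congrArg (eval (Pi.single k 1)) h0
    simp [Pi.single_apply] at h1
    exact hl h1
  refine ⟨f, e, _, he, hf, mul_ne_zero hcomp hlin, fun a ha => ?_⟩
  rw [map_mul] at ha
  refine ⟨left_ne_zero_of_mul ha, fun h0 => right_ne_zero_of_mul ha ?_⟩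
  have h1 := congrArg l h0
  simpa [mul_comm] using h1

theorem IsReduction.project {n : ℕ} {x : ι → K} {y : Fin (n + 1) → K} (hxy : IsReduction F x y)
    {f : MvPolynomial (Fin (n + 1)) F} {e : ℕ} (hfe : f.totalDegree = e + 1) (hf : aeval y f = 0)
    {a : Fin (n + 1) → F} (ha1 : a (Fin.last n) = 1)
    (ha : eval a (homogeneousComponent (e + 1) f) ≠ 0)
    (hd : ∑ k, a k • aeval y (pderiv k f) ≠ 0) :
    IsReduction F x fun i : Fin n => y i.castSucc - a i.castSucc • y (Fin.last n) := by
  set t := y (Fin.last n) with ht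
  set y' : Fin n → K := fun i : Fin n => y i.castSucc - a i.castSucc • t with hy'
  have hW : linSpan F y' ≤ linSpan F y := linSpan_le (one_mem_linSpan y) fun i =>
    sub_mem (mem_linSpan y _) (Submodule.smul_mem _ _ (mem_linSpan y _))
  have hyW : ∀ i, y i - a i • t ∈ linSpan F y' := by
    intro i
    refine Fin.lastCases ?_ (fun i => ?_) i
    · rw [ha1, one_smul, sub_self]; exact zero_mem _
    · exact mem_linSpan y' i
  obtain ⟨N, hN⟩ := hxy.pow_le
  refine ⟨hW.trans hxy.le, ⟨N + e, reduction_trans hxy.le hN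
    (pow_le_of_relation rfl (one_mem_linSpan y') hW hyW hfe hf ha)⟩, ?_⟩
  have := hxy.separable
  apply isSeparable_adjoin_of_isSeparable (y := y)
  set E' := IntermediateField.adjoin F (Set.range y') with hE'
  have hmem : ∀ i, y i - a i • t ∈ E' := fun i =>
    linSpan_pow_subset_adjoin y' 1 _ (by rw [pow_one]; exact hyW i)
  let h : Fin (n + 1) → Polynomial E' := fun i =>
    Polynomial.C ⟨y i - a i • t, hmem i⟩ + Polynomial.C (algebraMap F E' (a i)) * Polynomial.X
  have hat : ∀ p : MvPolynomial (Fin (n + 1)) F, Polynomial.aeval t (aeval h p) = aeval y p := by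
    intro p
    have h1 : ((Polynomial.aeval (R := E') t).restrictScalars F).comp (aeval h) =
        aeval (R := F) y := by
      ext i
      have h2 : algebraMap E' K (algebraMap F E' (a i)) = algebraMap F K (a i) :=
        (IsScalarTower.algebraMap_apply F E' K (a i)).symm
      simp only [h, AlgHom.comp_apply, aeval_X, AlgHom.restrictScalars_apply, map_add, map_mul,
        Polynomial.aeval_C, Polynomial.aeval_X, h2]
      change y i - a i • t + _ = _
      rw [Algebra.smul_def, sub_add_cancel]
    exact DFunLike.congr_fun h1 p
  have hts : IsSeparable E' t := by
    refine isSeparable_of_aeval_derivative_ne_zero (g := aeval h f) ((hat f).trans hf) ?_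
    rw [derivative_aeval]
    convert hd using 1
    rw [map_sum]
    refine Finset.sum_congr rfl fun k _ => ?_
    have h2 : algebraMap E' K (algebraMap F E' (a k)) = algebraMap F K (a k) :=
      (IsScalarTower.algebraMap_apply F E' K (a k)).symm
    rw [map_mul, hat]
    simp only [h, Polynomial.derivative_add, Polynomial.derivative_C, zero_add,
      Polynomial.derivative_C_mul, Polynomial.derivative_X, mul_one, Polynomial.aeval_C, h2]
    rw [Algebra.smul_def, mul_comm]
  intro i
  have h3 : y i = algebraMap E' K ⟨y i - a i • t, hmem i⟩ +
      algebraMap E' K (algebraMap F E' (a i)) * t := by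
    have h2 : algebraMap E' K (algebraMap F E' (a i)) = algebraMap F K (a i) :=
      (IsScalarTower.algebraMap_apply F E' K (a i)).symm
    rw [h2, ← Algebra.smul_def]
    exact (sub_add_cancel _ _).symm
  rw [h3, ← mem_separableClosure_iff]
  exact add_mem (algebraMap_mem _ _) (mul_mem (algebraMap_mem _ _) (mem_separableClosure_iff.2 hts))

/-- Finitely many affine algebras of the same dimension admit a common separable linear
Noether normalization. -/
theorem exists_common_reduction [IsAlgClosed F] {J : Type*} [Finite J] {K : J → Type*}
    [∀ j, Field (K j)] [∀ j, Algebra F (K j)] {n₀ ρ : ℕ} (x : ∀ j, Fin n₀ → K j)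
    (htop : ∀ j, IntermediateField.adjoin F (Set.range (x j)) = ⊤)
    (hρ : ∀ j, Algebra.trdeg F (K j) = ρ) (hn : ρ ≤ n₀) :
    ∃ c : Fin ρ → Fin n₀ → F, ∀ j, IsReduction F (x j) (fun i => ∑ k, c i k • x j k) := by
  classical
  cases nonempty_fintype J
  obtain ⟨m, rfl⟩ := Nat.exists_eq_add_of_le hn
  suffices h : ∀ k ≤ m, ∃ c : Fin (ρ + k) → Fin (ρ + m) → F, ∀ j,
      IsReduction F (x j) (fun i => ∑ k, c i k • x j k) from h 0 (Nat.zero_le m)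
  intro k hk
  refine Nat.decreasingInduction' (P := fun k => ∃ c : Fin (ρ + k) → Fin (ρ + m) → F, ∀ j,
      IsReduction F (x j) (fun i => ∑ k, c i k • x j k)) ?_ hk ?_
  rotate_left
  ·
    refine ⟨fun i => Pi.single i 1, fun j => ?_⟩
    have h1 : (fun i => ∑ k, (Pi.single i 1 : Fin (ρ + m) → F) k • x j k) = x j := by
      ext i
      simp [Pi.single_apply]
    rw [h1]
    refine ⟨le_rfl, ⟨0, by simp⟩, ?_⟩
    rw [htop]
    refine ⟨fun a => ?_⟩
    exact isSeparable_algebraMap (⟨a, trivial⟩ : (⊤ : IntermediateField F (K j)))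
  · intro k hkm _ ih
    obtain ⟨c, hc⟩ := ih
    have hdep : ∀ j, ¬ AlgebraicIndependent F (fun i => ∑ k, c i k • x j k) := by
      intro j hind
      have h1 := hind.lift_cardinalMk_le_trdeg
      rw [hρ j] at h1
      simp at h1
      norm_cast at h1
      omega
    choose f e g hfe hf hg hgood using fun j => exists_good_polynomial (n := ρ + k) (hdep j)
    have hprod : (∏ j, g j) * X (Fin.last (ρ + k)) ≠ 0 :=
      mul_ne_zero (Finset.prod_ne_zero_iff.2 fun j _ => hg j) (X_ne_zero _)
    obtain ⟨a, ha⟩ : ∃ a, eval a ((∏ j, g j) * X (Fin.last (ρ + k))) ≠ 0 := by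
      by_contra! h0
      exact hprod (MvPolynomial.funext fun a => by rw [h0 a, map_zero])
    rw [map_mul, eval_X, map_prod] at ha
    have hlast := right_ne_zero_of_mul ha
    have hj := Finset.prod_ne_zero_iff.1 (left_ne_zero_of_mul ha)
    set s := (a (Fin.last (ρ + k)))⁻¹ with hs
    have hs0 : s ≠ 0 := inv_ne_zero hlast
    refine ⟨fun i l => c i.castSucc l - (s • a) i.castSucc * c (Fin.last _) l, fun j => ?_⟩
    have h2 := hgood j a (hj j (Finset.mem_univ j))
    have h3 := (hc j).project (hfe j) (hf j) (a := s • a) (inv_mul_cancel₀ hlast)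
      (by
        rw [eval_smul_of_isHomogeneous (homogeneousComponent_isHomogeneous _ _)]
        exact mul_ne_zero (pow_ne_zero _ hs0) h2.1)
      (by
        simp only [Pi.smul_apply, smul_assoc, ← Finset.smul_sum]
        exact smul_ne_zero hs0 h2.2)
    refine cast (congrArg (IsReduction F (x j)) (funext fun i => ?_)) h3
    simp only [sub_smul, Finset.sum_sub_distrib, mul_smul, ← Finset.smul_sum]

end

section

variable {F R K ι : Type*} [Field F] [CommRing R] [Algebra F R] [Field K] [Algebra F K]

theorem linSpan_comp_equiv {ι' : Type*} (e : ι' ≃ ι) (x : ι → R) :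
    linSpan F (x ∘ e) = linSpan F x := by
  rw [linSpan, linSpan, EquivLike.range_comp]

/-- The transcendence degree as a natural number. -/
def dimOver (F R : Type*) [Field F] [CommRing R] [Algebra F R] : ℕ :=
  Cardinal.toNat (Algebra.trdeg F R)

theorem cast_dimOver [Algebra.FiniteType F R] : (dimOver F R : Cardinal) = Algebra.trdeg F R :=
  Cardinal.cast_toNat_of_lt_aleph0 trdeg_lt_aleph0_of_finiteType

theorem trdeg_fractionRing [IsDomain R] :
    Algebra.trdeg F (FractionRing R) = Algebra.trdeg F R := by
  have h := trdeg_add_eq F R (A := FractionRing R)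
  have : Algebra.IsAlgebraic R (FractionRing R) := IsLocalization.isAlgebraic _ (nonZeroDivisors R)
  have h0 : Algebra.trdeg R (FractionRing R) = 0 := trdeg_eq_zero
  rw [← h, h0, add_zero]

theorem adjoin_algebraMap_eq_top [IsDomain R] {x : ι → R}
    (hx : Algebra.adjoin F (Set.range x) = ⊤) :
    IntermediateField.adjoin F (Set.range (algebraMap R (FractionRing R) ∘ x)) = ⊤ := by
  rw [eq_top_iff]
  set E := IntermediateField.adjoin F (Set.range (algebraMap R (FractionRing R) ∘ x))
  have h1 : ∀ r : R, algebraMap R (FractionRing R) r ∈ E := by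
    have h2 : Algebra.adjoin F (Set.range x) ≤
        E.toSubalgebra.comap (IsScalarTower.toAlgHom F R (FractionRing R)) := by
      refine Algebra.adjoin_le ?_
      rintro _ ⟨i, rfl⟩
      exact IntermediateField.subset_adjoin _ _ ⟨i, rfl⟩
    intro r
    exact h2 (by rw [hx]; trivial)
  intro a _
  obtain ⟨p, q, _, rfl⟩ := IsFractionRing.div_surjective (A := R) a
  exact div_mem (h1 p) (h1 q)

theorem IsReduction.isAlgebraic {κ : Type*} {x : ι → K} {y : κ → K} (h : IsReduction F x y) :
    Algebra.IsAlgebraic (Algebra.adjoin F (Set.range y)) K := by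
  rw [← IntermediateField.isAlgebraic_adjoin_iff_top]
  have := h.separable
  infer_instance

theorem IsReduction.algebraicIndependent {ρ : ℕ} {x : ι → K} {y : Fin ρ → K}
    (h : IsReduction F x y) (hρ : Algebra.trdeg F K = ρ) : AlgebraicIndependent F y := by
  have := h.isAlgebraic
  exact (Algebra.IsAlgebraic.isTranscendenceBasis_of_lift_le_trdeg_of_finite F y (by simp [hρ])).1

theorem trdeg_le_of_adjoin_eq_top {n : ℕ} {x : Fin n → K}
    (htop : IntermediateField.adjoin F (Set.range x) = ⊤) {ρ : ℕ}
    (hρ : Algebra.trdeg F K = ρ) : ρ ≤ n := by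
  have : Algebra.IsAlgebraic (Algebra.adjoin F (Set.range x)) K := by
    rw [← IntermediateField.isAlgebraic_adjoin_iff_top, htop]
    exact ⟨fun a => isAlgebraic_algebraMap (⟨a, trivial⟩ : (⊤ : IntermediateField F K))⟩
  have h := Algebra.IsAlgebraic.trdeg_le_cardinalMk F (Set.range x) 
  rw [hρ] at h
  have h2 := Cardinal.mk_range_le_lift (f := x)
  simp at h2
  exact_mod_cast h.trans h2

theorem exists_reduction [IsAlgClosed F] [Finite ι] (x : ι → K) {ρ : ℕ}
    (htop : IntermediateField.adjoin F (Set.range x) = ⊤) (hρ : Algebra.trdeg F K = ρ) :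
    ∃ y : Fin ρ → K, IsReduction F x y := by
  obtain ⟨n, ⟨e⟩⟩ := Finite.exists_equiv_fin ι
  have htop' : IntermediateField.adjoin F (Set.range (x ∘ e.symm)) = ⊤ := by
    rwa [EquivLike.range_comp]
  obtain ⟨c, hc⟩ := exists_common_reduction (J := Unit) (K := fun _ => K) (fun _ => x ∘ e.symm)
    (fun _ => htop') (fun _ => hρ) (trdeg_le_of_adjoin_eq_top htop' hρ)
  obtain ⟨h1, h2, h3⟩ := hc ()
  rw [linSpan_comp_equiv] at h1 h2
  exact ⟨_, h1, h2, h3⟩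

theorem exists_hasDeg [IsAlgClosed F] [Finite ι] [IsDomain R] (x : ι → R)
    (hx : Algebra.adjoin F (Set.range x) = ⊤) :
    ∃ δ, 0 < δ ∧ HasDeg F x (dimOver F R) δ := by
  have : Algebra.FiniteType F R := ⟨⟨(Set.finite_range x).toFinset, by simpa using hx⟩⟩
  have htop := adjoin_algebraMap_eq_top hx
  have hρ : Algebra.trdeg F (FractionRing R) = dimOver F R := by
    rw [trdeg_fractionRing, cast_dimOver]
  obtain ⟨y, hy⟩ := exists_reduction _ htop hρ
  obtain ⟨N, hN⟩ := hy.pow_le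
  obtain ⟨hfin, hdeg⟩ := hasDeg_of_reduction (hy.algebraicIndependent hρ) hy.le hN htop
  exact ⟨_, Module.finrank_pos, hdeg.of_injective (IsScalarTower.toAlgHom F R (FractionRing R))
    (IsFractionRing.injective R (FractionRing R))⟩

end

section primes

variable {F σ : Type*} [Field F]

/-- The coordinate functions modulo an ideal. -/
def coord (P : Ideal (MvPolynomial σ F)) (i : σ) : MvPolynomial σ F ⧸ P :=
  Ideal.Quotient.mk P (X i)

/-- The dimension of the zero locus of a prime ideal. -/
def pdim (P : Ideal (MvPolynomial σ F)) : ℕ := dimOver F (MvPolynomial σ F ⧸ P)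

open Classical in
/-- The degree of the zero locus of a prime ideal. -/
def pdeg (P : Ideal (MvPolynomial σ F)) : ℕ :=
  if h : ∃ δ, HasDeg F (coord P) (pdim P) δ then h.choose else 0

theorem adjoin_coord (P : Ideal (MvPolynomial σ F)) :
    Algebra.adjoin F (Set.range (coord P)) = ⊤ := by
  have h : Set.range (coord P) = (Ideal.Quotient.mkₐ F P) '' Set.range X := by
    rw [← Set.range_comp]; rfl
  rw [h, ← AlgHom.map_adjoin, adjoin_range_X, Algebra.map_top, AlgHom.range_eq_top]
  exact Ideal.Quotient.mkₐ_surjective F P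

variable {P : Ideal (MvPolynomial σ F)}

theorem HasDeg.pdeg_eq {δ : ℕ} (h : HasDeg F (coord P) (pdim P) δ) : pdeg P = δ := by
  have hex : ∃ δ, HasDeg F (coord P) (pdim P) δ := ⟨δ, h⟩
  rw [pdeg, dif_pos hex]
  exact le_antisymm (hex.choose_spec.le h) (h.le hex.choose_spec)

theorem hasDeg_pdeg [IsAlgClosed F] [Finite σ] [P.IsPrime] :
    HasDeg F (coord P) (pdim P) (pdeg P) := by
  obtain ⟨δ, _, h⟩ := exists_hasDeg (coord P) (adjoin_coord P)
  have h' : HasDeg F (coord P) (pdim P) δ := h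
  rwa [h'.pdeg_eq]

theorem pdeg_pos [IsAlgClosed F] [Finite σ] [P.IsPrime] : 0 < pdeg P := by
  obtain ⟨δ, h0, h⟩ := exists_hasDeg (coord P) (adjoin_coord P)
  have h' : HasDeg F (coord P) (pdim P) δ := h
  rwa [h'.pdeg_eq]

end primes

section

universe u

variable {F : Type*} [Field F]

theorem degreeOf_rename_of_notMem_range {σ τ : Type*} {f : σ → τ} {i : τ}
    (hi : i ∉ Set.range f) (p : MvPolynomial σ F) : degreeOf i (rename f p) = 0 := by
  classical
  rw [degreeOf_def, Multiset.count_eq_zero]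
  intro h
  have := vars_rename f p (Multiset.mem_toFinset.2 h)
  simp only [Finset.mem_image] at this
  obtain ⟨a, _, rfl⟩ := this
  exact hi ⟨a, rfl⟩

theorem trdeg_lt_of_surjective {R R' : Type u} [CommRing R] [IsDomain R] [Algebra F R]
    [CommRing R'] [IsDomain R'] [Algebra F R'] [Algebra.FiniteType F R] (f : R →ₐ[F] R')
    (hf : Function.Surjective f) {a : R} (ha0 : a ≠ 0) (ha : f a = 0) :
    Algebra.trdeg F R' < Algebra.trdeg F R := by
  have hft : Algebra.FiniteType F R' := .of_surjective f hf
  by_contra! hle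
  obtain ⟨s, hs⟩ := exists_isTranscendenceBasis F R'
  have hcard := hs.cardinalMk_eq_trdeg
  have hfin : Finite s := by
    rw [← Cardinal.lt_aleph0_iff_finite, hcard]
    exact trdeg_lt_aleph0_of_finiteType
  choose w hw using fun i : s => hf i.1
  have hwz : ∀ p : MvPolynomial s F, aeval (Subtype.val : s → R') p = f (aeval w p) := by
    intro p
    have : (Subtype.val : s → R') = fun i => f (w i) := by
      funext i; exact (hw i).symm
    rw [this, comp_aeval_apply]
  have hwi : AlgebraicIndependent F w := by
    rw [algebraicIndependent_iff]
    intro p hp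
    apply (algebraicIndependent_iff.1 hs.1) p
    rw [hwz, hp, map_zero]
  have htb := hwi.isTranscendenceBasis_of_trdeg_le_of_finite (by rw [hcard]; exact hle)
  have halg := htb.isAlgebraic.isAlgebraic a
  obtain ⟨r, hr0, hr⟩ := halg.exists_nonzero_dvd (mem_nonZeroDivisors_of_ne_zero ha0)
  have hrq : f (r : R) = 0 := by
    have := map_dvd f hr
    rw [ha, zero_dvd_iff] at this
    exact this
  obtain ⟨p, hp⟩ : ∃ p, aeval w p = (r : R) :=
    (Algebra.adjoin_range_eq_range_aeval F w).le r.2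
  apply hr0
  have hp0 : p = 0 := by
    apply (algebraicIndependent_iff.1 hs.1) p
    rw [hwz]
    rw [← hrq]
    exact congrArg f hp
  apply Subtype.ext
  rw [← hp, hp0, map_zero, ZeroMemClass.coe_zero]

theorem le_trdeg_quotient_span {s : ℕ} {g : MvPolynomial (Fin s) F} (hg : Prime g) :
    (s : Cardinal) ≤ Algebra.trdeg F (MvPolynomial (Fin s) F ⧸ Ideal.span {g}) + 1 := by
  classical
  have hvars : g.vars.Nonempty := by
    rw [Finset.nonempty_iff_ne_empty]
    intro h
    rw [vars_eq_empty_iff_eq_C] at h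
    have h0 : coeff 0 g ≠ 0 := by
      intro h0
      rw [h0, C_0] at h
      exact hg.ne_zero h
    apply hg.not_isUnit
    rw [h]
    exact (IsUnit.mk0 _ h0).map C
  obtain ⟨i, hi⟩ := hvars
  have hdeg : degreeOf i g ≠ 0 := by
    rw [degreeOf_def, ne_eq, Multiset.count_eq_zero, not_not]
    rw [vars_def] at hi
    exact Multiset.mem_toFinset.1 hi
  have hind : AlgebraicIndependent F
      (fun j : {j : Fin s // j ≠ i} => Ideal.Quotient.mkₐ F (Ideal.span {g}) (X j.1)) := by
    rw [algebraicIndependent_iff]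
    intro p hp
    rw [← comp_aeval_apply] at hp
    have hp' := Ideal.Quotient.eq_zero_iff_mem.1 hp
    rw [Ideal.mem_span_singleton] at hp'
    obtain ⟨h, hh⟩ := hp'
    have hre : aeval (fun j : {j : Fin s // j ≠ i} => (X j.1 : MvPolynomial (Fin s) F)) p
        = rename Subtype.val p := by
      rw [← aeval_X_left_apply (rename Subtype.val p), aeval_rename]
      rfl
    rw [hre] at hh
    by_contra hp0
    have hne : rename (Subtype.val : {j : Fin s // j ≠ i} → Fin s) p ≠ 0 := by
      rwa [ne_eq, map_eq_zero_iff _ (rename_injective _ Subtype.val_injective)]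
    have hh0 : h ≠ 0 := by
      rintro rfl
      exact hne (by rw [hh, mul_zero])
    have h3 := degreeOf_mul_eq (n := i) hg.ne_zero hh0
    rw [← hh, degreeOf_rename_of_notMem_range (by simp)] at h3
    omega
  have h := hind.lift_cardinalMk_le_trdeg
  have hc : Fintype.card {j : Fin s // j ≠ i} = s - 1 := by
    rw [Fintype.card_subtype_compl, Fintype.card_fin, Fintype.card_subtype_eq]
  rw [Cardinal.mk_fintype, hc] at h
  simp only [Cardinal.lift_natCast, Cardinal.lift_uzero] at h
  calc (s : Cardinal) = ((s - 1 : ℕ) : Cardinal) + 1 := by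
        have : 0 < s := i.pos
        exact_mod_cast (by omega : s = s - 1 + 1)
    _ ≤ _ := by gcongr

theorem trdeg_le_add_one_of_surjective {R R' : Type u} [CommRing R] [IsDomain R] [Algebra F R]
    [CommRing R'] [IsDomain R'] [Algebra F R'] [Algebra.FiniteType F R] (π : R →ₐ[F] R')
    {ℓ : R} (hℓ : ℓ ≠ 0)
    (hq : RingHom.ker π ∈ (Ideal.span {ℓ}).minimalPrimes) :
    Algebra.trdeg F R ≤ Algebra.trdeg F R' + 1 := by
  set q : Ideal R := RingHom.ker π with hqdef
  have hqp : q.IsPrime := hq.1.1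
  have hnoeth : IsNoetherianRing R := Algebra.FiniteType.isNoetherianRing F R
  obtain ⟨s, f, hinj, hInt⟩ := exists_integral_inj_algHom_of_fg F R
  have hht := Ideal.height_le_one_of_isPrincipal_of_mem_minimalPrimes _ q hq
  have hq0 : q ≠ ⊥ := by
    intro h0
    have := hq.1.2 (Ideal.mem_span_singleton_self ℓ)
    rw [h0] at this
    exact hℓ (by simpa using this)
  let _ := f.toRingHom.toAlgebra
  have hst : IsScalarTower F (MvPolynomial (Fin s) F) R :=
    IsScalarTower.of_algebraMap_eq fun r => (f.commutes r).symm
  have hI : Algebra.IsIntegral (MvPolynomial (Fin s) F) R := ⟨hInt⟩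
  have hF : FaithfulSMul (MvPolynomial (Fin s) F) R :=
    (faithfulSMul_iff_algebraMap_injective _ _).2 hinj
  have hs : Algebra.trdeg F R = s := by
    have h := lift_trdeg_add_eq F (MvPolynomial (Fin s) F) R
    have h0 : Algebra.trdeg (MvPolynomial (Fin s) F) R = 0 := trdeg_eq_zero
    rw [h0, trdeg_of_isDomain] at h
    simpa using h.symm
  set p := q.under (MvPolynomial (Fin s) F) with hp
  have hp0 : p ≠ ⊥ := fun h => hq0 (Ideal.eq_bot_of_comap_eq_bot h)
  obtain ⟨g, hgp, hg⟩ := Ideal.IsPrime.exists_mem_prime_of_ne_bot (I := p) inferInstance hp0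
  have hgprime : (Ideal.span {g}).IsPrime := (Ideal.span_singleton_prime hg.ne_zero).2 hg
  have hle : Ideal.span {g} ≤ p := by rwa [Ideal.span_singleton_le_iff_mem]
  have heq : Ideal.span {g} = p := by
    by_contra hne
    obtain ⟨P, hPq, hP, hPo⟩ := Ideal.exists_ideal_lt_liesOver_of_lt q (lt_of_le_of_ne hle hne)
    have hP0 : ⊥ < P := by
      rw [bot_lt_iff_ne_bot]
      rintro rfl
      have := hPo.over
      rw [Ideal.under_bot, Ideal.span_singleton_eq_bot] at this
      exact hg.ne_zero this
    have h1 := Ideal.height_add_one_le_of_lt_of_isPrime hP0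
    have h2 := Ideal.height_add_one_le_of_lt_of_isPrime hPq
    have h3 : (1 : ℕ∞) + 1 ≤ 1 := by
      refine le_trans ?_ (h2.trans hht)
      gcongr
      exact le_trans (by simp) h1
    exact absurd h3 (by decide)
  have h1 := le_trdeg_quotient_span hg
  rw [heq] at h1
  have hpk : ∀ a ∈ p, (π.comp f) a = 0 := fun a ha => ha
  have h2 := lift_trdeg_le_of_injective (Ideal.Quotient.liftₐ p (π.comp f) hpk) (by
    rw [injective_iff_map_eq_zero]
    intro a
    obtain ⟨a, rfl⟩ := Ideal.Quotient.mk_surjective a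
    intro ha
    exact Ideal.Quotient.eq_zero_iff_mem.2 ha)
  rw [hs]
  have h3 := Cardinal.lift_le.2 h1
  rw [Cardinal.lift_add, Cardinal.lift_one] at h3
  have h4 := h3.trans (add_le_add_left h2 1)
  rw [← Cardinal.lift_le]
  simpa using h4

variable {σ : Type*} [Finite σ]

theorem pdim_lt_of_lt {P Q : Ideal (MvPolynomial σ F)} [P.IsPrime] [Q.IsPrime] (h : P < Q) :
    pdim Q < pdim P := by
  obtain ⟨a, haQ, haP⟩ := SetLike.exists_of_lt h
  have h2 := trdeg_lt_of_surjective (Ideal.Quotient.factorₐ F h.le)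
    (Ideal.Quotient.factor_surjective h.le) (a := Ideal.Quotient.mk P a)
    (by rwa [ne_eq, Ideal.Quotient.eq_zero_iff_mem])
    (Ideal.Quotient.eq_zero_iff_mem.2 haQ)
  rw [← cast_dimOver, ← cast_dimOver] at h2
  exact_mod_cast h2

theorem pdim_add_one {P Q : Ideal (MvPolynomial σ F)} [P.IsPrime] {ℓ : MvPolynomial σ F}
    (hℓ : ℓ ∉ P) (hQ : Q ∈ (P ⊔ Ideal.span {ℓ}).minimalPrimes) :
    pdim Q + 1 = pdim P := by
  have hQp : Q.IsPrime := hQ.1.1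
  have hPQ : P < Q := by
    refine lt_of_le_of_ne (le_sup_left.trans hQ.1.2) ?_
    rintro rfl
    exact hℓ (hQ.1.2 (Ideal.mem_sup_right (Ideal.mem_span_singleton_self ℓ)))
  refine le_antisymm (pdim_lt_of_lt hPQ) ?_
  have hq : Q.map (Ideal.Quotient.mk P) ∈
      (Ideal.span {Ideal.Quotient.mk P ℓ}).minimalPrimes := by
    have hs := Ideal.minimalPrimes_map_of_surjective
      (f := Ideal.Quotient.mk P) Ideal.Quotient.mk_surjective (P ⊔ Ideal.span {ℓ})
    have h2 : (P ⊔ Ideal.span {ℓ}).map (Ideal.Quotient.mk P) =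
        Ideal.span {Ideal.Quotient.mk P ℓ} := by
      rw [Ideal.map_sup, Ideal.map_quotient_self, bot_sup_eq, Ideal.map_span, Set.image_singleton]
    rw [h2, Ideal.mk_ker, sup_assoc, sup_comm (Ideal.span {ℓ}), ← sup_assoc, sup_idem] at hs
    rw [hs]
    exact ⟨Q, hQ, rfl⟩
  have hℓ0 : Ideal.Quotient.mk P ℓ ≠ 0 := by rwa [ne_eq, Ideal.Quotient.eq_zero_iff_mem]
  have hk : RingHom.ker (Ideal.Quotient.factorₐ F hPQ.le) = Q.map (Ideal.Quotient.mk P) :=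
    Ideal.Quotient.factor_ker hPQ.le
  rw [← hk] at hq
  have h2 := trdeg_le_add_one_of_surjective _ hℓ0 hq
  rw [← cast_dimOver, ← cast_dimOver] at h2
  exact_mod_cast h2

end

section

variable {F σ : Type*} [Field F]

theorem finrank_add_finrank_le {A B : Type*} [AddCommGroup A] [Module F A] [AddCommGroup B]
    [Module F B] {U L : Submodule F A} [FiniteDimensional F U] (π : A →ₗ[F] B)
    (hLU : L ≤ U) (hL : ∀ a ∈ L, π a = 0) {D : Submodule F B} (hD : D ≤ U.map π) :
    Module.finrank F L + Module.finrank F D ≤ Module.finrank F U := by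
  have h := LinearMap.finrank_range_add_finrank_ker (π.domRestrict U)
  have h1 : Module.finrank F D ≤ Module.finrank F (LinearMap.range (π.domRestrict U)) := by
    apply Submodule.finrank_mono
    rwa [LinearMap.range_domRestrict]
  have h2 : Module.finrank F L ≤ Module.finrank F (LinearMap.ker (π.domRestrict U)) := by
    let f : L →ₗ[F] LinearMap.ker (π.domRestrict U) :=
      LinearMap.codRestrict _ (Submodule.inclusion hLU) (fun a => hL a a.2)
    refine LinearMap.finrank_le_finrank_of_injective (f := f) ?_
    intro a b hab
    exact Submodule.inclusion_injective hLU (congrArg Subtype.val hab)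
  omega

theorem exists_mem_primes_notMem {J R : Type*} [Finite J] [CommRing R] {Q : J → Ideal R}
    (hQ : ∀ j, (Q j).IsPrime) (hinc : ∀ i j, Q i ≤ Q j → i = j) (j : J) :
    ∃ f, f ∉ Q j ∧ ∀ i, i ≠ j → f ∈ Q i := by
  classical
  cases nonempty_fintype J
  have h : ¬ (Finset.univ.erase j).inf Q ≤ Q j := by
    rw [(hQ j).inf_le']
    rintro ⟨i, hi, hle⟩
    exact (Finset.mem_erase.1 hi).1 (hinc i j hle)
  obtain ⟨f, hf, hfj⟩ := SetLike.not_le_iff_exists.1 h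
  refine ⟨f, hfj, fun i hi => ?_⟩
  exact Finset.inf_le (f := Q) (Finset.mem_erase.2 ⟨hi, Finset.mem_univ i⟩) hf

theorem coord_eq (P : Ideal (MvPolynomial σ F)) : coord P = Ideal.Quotient.mkₐ F P ∘ X := rfl

theorem mk_mem_linSpan_coord_pow (P : Ideal (MvPolynomial σ F)) {f : MvPolynomial σ F} {m : ℕ}
    (hf : f ∈ linSpan F X ^ m) : Ideal.Quotient.mkₐ F P f ∈ linSpan F (coord P) ^ m := by
  rw [coord_eq, ← map_linSpan_pow]
  exact ⟨f, hf, rfl⟩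

/-- The Hilbert function of an affine coordinate ring. -/
def hilb (P : Ideal (MvPolynomial σ F)) (m : ℕ) : ℕ :=
  Module.finrank F (linSpan F (coord P) ^ m : Submodule F _)

variable [Finite σ]

theorem hilb_mono (P : Ideal (MvPolynomial σ F)) : Monotone (hilb P) := fun _ _ h =>
  Submodule.finrank_mono (pow_le_pow_of_one_mem (one_mem_linSpan _) h)

theorem sum_hilb_add_le {J : Type*} [Fintype J] {P : Ideal (MvPolynomial σ F)} [P.IsPrime]
    {Q : J → Ideal (MvPolynomial σ F)} (hQ : ∀ j, (Q j).IsPrime)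
    (hinc : ∀ i j, Q i ≤ Q j → i = j) (hPQ : ∀ j, P ≤ Q j) {ℓ : MvPolynomial σ F}
    (hℓ : ℓ ∈ linSpan F X) (hℓP : ℓ ∉ P) (hℓQ : ∀ j, ℓ ∈ Q j) :
    ∃ e, ∀ m, ∑ j, hilb (Q j) m + hilb P (m + e) ≤ hilb P (m + e + 1) := by
  classical
  choose f hfj hfi using exists_mem_primes_notMem hQ hinc
  choose e' he' using fun j => exists_mem_linSpan_X_pow (f j)
  set e := Finset.univ.sup e'
  have he : ∀ j, f j ∈ linSpan F X ^ e := fun j =>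
    pow_le_pow_of_one_mem (one_mem_linSpan _) (Finset.le_sup (Finset.mem_univ j)) (he' j)
  refine ⟨e, fun m => ?_⟩
  let π : (MvPolynomial σ F ⧸ P) →ₐ[F] (∀ j, MvPolynomial σ F ⧸ Q j) :=
    AlgHom.pi (fun j => Ideal.Quotient.factorₐ F (hPQ j))
  let μ : (MvPolynomial σ F ⧸ P) →ₗ[F] (MvPolynomial σ F ⧸ P) :=
    LinearMap.mulLeft F (Ideal.Quotient.mk P ℓ)
  have hμ : Function.Injective μ := mul_right_injective₀ (by
    rwa [ne_eq, Ideal.Quotient.eq_zero_iff_mem])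
  let G : (∀ j, (linSpan F (coord (Q j)) ^ m : Submodule F _)) →ₗ[F]
      (∀ j, MvPolynomial σ F ⧸ Q j) :=
    LinearMap.pi (fun j => (LinearMap.mulLeft F (Ideal.Quotient.mk (Q j) (f j))).comp
      ((Submodule.subtype _).comp (LinearMap.proj j)))
  have hG : Function.Injective G := by
    intro u v huv
    funext j
    have := congrFun huv j
    apply Subtype.ext
    refine mul_right_injective₀ (a := Ideal.Quotient.mk (Q j) (f j)) ?_ this
    rw [ne_eq, Ideal.Quotient.eq_zero_iff_mem]
    exact hfj j
  have hL : Module.finrank F ((linSpan F (coord P) ^ (m + e)).map μ) = hilb P (m + e) :=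
    (LinearEquiv.finrank_eq (Submodule.equivMapOfInjective μ hμ _)).symm
  have hD : Module.finrank F (LinearMap.range G) = ∑ j, hilb (Q j) m := by
    have hfree : ∀ j, Module.Free F (linSpan F (coord (Q j)) ^ m : Submodule F _) :=
      fun j => Module.Free.of_divisionRing F _
    rw [LinearMap.finrank_range_of_inj hG, Module.finrank_pi_fintype]
    rfl
  rw [← hL, ← hD, add_comm]
  refine finrank_add_finrank_le π.toLinearMap ?_ ?_ ?_
  · rw [Submodule.map_le_iff_le_comap]
    intro a ha
    change Ideal.Quotient.mk P ℓ * a ∈ linSpan F (coord P) ^ (m + e + 1)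
    rw [pow_succ']
    refine Submodule.mul_mem_mul ?_ ha
    have := mk_mem_linSpan_coord_pow (m := 1) P (by rwa [pow_one])
    rwa [pow_one] at this
  · rintro _ ⟨a, _, rfl⟩
    change π (Ideal.Quotient.mk P ℓ * a) = 0
    rw [map_mul]
    have : π (Ideal.Quotient.mk P ℓ) = 0 := by
      funext j
      exact Ideal.Quotient.eq_zero_iff_mem.2 (hℓQ j)
    rw [this, zero_mul]
  · rintro _ ⟨u, rfl⟩
    have hlift : ∀ j, ∃ a ∈ linSpan F X ^ m, Ideal.Quotient.mkₐ F (Q j) a = u j := by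
      intro j
      exact (map_linSpan_pow (Ideal.Quotient.mkₐ F (Q j)) X m).ge (u j).2
    choose a ha hau using hlift
    refine ⟨Ideal.Quotient.mkₐ F P (∑ j, f j * a j), ?_, ?_⟩
    · refine mk_mem_linSpan_coord_pow P (Submodule.sum_mem _ fun j _ => ?_)
      refine pow_le_pow_of_one_mem (one_mem_linSpan _) (Nat.le_succ _) ?_
      rw [add_comm m, pow_add]
      exact Submodule.mul_mem_mul (he j) (ha j)
    · funext i
      change Ideal.Quotient.mk (Q i) (∑ j, f j * a j) = Ideal.Quotient.mk (Q i) (f i) * u i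
      rw [map_sum, Finset.sum_eq_single i]
      · rw [map_mul, ← hau i]
        rfl
      · intro j _ hji
        rw [Ideal.Quotient.eq_zero_iff_mem]
        exact Ideal.mul_mem_right _ _ (hfi j i hji.symm)
      · simp

theorem sum_pdeg_le [IsAlgClosed F] {J : Type*} [Fintype J] {P : Ideal (MvPolynomial σ F)}
    [P.IsPrime] {Q : J → Ideal (MvPolynomial σ F)} (hinj : Function.Injective Q)
    {ℓ : MvPolynomial σ F} (hℓ : ℓ ∈ linSpan F X) (hℓP : ℓ ∉ P)
    (hQ : ∀ j, Q j ∈ (P ⊔ Ideal.span {ℓ}).minimalPrimes) :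
    ∑ j, pdeg (Q j) ≤ pdeg P := by
  have hQp : ∀ j, (Q j).IsPrime := fun j => (hQ j).1.1
  rcases isEmpty_or_nonempty J with hJ | ⟨⟨j₀⟩⟩
  · simp
  obtain ⟨ρ, hρ⟩ : ∃ ρ, pdim P = ρ + 1 := ⟨_, (pdim_add_one hℓP (hQ j₀)).symm⟩
  have hρQ : ∀ j, pdim (Q j) = ρ := fun j => by
    have := pdim_add_one hℓP (hQ j)
    omega
  obtain ⟨e, he⟩ := sum_hilb_add_le hQp
    (fun i j hij => hinj (le_antisymm hij ((hQ j).2 (hQ i).1 hij)))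
    (fun j => le_sup_left.trans (hQ j).1.2) hℓ hℓP
    (fun j => (hQ j).1.2 (Ideal.mem_sup_right (Ideal.mem_span_singleton_self ℓ)))
  choose a' ha' using fun j => hasDeg_pdeg (P := Q j)
  set a := Finset.univ.sup a'
  have ha : ∀ j m, pdeg (Q j) * (m + ρ).choose ρ ≤ hilb (Q j) (m + a) := fun j m => by
    have h := (ha' j m).1
    rw [hρQ] at h
    refine h.trans (hilb_mono _ ?_)
    have : a' j ≤ a := Finset.le_sup (Finset.mem_univ j)
    omega
  obtain ⟨b, hb⟩ := hasDeg_pdeg (P := P)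
  rw [hρ] at hb
  have hsum : ∀ m, (∑ j, pdeg (Q j)) * ∑ i ∈ Finset.range m, (i + ρ).choose ρ ≤
      hilb P (m + a + e) := by
    intro m
    induction m with
    | zero => simp
    | succ m ih =>
      rw [Finset.sum_range_succ, mul_add]
      have h1 := he (m + a)
      have h2 : (∑ j, pdeg (Q j)) * (m + ρ).choose ρ ≤ ∑ j, hilb (Q j) (m + a) := by
        rw [Finset.sum_mul]
        exact Finset.sum_le_sum fun j _ => ha j m
      have h3 : m + 1 + a + e = m + a + e + 1 := by ring
      rw [h3]
      omega
  refine le_of_mul_choose_le (e := 1 + a + e + b) (ρ := ρ + 1) fun m => ?_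
  have h1 := hsum (m + 1)
  rw [Nat.sum_range_add_choose] at h1
  have h2 := (hb (m + 1 + a + e)).2
  refine (h1.trans h2).trans_eq ?_
  congr 2
  ring

end

section

open TensorProduct

variable {F A A' : Type*} [Field F] [IsAlgClosed F] [CommRing A] [Algebra F A]
  [CommRing A'] [Algebra F A']

theorem exists_algHom_of_isMaximal [Algebra.FiniteType F A] (m : Ideal A) [m.IsMaximal] :
    ∃ φ : A →ₐ[F] F, RingHom.ker φ = m := by
  let _ : Field (A ⧸ m) := Ideal.Quotient.field m
  have hft : Algebra.FiniteType F (A ⧸ m) := inferInstance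
  have hfin : Module.Finite F (A ⧸ m) := finite_of_finite_type_of_isJacobsonRing F (A ⧸ m)
  have hbij := IsAlgClosed.algebraMap_bijective_of_isIntegral (k := F) (K := A ⧸ m)
  let e : F ≃ₐ[F] (A ⧸ m) := AlgEquiv.ofBijective (Algebra.ofId F (A ⧸ m)) hbij
  refine ⟨(e.symm : (A ⧸ m) →ₐ[F] F).comp (Ideal.Quotient.mkₐ F m), ?_⟩
  ext a
  simp [RingHom.mem_ker, Ideal.Quotient.eq_zero_iff_mem]

theorem exists_algHom_ne_zero [Algebra.FiniteType F A] [IsDomain A] {a : A} (ha : a ≠ 0) :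
    ∃ φ : A →ₐ[F] F, φ a ≠ 0 := by
  have hJ : IsJacobsonRing A := isJacobsonRing_of_finiteType (A := F)
  have h : (⊥ : Ideal A).jacobson = ⊥ :=
    isJacobsonRing_iff.1 hJ ⊥ ((Ideal.isPrime_bot).isRadical)
  by_contra! hall
  apply ha
  have : a ∈ (⊥ : Ideal A).jacobson := by
    rw [Ideal.jacobson, Submodule.mem_sInf]
    rintro m ⟨_, hm⟩
    obtain ⟨φ, hφ⟩ := exists_algHom_of_isMaximal (F := F) m
    rw [← hφ]
    exact hall φ
  rwa [h, Ideal.mem_bot] at this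

theorem repr_lift_eq {F A A' ι : Type*} [Field F] [CommRing A] [Algebra F A] [CommRing A']
    [Algebra F A'] (b : Module.Basis ι F A') (φ : A →ₐ[F] F) (t : A ⊗[F] A') (i : ι) :
    b.repr (Algebra.TensorProduct.lift ((Algebra.ofId F A').comp φ) (AlgHom.id F A')
      (fun _ _ => Commute.all _ _) t) i = φ ((Algebra.TensorProduct.basis A b).repr t i) := by
  induction t using TensorProduct.induction_on with
  | zero => simp
  | tmul a m =>
    simp only [Algebra.TensorProduct.lift_tmul, AlgHom.comp_apply, AlgHom.id_apply,
      Algebra.TensorProduct.basis_repr_tmul]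
    rw [Algebra.ofId_apply, ← Algebra.smul_def]
    simp
  | add s t hs ht => simp [hs, ht]

theorem isDomain_tensorProduct [Algebra.FiniteType F A] [IsDomain A] [IsDomain A'] :
    IsDomain (A ⊗[F] A') := by
  have hnt : Nontrivial (A ⊗[F] A') := by
    have := Algebra.TensorProduct.includeLeft_injective (R := F) (S := F) (A := A) (B := A')
      (algebraMap F A').injective
    exact this.nontrivial
  have : NoZeroDivisors (A ⊗[F] A') := by
    refine ⟨fun {s t} hst => ?_⟩
    by_contra! hne
    set b := Module.Free.chooseBasis F A'
    have hco : ∀ u : A ⊗[F] A', u ≠ 0 →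
        ∃ i, (Algebra.TensorProduct.basis A b).repr u i ≠ 0 := by
      intro u hu
      by_contra! h
      exact hu ((Algebra.TensorProduct.basis A b).repr.map_eq_zero_iff.1 (Finsupp.ext h))
    obtain ⟨i, hi⟩ := hco s hne.1
    obtain ⟨j, hj⟩ := hco t hne.2
    obtain ⟨φ, hφ⟩ := exists_algHom_ne_zero (F := F) (mul_ne_zero hi hj)
    rw [map_mul, ← repr_lift_eq, ← repr_lift_eq] at hφ
    have h0 := congrArg (Algebra.TensorProduct.lift ((Algebra.ofId F A').comp φ) (AlgHom.id F A')
      (fun _ _ => Commute.all _ _)) hst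
    rw [map_mul, map_zero, mul_eq_zero] at h0
    rcases h0 with h0 | h0 <;> rw [h0] at hφ <;> simp at hφ
  exact NoZeroDivisors.to_isDomain _

end

section

open TensorProduct

variable {F : Type*} [Field F]

theorem linSpan_sumElim {R ι ι' : Type*} [CommRing R] [Algebra F R] (x : ι → R) (x' : ι' → R) :
    linSpan F (Sum.elim x x') = linSpan F x ⊔ linSpan F x' := by
  rw [linSpan, linSpan, linSpan, ← Submodule.span_union, Set.Sum.elim_range]
  congr 1
  ext
  simp only [Set.mem_insert_iff, Set.mem_union]
  tauto

theorem sup_pow_le {R : Type*} [CommRing R] [Algebra F R] {M M' L : Submodule F R} {k : ℕ}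
    (h : ∀ i j, i + j = k → M ^ i * M' ^ j ≤ L) : (M ⊔ M') ^ k ≤ L := by
  rw [← Submodule.add_eq_sup, (Commute.all M M').add_pow']
  refine Finset.sum_induction _ (· ≤ L) (fun a b ha hb => ?_) (by simp) (fun p hp => ?_)
  · rw [Submodule.add_eq_sup]
    exact sup_le ha hb
  · have hle := h p.1 p.2 (Finset.HasAntidiagonal.mem_antidiagonal.1 hp)
    induction k.choose p.1 with
    | zero => simp
    | succ n ih =>
      rw [succ_nsmul, Submodule.add_eq_sup]
      exact sup_le ih hle

theorem sup_pow_succ_le {R : Type*} [CommRing R] [Algebra F R] {M M' U U' : Submodule F R}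
    {N N' : ℕ} (h : M ^ (N + 1) ≤ U * M ^ N) (h' : M' ^ (N' + 1) ≤ U' * M' ^ N') :
    (M ⊔ M') ^ (N + N' + 1) ≤ (U ⊔ U') * (M ⊔ M') ^ (N + N') := by
  have key : ∀ i j k, i + j = k → M ^ i * M' ^ j ≤ (M ⊔ M') ^ k := by
    rintro i j _ rfl
    rw [pow_add]
    exact mul_le_mul' (pow_le_pow_left' le_sup_left _) (pow_le_pow_left' le_sup_right _)
  refine sup_pow_le fun i j hij => ?_
  rcases Nat.lt_or_ge N i with hi | hi
  · obtain ⟨c, rfl⟩ := Nat.exists_eq_add_of_le hi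
    calc M ^ (N + 1 + c) * M' ^ j = M ^ (N + 1) * (M ^ c * M' ^ j) := by ring
      _ ≤ U * M ^ N * (M ^ c * M' ^ j) := mul_le_mul_left h _
      _ = U * (M ^ (N + c) * M' ^ j) := by ring
      _ ≤ _ := mul_le_mul' le_sup_left (key _ _ _ (by omega))
  · obtain ⟨c, rfl⟩ : ∃ c, j = N' + 1 + c := Nat.exists_eq_add_of_le (by omega)
    calc M ^ i * M' ^ (N' + 1 + c) = M' ^ (N' + 1) * (M ^ i * M' ^ c) := by ring
      _ ≤ U' * M' ^ N' * (M ^ i * M' ^ c) := mul_le_mul_left h' _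
      _ = U' * (M ^ i * M' ^ (N' + c)) := by ring
      _ ≤ _ := mul_le_mul' le_sup_right (key _ _ _ (by omega))

variable {A A' : Type*} [CommRing A] [Algebra F A] [CommRing A'] [Algebra F A']

theorem algebraicIndependent_tmul {κ : Type*} {y : κ → A'} (hy : AlgebraicIndependent F y) :
    AlgebraicIndependent A (fun i => (1 : A) ⊗ₜ[F] y i) := by
  have h : (aeval (fun i => (1 : A) ⊗ₜ[F] y i) : MvPolynomial κ A →ₐ[A] A ⊗[F] A') =
      (Algebra.TensorProduct.map (AlgHom.id A A) (aeval y)).comp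
        (algebraTensorAlgEquiv F A).symm.toAlgHom := by
    ext i
    simp
  have hinj : Function.Injective
      (LinearMap.lTensor A (aeval y : MvPolynomial κ F →ₐ[F] A').toLinearMap) :=
    Module.Flat.lTensor_preserves_injective_linearMap _ hy
  rw [AlgebraicIndependent, h]
  have hmap : Function.Injective (Algebra.TensorProduct.map (AlgHom.id A A)
      (aeval y : MvPolynomial κ F →ₐ[F] A')) := hinj
  exact hmap.comp (algebraTensorAlgEquiv F A).symm.injective

theorem adjoin_tmul_eq_top {ι ι' : Type*} {x : ι → A} {x' : ι' → A'}
    (hx : Algebra.adjoin F (Set.range x) = ⊤) (hx' : Algebra.adjoin F (Set.range x') = ⊤) :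
    Algebra.adjoin F (Set.range (Sum.elim (fun i => x i ⊗ₜ[F] (1 : A'))
      (fun i => (1 : A) ⊗ₜ[F] x' i))) = ⊤ := by
  rw [eq_top_iff]
  set E := Algebra.adjoin F (Set.range (Sum.elim (fun i => x i ⊗ₜ[F] (1 : A'))
      (fun i => (1 : A) ⊗ₜ[F] x' i)))
  have h1 : ∀ a : A, a ⊗ₜ[F] (1 : A') ∈ E := by
    have : Algebra.adjoin F (Set.range x) ≤ E.comap Algebra.TensorProduct.includeLeft := by
      refine Algebra.adjoin_le ?_
      rintro _ ⟨i, rfl⟩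
      exact Algebra.subset_adjoin ⟨Sum.inl i, rfl⟩
    intro a
    exact this (hx.ge trivial)
  have h2 : ∀ a : A', (1 : A) ⊗ₜ[F] a ∈ E := by
    have : Algebra.adjoin F (Set.range x') ≤ E.comap Algebra.TensorProduct.includeRight := by
      refine Algebra.adjoin_le ?_
      rintro _ ⟨i, rfl⟩
      exact Algebra.subset_adjoin ⟨Sum.inr i, rfl⟩
    intro a
    exact this (hx'.ge trivial)
  intro t _
  induction t using TensorProduct.induction_on with
  | zero => exact zero_mem _
  | add s t hs ht => exact add_mem (hs trivial) (ht trivial)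
  | tmul a a' =>
    have : a ⊗ₜ[F] a' = (a ⊗ₜ[F] (1 : A')) * ((1 : A) ⊗ₜ[F] a') := by simp
    rw [this]
    exact mul_mem (h1 a) (h2 a')

/-- Noether normalization of an affine domain by linear forms, together with its degree. -/
theorem exists_reduction_of_hasDeg [IsAlgClosed F] [IsDomain A] {ι : Type*} [Finite ι] {x : ι → A}
    (hx : Algebra.adjoin F (Set.range x) = ⊤) {δ : ℕ} (hδ : HasDeg F x (dimOver F A) δ) :
    ∃ y : Fin (dimOver F A) → A, AlgebraicIndependent F y ∧ linSpan F y ≤ linSpan F x ∧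
      (∃ N, linSpan F x ^ (N + 1) ≤ linSpan F y * linSpan F x ^ N) ∧
      FiniteDimensional (IntermediateField.adjoin F (Set.range (algebraMap A (FractionRing A) ∘ y)))
        (FractionRing A) ∧
      Module.finrank (IntermediateField.adjoin F (Set.range (algebraMap A (FractionRing A) ∘ y)))
        (FractionRing A) = δ := by
  have : Algebra.FiniteType F A := ⟨⟨(Set.finite_range x).toFinset, by simpa using hx⟩⟩
  have htop := adjoin_algebraMap_eq_top hx
  have hρ : Algebra.trdeg F (FractionRing A) = dimOver F A := by
    rw [trdeg_fractionRing, cast_dimOver]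
  let f := IsScalarTower.toAlgHom F A (FractionRing A)
  have hf : Function.Injective f := IsFractionRing.injective A (FractionRing A)
  have hfx : f ∘ x = algebraMap A (FractionRing A) ∘ x := rfl
  obtain ⟨y', hy'⟩ := exists_reduction _ htop hρ
  have hlift : ∀ i, ∃ a, f a = y' i := by
    intro i
    have h := hy'.le (mem_linSpan y' i)
    rw [← hfx, ← map_linSpan] at h
    obtain ⟨a, _, ha⟩ := h
    exact ⟨a, ha⟩
  choose y hy using hlift
  have hfy : f ∘ y = y' := funext hy
  obtain ⟨N, hN⟩ := hy'.pow_le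
  obtain ⟨hfin, hdeg⟩ := hasDeg_of_reduction (hy'.algebraicIndependent hρ) hy'.le hN htop
  have hdeg' := hdeg.of_injective f hf
  refine ⟨y, ?_, ?_, ⟨N, ?_⟩, ?_⟩
  · have := hy'.algebraicIndependent hρ
    rw [← hfy] at this
    exact this.of_comp f
  · have h := hy'.le
    rw [← hfy, ← hfx, ← map_linSpan, ← map_linSpan] at h
    exact (Submodule.map_le_map_iff_of_injective hf _ _).1 h
  · rw [← hfy, ← hfx, ← map_linSpan_pow, ← map_linSpan_pow, ← map_linSpan,
      ← Submodule.map_mul] at hN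
    exact (Submodule.map_le_map_iff_of_injective hf _ _).1 hN
  · have : algebraMap A (FractionRing A) ∘ y = y' := hfy
    rw [this]
    exact ⟨hfin, le_antisymm (hdeg'.le hδ) (hδ.le hdeg')⟩

theorem mem_adjoin_range_comp {K L κ κ' : Type*} [Field K] [Algebra F K] [Field L] [Algebra F L]
    (f : K →ₐ[F] L) {y : κ → K} {w : κ' → L} (h : ∀ i, f (y i) ∈ Set.range w) {a : K}
    (ha : a ∈ IntermediateField.adjoin F (Set.range y)) :
    f a ∈ IntermediateField.adjoin F (Set.range w) := by
  have hle : IntermediateField.adjoin F (Set.range y) ≤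
      (IntermediateField.adjoin F (Set.range w)).comap f := by
    rw [IntermediateField.adjoin_le_iff]
    rintro _ ⟨i, rfl⟩
    exact IntermediateField.subset_adjoin F _ (h i)
  exact hle ha

theorem finrank_le_mul_of_products {K K' L : Type*} [Field K] [Algebra F K] [Field K']
    [Algebra F K'] [Field L] [Algebra F L] (g₁ : K →ₐ[F] L) (g₂ : K' →ₐ[F] L)
    (E₁ : IntermediateField F K) (E₂ : IntermediateField F K') (E : IntermediateField F L)
    [FiniteDimensional E₁ K] [FiniteDimensional E₂ K']
    (h₁ : ∀ a ∈ E₁, g₁ a ∈ E) (h₂ : ∀ a ∈ E₂, g₂ a ∈ E) {D : Set L}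
    (hD : ∀ u ∈ D, u ∈ Submodule.span F (Set.range fun p : K × K' => g₁ p.1 * g₂ p.2))
    (htop : Submodule.span E D = ⊤) :
    Module.finrank E L ≤ Module.finrank E₁ K * Module.finrank E₂ K' := by
  let b := Module.finBasis E₁ K
  let b' := Module.finBasis E₂ K'
  let v : Fin (Module.finrank E₁ K) × Fin (Module.finrank E₂ K') → L :=
    fun p => g₁ (b p.1) * g₂ (b' p.2)
  have hv : ∀ a a', g₁ a * g₂ a' ∈ Submodule.span E (Set.range v) := by
    intro a a'
    rw [← b.sum_repr a, ← b'.sum_repr a', map_sum, map_sum, Finset.sum_mul_sum]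
    refine Submodule.sum_mem _ fun i _ => Submodule.sum_mem _ fun j _ => ?_
    rw [IntermediateField.smul_def, IntermediateField.smul_def, smul_eq_mul, smul_eq_mul,
      map_mul, map_mul]
    have h2 := Submodule.smul_mem (Submodule.span E (Set.range v))
      ((⟨_, h₁ _ (b.repr a i).2⟩ : E) * ⟨_, h₂ _ (b'.repr a' j).2⟩)
      (Submodule.subset_span (⟨(i, j), rfl⟩ : v (i, j) ∈ Set.range v))
    convert h2 using 1
    rw [IntermediateField.smul_def, smul_eq_mul]
    simp only [v, MulMemClass.coe_mul]
    ring
  have htop' : Submodule.span E (Set.range v) = ⊤ := by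
    rw [eq_top_iff, ← htop, Submodule.span_le]
    intro u hu
    have hle : Submodule.span F (Set.range fun p : K × K' => g₁ p.1 * g₂ p.2) ≤
        (Submodule.span E (Set.range v)).restrictScalars F := by
      rw [Submodule.span_le]
      rintro _ ⟨p, rfl⟩
      exact hv p.1 p.2
    exact hle (hD u hu)
  have hcard := finrank_range_le_card (R := E) v
  rw [Set.finrank, htop', finrank_top] at hcard
  exact hcard.trans_eq (by rw [Fintype.card_prod, Fintype.card_fin, Fintype.card_fin])

theorem exists_lift_fractionRing {B L : Type*} [CommRing B] [IsDomain B] [Algebra F B] [Field L]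
    [Algebra F L] (h : B →ₐ[F] L) (hh : Function.Injective h) :
    ∃ g : FractionRing B →ₐ[F] L, ∀ b, g (algebraMap B (FractionRing B) b) = h b :=
  ⟨IsFractionRing.liftAlgHom (g := h) hh, fun b => by simp⟩

theorem exists_hasDeg_of_products [IsAlgClosed F] [IsDomain A] [IsDomain A'] {ι ι' : Type*}
    [Finite ι] [Finite ι'] {x : ι → A} {x' : ι' → A'}
    (hx : Algebra.adjoin F (Set.range x) = ⊤) (hx' : Algebra.adjoin F (Set.range x') = ⊤)
    {δ δ' : ℕ} (hδ : HasDeg F x (dimOver F A) δ) (hδ' : HasDeg F x' (dimOver F A') δ')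
    {T : Type*} [CommRing T] [IsDomain T] [Algebra F T] (i₁ : A →ₐ[F] T) (i₂ : A' →ₐ[F] T)
    (hi₁ : Function.Injective i₁) (hi₂ : Function.Injective i₂)
    (hT : Algebra.adjoin F (Set.range (Sum.elim (i₁ ∘ x) (i₂ ∘ x'))) = ⊤)
    (hT' : ∀ t, t ∈ Submodule.span F (Set.range fun p : A × A' => i₁ p.1 * i₂ p.2))
    (hind : ∀ (y : Fin (dimOver F A) → A) (y' : Fin (dimOver F A') → A'),
      AlgebraicIndependent F y → AlgebraicIndependent F y' →
        AlgebraicIndependent F (Sum.elim (i₂ ∘ y') (i₁ ∘ y))) :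
    ∃ d ≤ δ * δ', HasDeg F (Sum.elim (i₁ ∘ x) (i₂ ∘ x')) (dimOver F T) d := by
  have hft : Algebra.FiniteType F A := ⟨⟨(Set.finite_range x).toFinset, by simpa using hx⟩⟩
  have hft' : Algebra.FiniteType F A' := ⟨⟨(Set.finite_range x').toFinset, by simpa using hx'⟩⟩
  obtain ⟨y, hyi, hyle, ⟨N, hN⟩, hfin, hrk⟩ := exists_reduction_of_hasDeg hx hδ
  obtain ⟨y', hyi', hyle', ⟨N', hN'⟩, hfin', hrk'⟩ := exists_reduction_of_hasDeg hx' hδ'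
  specialize hind y y' hyi hyi'
  generalize dimOver F A = ρ at y hind
  generalize dimOver F A' = ρ' at y' hind
  obtain ⟨f, hfa⟩ : ∃ f : T →ₐ[F] FractionRing T, ∀ t, f t = algebraMap T (FractionRing T) t :=
    ⟨IsScalarTower.toAlgHom F T (FractionRing T), fun _ => rfl⟩
  have hf : Function.Injective f := by
    rw [show (f : T → FractionRing T) = algebraMap T (FractionRing T) from funext hfa]
    exact IsFractionRing.injective T (FractionRing T)
  set z := Sum.elim (i₁ ∘ x) (i₂ ∘ x') with hzdef
  set w := Sum.elim (i₂ ∘ y') (i₁ ∘ y) with hwdef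
  let e : Fin (ρ' + ρ) ≃ Fin ρ' ⊕ Fin ρ := finSumFinEquiv.symm
  have hYi : AlgebraicIndependent F (f ∘ (w ∘ e)) := (hind.comp e e.injective).map' hf
  have hz : linSpan F (f ∘ z) = linSpan F (f ∘ i₁ ∘ x) ⊔ linSpan F (f ∘ i₂ ∘ x') := by
    rw [← linSpan_sumElim, hzdef, Sum.comp_elim]
  have hY : linSpan F (f ∘ (w ∘ e)) = linSpan F (f ∘ i₁ ∘ y) ⊔ linSpan F (f ∘ i₂ ∘ y') := by
    rw [← Function.comp_assoc, linSpan_comp_equiv, sup_comm, ← linSpan_sumElim, hwdef,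
      Sum.comp_elim]
  have hred : linSpan F (f ∘ z) ^ (N + N' + 1) ≤
      linSpan F (f ∘ (w ∘ e)) * linSpan F (f ∘ z) ^ (N + N') := by
    rw [hz, hY]
    refine sup_pow_succ_le ?_ ?_
    · have := Submodule.map_mono (f := (f.comp i₁).toLinearMap) hN
      rw [Submodule.map_mul, map_linSpan, map_linSpan_pow, map_linSpan_pow] at this
      exact this
    · have := Submodule.map_mono (f := (f.comp i₂).toLinearMap) hN'
      rw [Submodule.map_mul, map_linSpan, map_linSpan_pow, map_linSpan_pow] at this
      exact this
  have hYz : linSpan F (f ∘ (w ∘ e)) ≤ linSpan F (f ∘ z) := by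
    rw [hz, hY]
    refine sup_le_sup ?_ ?_
    · have := Submodule.map_mono (f := (f.comp i₁).toLinearMap) hyle
      rw [map_linSpan, map_linSpan] at this
      exact this
    · have := Submodule.map_mono (f := (f.comp i₂).toLinearMap) hyle'
      rw [map_linSpan, map_linSpan] at this
      exact this
  have hztop : IntermediateField.adjoin F (Set.range (f ∘ z)) = ⊤ := by
    rw [show (f : T → FractionRing T) = algebraMap T (FractionRing T) from funext hfa]
    exact adjoin_algebraMap_eq_top hT
  obtain ⟨hfinT, hdegT⟩ := hasDeg_of_reduction hYi hYz hred hztop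
  have hspan := span_pow_eq_top hred hztop
  set E := IntermediateField.adjoin F (Set.range (f ∘ (w ∘ e))) with hE
  have hdim : dimOver F T = ρ' + ρ := by
    have halg : Algebra.IsAlgebraic (Algebra.adjoin F (Set.range (f ∘ (w ∘ e))))
        (FractionRing T) := by
      rw [← IntermediateField.isAlgebraic_adjoin_iff_top]
      exact inferInstanceAs (Algebra.IsAlgebraic E (FractionRing T))
    have htb : IsTranscendenceBasis F (f ∘ (w ∘ e)) :=
      hYi.isTranscendenceBasis_iff_isAlgebraic.2 halg
    have hc := htb.lift_cardinalMk_eq_trdeg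
    rw [dimOver, ← trdeg_fractionRing]
    have := congrArg Cardinal.toNat hc
    simpa using this.symm
  refine ⟨_, ?_, by rw [hdim]; exact hdegT.of_injective f hf⟩
  rw [← hrk, ← hrk']
  obtain ⟨g₁, hg₁⟩ := exists_lift_fractionRing (f.comp i₁) (hf.comp hi₁)
  obtain ⟨g₂, hg₂⟩ := exists_lift_fractionRing (f.comp i₂) (hf.comp hi₂)
  refine finrank_le_mul_of_products g₁ g₂ _ _ E
    (fun a ha => mem_adjoin_range_comp g₁ (fun i => ⟨e.symm (Sum.inr i), ?_⟩) ha)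
    (fun a ha => mem_adjoin_range_comp g₂ (fun i => ⟨e.symm (Sum.inl i), ?_⟩) ha) ?_ hspan
  · simp [hwdef, hg₁]
  · simp [hwdef, hg₂]
  · intro u hu
    have hu' : u ∈ linSpan F (f ∘ z) ^ (N + N') := hu
    rw [← map_linSpan_pow] at hu'
    obtain ⟨t, _, rfl⟩ := hu'
    have hle : (Submodule.span F (Set.range fun p : A × A' => i₁ p.1 * i₂ p.2)).map
        f.toLinearMap ≤ Submodule.span F
          (Set.range fun p : FractionRing A × FractionRing A' => g₁ p.1 * g₂ p.2) := by
      rw [Submodule.map_span_le]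
      rintro _ ⟨p, rfl⟩
      refine Submodule.subset_span ⟨(algebraMap A _ p.1, algebraMap A' _ p.2), ?_⟩
      simp only [hg₁, hg₂]
      exact (map_mul f _ _).symm
    exact hle ⟨t, hT' t, rfl⟩

theorem exists_hasDeg_tensorProduct [IsAlgClosed F] [IsDomain A] [IsDomain A'] {ι ι' : Type*}
    [Finite ι] [Finite ι'] {x : ι → A} {x' : ι' → A'}
    (hx : Algebra.adjoin F (Set.range x) = ⊤) (hx' : Algebra.adjoin F (Set.range x') = ⊤)
    {δ δ' : ℕ} (hδ : HasDeg F x (dimOver F A) δ) (hδ' : HasDeg F x' (dimOver F A') δ') :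
    ∃ d ≤ δ * δ', HasDeg F (Sum.elim (fun i => x i ⊗ₜ[F] (1 : A')) (fun i => (1 : A) ⊗ₜ[F] x' i))
      (dimOver F (A ⊗[F] A')) d := by
  have hft : Algebra.FiniteType F A := ⟨⟨(Set.finite_range x).toFinset, by simpa using hx⟩⟩
  have hdom : IsDomain (A ⊗[F] A') := isDomain_tensorProduct
  refine exists_hasDeg_of_products hx hx' hδ hδ'
    (Algebra.TensorProduct.includeLeft : A →ₐ[F] A ⊗[F] A')
    (Algebra.TensorProduct.includeRight : A' →ₐ[F] A ⊗[F] A')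
    (Algebra.TensorProduct.includeLeft_injective (algebraMap F A').injective)
    (Algebra.TensorProduct.includeRight_injective (algebraMap F A).injective)
    (adjoin_tmul_eq_top hx hx') (fun t => ?_)
    (fun y y' hy hy' => hy.sumElim_comp (algebraicIndependent_tmul hy'))
  induction t using TensorProduct.induction_on with
  | zero => exact zero_mem _
  | add s t hs ht => exact add_mem hs ht
  | tmul a a' => exact Submodule.subset_span ⟨(a, a'), by simp⟩

end

section

open scoped TensorProduct

variable {F σ τ : Type*} [Field F]

theorem HasDeg.congr_linSpan {R ι ι' : Type*} [CommRing R] [Algebra F R] {x : ι → R} {x' : ι' → R}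
    {ρ δ : ℕ} (h : HasDeg F x ρ δ) (hx : linSpan F x = linSpan F x') : HasDeg F x' ρ δ := by
  rw [HasDeg] at h ⊢
  rwa [← hx]

theorem dimOver_eq_of_bijective {R R' : Type*} [CommRing R] [Algebra F R] [CommRing R']
    [Algebra F R'] (f : R →ₐ[F] R') (hf : Function.Bijective f) : dimOver F R = dimOver F R' := by
  have h := (AlgEquiv.ofBijective f hf).lift_trdeg_eq
  have := congrArg Cardinal.toNat h
  simpa [dimOver] using this

theorem pdim_ker {T : Type*} [CommRing T] [Algebra F T] (g : MvPolynomial τ F →ₐ[F] T)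
    (hg : Function.Surjective g) : pdim (RingHom.ker g) = dimOver F T :=
  dimOver_eq_of_bijective (Ideal.kerLiftAlg g)
    ⟨Ideal.kerLiftAlg_injective g, fun t => by
      obtain ⟨p, rfl⟩ := hg t
      exact ⟨Ideal.Quotient.mk _ p, Ideal.kerLiftAlg_mk g p⟩⟩

theorem pdeg_ker [Finite τ] {T : Type*} [CommRing T] [Algebra F T] (g : MvPolynomial τ F →ₐ[F] T)
    (hg : Function.Surjective g) {δ : ℕ} (h : HasDeg F (g ∘ X) (dimOver F T) δ) :
    pdeg (RingHom.ker g) = δ := by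
  apply HasDeg.pdeg_eq
  rw [pdim_ker g hg]
  exact HasDeg.of_injective (x := coord (RingHom.ker g)) (Ideal.kerLiftAlg g)
    (Ideal.kerLiftAlg_injective g) h

theorem pdeg_comap [IsAlgClosed F] [Finite σ] [Finite τ]
    (φ : MvPolynomial τ F →ₐ[F] MvPolynomial σ F)
    (hφ : Function.Surjective φ) (hX : linSpan F (φ ∘ X) = linSpan F X)
    (Q : Ideal (MvPolynomial σ F)) [Q.IsPrime] : pdeg (Q.comap φ) = pdeg Q := by
  have hker : Q.comap φ = RingHom.ker ((Ideal.Quotient.mkₐ F Q).comp φ) := by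
    ext p
    simp [RingHom.mem_ker, Ideal.Quotient.eq_zero_iff_mem]
  rw [hker]
  refine pdeg_ker _ (Function.Surjective.comp (g := Ideal.Quotient.mkₐ F Q) (f := φ)
    (Ideal.Quotient.mkₐ_surjective F Q) hφ) ?_
  refine (hasDeg_pdeg (P := Q)).congr_linSpan ?_
  rw [coord_eq, ← map_linSpan, ← hX, map_linSpan]
  rfl

/-- The sum of the degrees of the minimal primes of an ideal. -/
def idealDeg (I : Ideal (MvPolynomial σ F)) : ℕ := ∑ᶠ Q ∈ I.minimalPrimes, pdeg Q

theorem idealDeg_of_isPrime (P : Ideal (MvPolynomial σ F)) [P.IsPrime] : idealDeg P = pdeg P := by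
  rw [idealDeg, Ideal.minimalPrimes_eq_subsingleton_self, finsum_mem_singleton]

theorem sub_rename_aeval_mem (p : MvPolynomial (σ ⊕ σ) F) :
    p - rename Sum.inl (aeval (Sum.elim X X) p : MvPolynomial σ F) ∈
      Ideal.span (Set.range fun i : σ =>
        (X (Sum.inl i) - X (Sum.inr i) : MvPolynomial (σ ⊕ σ) F)) := by
  set D := Ideal.span (Set.range fun i : σ =>
    (X (Sum.inl i) - X (Sum.inr i) : MvPolynomial (σ ⊕ σ) F))
  have h : Ideal.Quotient.mkₐ F D = (Ideal.Quotient.mkₐ F D).comp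
      ((rename Sum.inl).comp (aeval (Sum.elim X X))) := by
    ext i
    rcases i with i | i
    · simp
    · simp only [AlgHom.comp_apply, aeval_X, Sum.elim_inr, rename_X, Ideal.Quotient.mkₐ_eq_mk]
      rw [eq_comm, Ideal.Quotient.eq]
      exact Ideal.subset_span ⟨i, rfl⟩
  exact Ideal.Quotient.eq.1 (DFunLike.congr_fun h p)

variable [Finite σ]

theorem idealDeg_eq_sum (I : Ideal (MvPolynomial σ F)) :
    idealDeg I = ∑ Q ∈ I.finite_minimalPrimes_of_isNoetherianRing.toFinset, pdeg Q :=
  finsum_mem_eq_finite_toFinset_sum _ _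

theorem sum_pdeg_le_idealDeg {I : Ideal (MvPolynomial σ F)}
    {s : Finset (Ideal (MvPolynomial σ F))} (hs : ∀ Q ∈ s, Q ∈ I.minimalPrimes) :
    ∑ Q ∈ s, pdeg Q ≤ idealDeg I := by
  rw [idealDeg_eq_sum]
  exact Finset.sum_le_sum_of_subset fun Q hQ => by simpa using hs Q hQ

theorem minimalPrimes_of_le {R : Type*} [CommRing R] {I I' Q : Ideal R} (hQ : Q ∈ I.minimalPrimes)
    (h : I ≤ I') (h' : I' ≤ Q) : Q ∈ I'.minimalPrimes :=
  ⟨⟨hQ.1.1, h'⟩, fun _ hP hle => hQ.2 ⟨hP.1, h.trans hP.2⟩ hle⟩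

open Classical in
theorem idealDeg_sup_span_singleton_le [IsAlgClosed F] (I : Ideal (MvPolynomial σ F))
    {ℓ : MvPolynomial σ F} (hℓ : ℓ ∈ linSpan F X) : idealDeg (I ⊔ Ideal.span {ℓ}) ≤ idealDeg I := by
  have hex : ∀ Q ∈ (I ⊔ Ideal.span {ℓ}).minimalPrimes, ∃ P ∈ I.minimalPrimes, P ≤ Q := fun Q hQ => by
    have := hQ.1.1
    exact Ideal.exists_minimalPrimes_le (le_sup_left.trans hQ.1.2)
  choose! p hp hpQ using hex
  rw [idealDeg_eq_sum, idealDeg_eq_sum]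
  rw [← Finset.sum_fiberwise_of_maps_to (g := p)
    (t := I.finite_minimalPrimes_of_isNoetherianRing.toFinset)
    (fun Q hQ => by
      rw [Set.Finite.mem_toFinset] at hQ ⊢
      exact hp Q hQ)]
  refine Finset.sum_le_sum fun P hP => ?_
  rw [Set.Finite.mem_toFinset] at hP
  have hPp : P.IsPrime := hP.1.1
  set s := {Q ∈ (I ⊔ Ideal.span {ℓ}).finite_minimalPrimes_of_isNoetherianRing.toFinset | p Q = P}
    with hsdef
  have hs : ∀ Q ∈ s, Q ∈ (P ⊔ Ideal.span {ℓ}).minimalPrimes := by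
    intro Q hQ
    rw [hsdef, Finset.mem_filter, Set.Finite.mem_toFinset] at hQ
    have hPQ : P ≤ Q := hQ.2 ▸ hpQ Q hQ.1
    exact minimalPrimes_of_le hQ.1 (sup_le_sup_right hP.1.2 _)
      (sup_le hPQ (le_sup_right.trans hQ.1.1.2))
  by_cases hℓP : ℓ ∈ P
  · have hPe : P ⊔ Ideal.span {ℓ} = P := by simpa using hℓP
    rw [hPe] at hs
    exact (sum_pdeg_le_idealDeg hs).trans_eq (idealDeg_of_isPrime P)
  · rw [← Finset.sum_coe_sort]
    exact sum_pdeg_le Subtype.val_injective hℓ hℓP fun Q => hs Q.1 Q.2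

theorem idealDeg_sup_span_range_le [IsAlgClosed F] {ι : Type*} [Finite ι]
    (I : Ideal (MvPolynomial σ F)) {ℓ : ι → MvPolynomial σ F} (hℓ : ∀ i, ℓ i ∈ linSpan F X) :
    idealDeg (I ⊔ Ideal.span (Set.range ℓ)) ≤ idealDeg I := by
  classical
  let _ := Fintype.ofFinite ι
  have h : ∀ s : Finset ι, idealDeg (I ⊔ Ideal.span (ℓ '' s)) ≤ idealDeg I := by
    intro s
    induction s using Finset.induction_on with
    | empty => simp
    | insert i s _ ih =>
      have he : I ⊔ Ideal.span (ℓ '' (insert i s : Finset ι)) =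
          (I ⊔ Ideal.span (ℓ '' s)) ⊔ Ideal.span {ℓ i} := by
        rw [Finset.coe_insert, Set.image_insert_eq, Ideal.span_insert, sup_assoc,
          sup_comm (Ideal.span {ℓ i})]
      rw [he]
      exact (idealDeg_sup_span_singleton_le _ (hℓ i)).trans ih
  simpa using h Finset.univ

theorem exists_join_of_surjective [IsAlgClosed F] {A A' B : Type*} [CommRing A] [IsDomain A]
    [Algebra F A] [CommRing A'] [IsDomain A'] [Algebra F A'] [CommRing B] [Algebra F B]
    (π : MvPolynomial σ F →ₐ[F] A) (hπ : Function.Surjective π)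
    (π' : MvPolynomial σ F →ₐ[F] A') (hπ' : Function.Surjective π')
    {δ δ' : ℕ} (hδ : HasDeg F (π ∘ X) (dimOver F A) δ) (hδ' : HasDeg F (π' ∘ X) (dimOver F A') δ')
    (h : A →ₐ[F] B) (h' : A' →ₐ[F] B) (hh : h.comp π = h'.comp π') :
    ∃ J : Ideal (MvPolynomial (σ ⊕ σ) F), J.IsPrime ∧ pdeg J ≤ δ * δ' ∧
      (∀ p, π p = 0 → rename Sum.inl p ∈ J) ∧ (∀ p, π' p = 0 → rename Sum.inr p ∈ J) ∧
      ∀ p ∈ J, h (π (aeval (Sum.elim X X) p)) = 0 := by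
  have hadj₁ : Algebra.adjoin F (Set.range (π ∘ X)) = ⊤ := by
    rw [Set.range_comp, ← AlgHom.map_adjoin, adjoin_range_X, Algebra.map_top,
      (AlgHom.range_eq_top π).2 hπ]
  have hadj₂ : Algebra.adjoin F (Set.range (π' ∘ X)) = ⊤ := by
    rw [Set.range_comp, ← AlgHom.map_adjoin, adjoin_range_X, Algebra.map_top,
      (AlgHom.range_eq_top π').2 hπ']
  have hft : Algebra.FiniteType F A := ⟨⟨(Set.finite_range (π ∘ X)).toFinset, by simpa using hadj₁⟩⟩
  have hdom : IsDomain (A ⊗[F] A') := isDomain_tensorProduct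
  obtain ⟨d, hd, hdeg⟩ := exists_hasDeg_tensorProduct hadj₁ hadj₂ hδ hδ'
  have hadj := adjoin_tmul_eq_top hadj₁ hadj₂
  set z : σ ⊕ σ → A ⊗[F] A' := Sum.elim (fun i => (π ∘ X) i ⊗ₜ[F] (1 : A'))
    (fun i => (1 : A) ⊗ₜ[F] (π' ∘ X) i) with hz
  obtain ⟨g, hg⟩ : ∃ g : MvPolynomial (σ ⊕ σ) F →ₐ[F] A ⊗[F] A', g = aeval z := ⟨_, rfl⟩
  have hsurj : Function.Surjective g := by
    rw [← AlgHom.range_eq_top, hg, ← Algebra.adjoin_range_eq_range_aeval]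
    exact hadj
  refine ⟨RingHom.ker g, RingHom.ker_isPrime _, ?_, ?_, ?_, ?_⟩
  · rw [pdeg_ker g hsurj (δ := d)]
    · exact hd
    · have : g ∘ X = z := by
        ext i
        simp [hg]
      rwa [this]
  · intro p hp
    have h3 : g.comp (rename Sum.inl) =
        (Algebra.TensorProduct.includeLeft : A →ₐ[F] A ⊗[F] A').comp π := by
      ext i
      simp [hg, hz]
    have h2 := DFunLike.congr_fun h3 p
    simp only [AlgHom.comp_apply, hp, map_zero] at h2
    exact h2
  · intro p hp
    have h3 : g.comp (rename Sum.inr) =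
        (Algebra.TensorProduct.includeRight : A' →ₐ[F] A ⊗[F] A').comp π' := by
      ext i
      simp [hg, hz]
    have h2 := DFunLike.congr_fun h3 p
    simp only [AlgHom.comp_apply, hp, map_zero] at h2
    exact h2
  · intro p hp
    have h3 : (Algebra.TensorProduct.lift h h' (fun _ _ => Commute.all _ _)).comp g =
        (h.comp π).comp (aeval (Sum.elim X X)) := by
      ext i
      rcases i with i | i
      · simp [hg, hz]
      · have := DFunLike.congr_fun hh (X i)
        simp only [AlgHom.comp_apply] at this
        simp [hg, hz, this]
    have h2 := DFunLike.congr_fun h3 p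
    rw [RingHom.mem_ker] at hp
    simp only [AlgHom.comp_apply, hp, map_zero] at h2
    exact h2.symm

theorem exists_join [IsAlgClosed F] (P P' : Ideal (MvPolynomial σ F)) [P.IsPrime] [P'.IsPrime] :
    ∃ J : Ideal (MvPolynomial (σ ⊕ σ) F), J.IsPrime ∧ pdeg J ≤ pdeg P * pdeg P' ∧
      (∀ p ∈ P, rename Sum.inl p ∈ J) ∧ (∀ p ∈ P', rename Sum.inr p ∈ J) ∧
      ∀ p ∈ J, aeval (Sum.elim X X) p ∈ P ⊔ P' := by
  obtain ⟨J, hJ, hdeg, h₁, h₂, h₃⟩ := exists_join_of_surjective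
    (Ideal.Quotient.mkₐ F P) (Ideal.Quotient.mkₐ_surjective F P)
    (Ideal.Quotient.mkₐ F P') (Ideal.Quotient.mkₐ_surjective F P')
    (hasDeg_pdeg (P := P)) (hasDeg_pdeg (P := P'))
    (Ideal.Quotient.factorₐ F (le_sup_left : P ≤ P ⊔ P'))
    (Ideal.Quotient.factorₐ F (le_sup_right : P' ≤ P ⊔ P')) rfl
  refine ⟨J, hJ, hdeg, fun p hp => h₁ p (Ideal.Quotient.eq_zero_iff_mem.2 hp),
    fun p hp => h₂ p (Ideal.Quotient.eq_zero_iff_mem.2 hp), fun p hp => ?_⟩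
  rw [← Ideal.Quotient.eq_zero_iff_mem]
  exact h₃ p hp

theorem idealDeg_sup_le_of_isPrime [IsAlgClosed F] (P P' : Ideal (MvPolynomial σ F)) [P.IsPrime]
    [P'.IsPrime] : idealDeg (P ⊔ P') ≤ pdeg P * pdeg P' := by
  classical
  obtain ⟨J, hJ, hdeg, hP, hP', hJP⟩ := exists_join P P'
  set D := Ideal.span (Set.range fun i : σ =>
    (X (Sum.inl i) - X (Sum.inr i) : MvPolynomial (σ ⊕ σ) F))
    with hD
  set φ : MvPolynomial (σ ⊕ σ) F →ₐ[F] MvPolynomial σ F := aeval (Sum.elim X X) with hφdef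
  have hφl : ∀ p, φ (rename Sum.inl p) = p := fun p => by
    rw [hφdef, aeval_rename]; simp
  have hφr : ∀ p, φ (rename Sum.inr p) = p := fun p => by
    rw [hφdef, aeval_rename]; simp
  have hφ : Function.Surjective φ := fun p => ⟨_, hφl p⟩
  have hX : linSpan F (φ ∘ X) = linSpan F X := by
    have : φ ∘ X = Sum.elim X X := by ext i; simp [hφdef]
    rw [this, linSpan_sumElim, sup_idem]
  have hcomap : (P ⊔ P').comap φ = J ⊔ D := by
    apply le_antisymm
    · intro p hp
      obtain ⟨a, ha, b, hb, hab⟩ := Submodule.mem_sup.1 (show φ p ∈ P ⊔ P' from hp)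
      have h1 := sub_rename_aeval_mem p
      have h2 := sub_rename_aeval_mem (rename Sum.inr b)
      rw [← hφdef] at h1 h2
      rw [hφr] at h2
      have : p = (rename Sum.inl a + rename Sum.inr b) +
          ((p - rename Sum.inl (φ p)) - (rename Sum.inr b - rename Sum.inl b)) := by
        rw [← hab, map_add]; ring
      rw [this]
      exact add_mem (Ideal.mem_sup_left (add_mem (hP a ha) (hP' b hb)))
        (Ideal.mem_sup_right (sub_mem h1 h2))
    · refine sup_le hJP ?_
      rw [hD, Ideal.span_le]
      rintro _ ⟨i, rfl⟩
      simp [hφdef]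
  have hmem : ∀ Q ∈ (P ⊔ P').minimalPrimes, Q.comap φ ∈ (J ⊔ D).minimalPrimes := by
    intro Q hQ
    rw [← hcomap]
    exact Ideal.minimalPrimes_comap_of_surjective (f := φ.toRingHom) hφ hQ
  calc idealDeg (P ⊔ P')
      = ∑ Q ∈ (P ⊔ P').finite_minimalPrimes_of_isNoetherianRing.toFinset, pdeg (Q.comap φ) := by
        rw [idealDeg_eq_sum]
        refine Finset.sum_congr rfl fun Q hQ => ?_
        rw [Set.Finite.mem_toFinset] at hQ
        have := hQ.1.1
        exact (pdeg_comap φ hφ hX Q).symm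
    _ ≤ idealDeg (J ⊔ D) := by
        rw [← Finset.sum_image (f := pdeg) (g := fun Q : Ideal (MvPolynomial σ F) => Q.comap φ)
          ((Ideal.comap_injective_of_surjective φ hφ).injOn)]
        refine sum_pdeg_le_idealDeg fun Q hQ => ?_
        obtain ⟨Q', hQ', rfl⟩ := Finset.mem_image.1 hQ
        exact hmem Q' (by simpa using hQ')
    _ ≤ idealDeg J := idealDeg_sup_span_range_le J fun i =>
        sub_mem (mem_linSpan _ _) (mem_linSpan _ _)
    _ = pdeg J := idealDeg_of_isPrime J
    _ ≤ _ := hdeg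

open Classical in
theorem idealDeg_sup_le [IsAlgClosed F] (I I' : Ideal (MvPolynomial σ F)) :
    idealDeg (I ⊔ I') ≤ idealDeg I * idealDeg I' := by
  have hex : ∀ Q ∈ (I ⊔ I').minimalPrimes, ∃ P ∈ I.minimalPrimes, P ≤ Q := fun Q hQ => by
    have := hQ.1.1
    exact Ideal.exists_minimalPrimes_le (le_sup_left.trans hQ.1.2)
  have hex' : ∀ Q ∈ (I ⊔ I').minimalPrimes, ∃ P ∈ I'.minimalPrimes, P ≤ Q := fun Q hQ => by
    have := hQ.1.1
    exact Ideal.exists_minimalPrimes_le (le_sup_right.trans hQ.1.2)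
  choose! p hp hpQ using hex
  choose! p' hp' hpQ' using hex'
  rw [idealDeg_eq_sum, idealDeg_eq_sum, idealDeg_eq_sum, Finset.sum_mul_sum,
    ← Finset.sum_product']
  rw [← Finset.sum_fiberwise_of_maps_to (g := fun Q => (p Q, p' Q))
    (t := I.finite_minimalPrimes_of_isNoetherianRing.toFinset ×ˢ
      I'.finite_minimalPrimes_of_isNoetherianRing.toFinset)
    (fun Q hQ => by
      rw [Set.Finite.mem_toFinset] at hQ
      simp only [Finset.mem_product, Set.Finite.mem_toFinset]
      exact ⟨hp Q hQ, hp' Q hQ⟩)]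
  refine Finset.sum_le_sum fun P hP => ?_
  simp only [Finset.mem_product, Set.Finite.mem_toFinset] at hP
  have hPp : P.1.IsPrime := hP.1.1.1
  have hPp' : P.2.IsPrime := hP.2.1.1
  refine le_trans (sum_pdeg_le_idealDeg fun Q hQ => ?_) (idealDeg_sup_le_of_isPrime P.1 P.2)
  rw [Finset.mem_filter, Set.Finite.mem_toFinset] at hQ
  obtain ⟨hQ, rfl⟩ := hQ
  exact minimalPrimes_of_le hQ (sup_le_sup hP.1.1.2 hP.2.1.2) (sup_le (hpQ Q hQ) (hpQ' Q hQ))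

theorem idealDeg_sup_finset_le [IsAlgClosed F] {ι : Type*} {s : Finset ι} (hs : s.Nonempty)
    (I : ι → Ideal (MvPolynomial σ F)) : idealDeg (s.sup I) ≤ ∏ i ∈ s, idealDeg (I i) := by
  induction hs using Finset.Nonempty.cons_induction with
  | singleton i => simp
  | cons i s hi _ ih =>
    rw [Finset.sup_cons, Finset.prod_cons]
    exact (idealDeg_sup_le _ _).trans (Nat.mul_le_mul_left _ ih)

end

section

variable {F : Type*} [Field F] [IsAlgClosed F]

section lift

variable {R A : Type*} [CommRing R] [IsDomain R] [IsIntegrallyClosed R]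
  [Algebra F R] [CommRing A] [IsDomain A] [Algebra F A] [Algebra.FiniteType F A] [Algebra R A]
  [IsScalarTower F R A] [Algebra.IsIntegral R A] [FaithfulSMul R A]

theorem exists_algHom_of_root (y₀ : R →ₐ[F] F) (θ : A) {t : F}
    (ht : (minpoly R θ).eval₂ (y₀ : R →+* F) t = 0) :
    ∃ φ : A →ₐ[F] F, (∀ r, φ (algebraMap R A r) = y₀ r) ∧ φ θ = t := by
  obtain ⟨ψ, hψ⟩ : ∃ ψ : Polynomial R →+* F, ψ = Polynomial.eval₂RingHom (y₀ : R →+* F) t :=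
    ⟨_, rfl⟩
  have hψC : ∀ a, ψ (Polynomial.C (algebraMap F R a)) = a := fun a => by simp [hψ]
  have hmax : (RingHom.ker ψ).IsMaximal := RingHom.ker_isMaximal_of_surjective ψ
    fun a => ⟨_, hψC a⟩
  let _ : Algebra (Polynomial R) A := (Polynomial.aeval θ : Polynomial R →ₐ[R] A).toAlgebra
  have hmap : ∀ p, algebraMap (Polynomial R) A p = Polynomial.aeval θ p := fun _ => rfl
  have htower : IsScalarTower R (Polynomial R) A := .of_algebraMap_eq fun r => by
    rw [hmap, Polynomial.algebraMap_eq, Polynomial.aeval_C]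
  have hInt : Algebra.IsIntegral (Polynomial R) A := Algebra.IsIntegral.tower_top R
  have hker : RingHom.ker (algebraMap (Polynomial R) A) ≤ RingHom.ker ψ := by
    intro p hp
    rw [RingHom.mem_ker, hmap] at hp
    obtain ⟨q, rfl⟩ := minpoly.isIntegrallyClosed_dvd (Algebra.IsIntegral.isIntegral θ) hp
    rw [RingHom.mem_ker, map_mul]
    simp [hψ, ht]
  obtain ⟨M, hM, hMψ⟩ := Ideal.exists_ideal_over_maximal_of_isIntegral (RingHom.ker ψ) hker
  obtain ⟨φ, hφ⟩ := exists_algHom_of_isMaximal (F := F) M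
  have key : ∀ p, φ (Polynomial.aeval θ p) = ψ p := by
    intro p
    have h1 : p - Polynomial.C (algebraMap F R (ψ p)) ∈ RingHom.ker ψ := by
      rw [RingHom.mem_ker, map_sub, hψC, sub_self]
    rw [← hMψ, Ideal.mem_comap, hmap, ← hφ, RingHom.mem_ker, map_sub, map_sub, sub_eq_zero,
      Polynomial.aeval_C, ← IsScalarTower.algebraMap_apply, AlgHom.commutes] at h1
    exact h1
  refine ⟨φ, fun r => ?_, ?_⟩
  · simpa [hψ] using key (Polynomial.C r)
  · simpa [hψ] using key Polynomial.X

theorem exists_separable_specialization {F R E : Type*} [Field F] [CommRing R] [IsDomain R]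
    [Field E] [Algebra R E] [IsFractionRing R E] {f : Polynomial R}
    (hf : (f.map (algebraMap R E)).Separable) :
    ∃ g : R, g ≠ 0 ∧ ∀ y₀ : R →+* F, y₀ g ≠ 0 → (f.map y₀).Separable := by
  obtain ⟨a, b, hab⟩ := (Polynomial.separable_def' _).1 hf
  obtain ⟨r, hr, hr'⟩ := IsLocalization.integerNormalization_spec (nonZeroDivisors R) a
  obtain ⟨s, hs, hs'⟩ := IsLocalization.integerNormalization_spec (nonZeroDivisors R) b
  set u := IsLocalization.integerNormalization (nonZeroDivisors R) a
  set v := IsLocalization.integerNormalization (nonZeroDivisors R) b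
  have key : Polynomial.C s * u * f + Polynomial.C r * v * Polynomial.derivative f =
      Polynomial.C (r * s) := by
    apply Polynomial.map_injective (algebraMap R E) (IsFractionRing.injective R E)
    simp only [Polynomial.map_add, Polynomial.map_mul, Polynomial.map_C, hr', hs', map_mul]
    rw [← Polynomial.derivative_map, Algebra.smul_def, Algebra.smul_def]
    simp only [Polynomial.algebraMap_apply]
    linear_combination (Polynomial.C (algebraMap R E r) * Polynomial.C (algebraMap R E s)) * hab
  refine ⟨r * s, mul_ne_zero (nonZeroDivisors.ne_zero hr) (nonZeroDivisors.ne_zero hs),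
    fun y₀ hy => ?_⟩
  have key' := congrArg (Polynomial.map y₀) key
  simp only [Polynomial.map_add, Polynomial.map_mul, Polynomial.map_C] at key'
  rw [← Polynomial.derivative_map] at key'
  rw [Polynomial.separable_def']
  refine ⟨Polynomial.C (y₀ (r * s))⁻¹ * (Polynomial.C (y₀ s) * u.map y₀),
    Polynomial.C (y₀ (r * s))⁻¹ * (Polynomial.C (y₀ r) * v.map y₀), ?_⟩
  rw [mul_assoc (Polynomial.C _) (_ * _), mul_assoc (Polynomial.C _) (_ * Polynomial.map y₀ v),
    ← mul_add, key', ← Polynomial.C_mul, inv_mul_cancel₀ hy, map_one]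

theorem exists_algHoms {E K : Type*} [Field E] [Algebra R E] [IsFractionRing R E] [Field K]
    [Algebra A K] [Algebra R K] [Algebra E K] [IsScalarTower R A K] [IsScalarTower R E K]
    (hAK : Function.Injective (algebraMap A K)) [Algebra.IsSeparable E K] [FiniteDimensional E K]
    (hden : ∀ z : K, ∃ r : R, r ≠ 0 ∧ ∃ a : A, algebraMap A K a = algebraMap R K r * z) :
    ∃ g : R, g ≠ 0 ∧ ∀ y₀ : R →ₐ[F] F, y₀ g ≠ 0 →
      ∃ t : Fin (Module.finrank E K) → A →ₐ[F] F, Function.Injective t ∧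
        ∀ i r, t i (algebraMap R A r) = y₀ r := by
  classical
  obtain ⟨α, hα⟩ := Field.exists_primitive_element E K
  obtain ⟨r, hr, θ, hθ⟩ := hden α
  have hrE : algebraMap R E r ≠ 0 := by
    rwa [ne_eq, FaithfulSMul.algebraMap_eq_zero_iff]
  have hprim : IntermediateField.adjoin E {algebraMap A K θ} = ⊤ := by
    rw [eq_top_iff, ← hα, IntermediateField.adjoin_simple_le_iff]
    have h1 : algebraMap A K θ ∈ IntermediateField.adjoin E {algebraMap A K θ} :=
      IntermediateField.mem_adjoin_simple_self E _
    have h2 := IntermediateField.smul_mem _ h1 (x := (algebraMap R E r)⁻¹)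
    have h3 : (algebraMap R E r)⁻¹ • algebraMap A K θ = α := by
      rw [hθ, IsScalarTower.algebraMap_apply R E K, ← Algebra.smul_def, smul_smul,
        inv_mul_cancel₀ hrE, one_smul]
    rwa [h3] at h2
  rw [Field.primitive_element_iff_minpoly_natDegree_eq] at hprim
  have hInt : IsIntegral R θ := Algebra.IsIntegral.isIntegral θ
  have hmin : minpoly E (algebraMap A K θ) = (minpoly R θ).map (algebraMap R E) := by
    rw [← minpoly.algebraMap_eq hAK]
    exact minpoly.isIntegrallyClosed_eq_field_fractions' E (hInt.map (IsScalarTower.toAlgHom R A K))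
  have hsep : ((minpoly R θ).map (algebraMap R E)).Separable := by
    rw [← hmin]
    exact Algebra.IsSeparable.isSeparable E _
  obtain ⟨g, hg, hg'⟩ := exists_separable_specialization (F := F) hsep
  refine ⟨g, hg, fun y₀ hy => ?_⟩
  have hnodup := Polynomial.nodup_roots (hg' (y₀ : R →+* F) hy)
  set f := (minpoly R θ).map (y₀ : R →+* F) with hf
  have hcard : f.roots.toFinset.card = Module.finrank E K := by
    rw [Multiset.toFinset_card_of_nodup hnodup, IsAlgClosed.card_roots_eq_natDegree, hf,
      (minpoly.monic hInt).natDegree_map, ← hprim, hmin, (minpoly.monic hInt).natDegree_map]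
  let e := (f.roots.toFinset.equivFinOfCardEq hcard).symm
  have hex : ∀ i, ∃ φ : A →ₐ[F] F, (∀ r, φ (algebraMap R A r) = y₀ r) ∧ φ θ = e i := by
    intro i
    refine exists_algHom_of_root y₀ θ ?_
    have h := Multiset.mem_toFinset.1 (e i).2
    have h2 := (Polynomial.mem_roots'.1 h).2
    rw [Polynomial.eval₂_eq_eval_map]
    exact h2
  choose t ht ht' using hex
  refine ⟨t, fun i j hij => ?_, ht⟩
  apply e.injective
  ext
  rw [← ht', ← ht', hij]

end lift

section reduction

variable {K : Type*} [Field K] [Algebra F K] {ι : Type*} [Finite ι]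

theorem IsReduction.isIntegral {F K ι κ : Type*} [Field F] [Field K] [Algebra F K] [Finite ι]
    {x : ι → K} {y : κ → K} (h : IsReduction F x y) (k : ι) :
    IsIntegral (Algebra.adjoin F (Set.range y)) (x k) := by
  obtain ⟨N, hN⟩ := h.pow_le
  set R := Algebra.adjoin F (Set.range y)
  obtain ⟨s, hs⟩ := (Module.Finite.iff_fg).1 (finiteDimensional_linSpan_pow (F := F) x N)
  have hyR : ∀ u ∈ linSpan F y, u ∈ R := fun u hu =>
    linSpan_le (W := Subalgebra.toSubmodule R) (one_mem R)
      (fun i => Algebra.subset_adjoin ⟨i, rfl⟩) hu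
  set M : Submodule R K := Submodule.span R ((linSpan F x ^ N : Submodule F K) : Set K) with hM
  have hsM : M = Submodule.span R (s : Set K) := by
    apply le_antisymm
    · rw [hM, Submodule.span_le, ← hs]
      exact Submodule.span_le_restrictScalars F R (s : Set K)
    · refine Submodule.span_mono ?_
      rw [← hs]
      exact Submodule.subset_span
  have h1 : (1 : K) ∈ M := Submodule.subset_span
    (pow_le_pow_of_one_mem (one_mem_linSpan x) (Nat.zero_le N)
      (by simp [Submodule.one_le.1 le_rfl]))
  refine isIntegral_of_smul_mem_submodule M ?_ ⟨s, hsM.symm⟩ (x k) fun z hz => ?_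
  · intro h0
    rw [h0] at h1
    exact one_ne_zero ((Submodule.mem_bot R).1 h1)
  · induction hz using Submodule.span_induction with
    | zero => simp
    | add a b _ _ ha hb => rw [smul_add]; exact add_mem ha hb
    | smul r a _ ha => rw [smul_comm]; exact M.smul_mem r ha
    | mem a ha =>
      have h2 : x k • a ∈ linSpan F x ^ (N + 1) := by
        rw [pow_succ', smul_eq_mul]
        exact Submodule.mul_mem_mul (mem_linSpan x k) ha
      refine Submodule.mul_induction_on (hN h2) (fun u hu v hv => ?_) fun _ _ => add_mem
      exact M.smul_mem ⟨u, hyR u hu⟩ (Submodule.subset_span hv)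

theorem IsReduction.adjoin_le {F K ι κ : Type*} [Field F] [Field K] [Algebra F K]
    {x : ι → K} {y : κ → K} (h : IsReduction F x y) :
    Algebra.adjoin F (Set.range y) ≤ Algebra.adjoin F (Set.range x) := by
  refine Algebra.adjoin_le ?_
  rintro _ ⟨i, rfl⟩
  exact linSpan_le (W := Subalgebra.toSubmodule (Algebra.adjoin F (Set.range x)))
    (Algebra.adjoin F (Set.range x)).one_mem
    (fun i => Algebra.subset_adjoin ⟨i, rfl⟩) (h.le (mem_linSpan y i))

theorem IsReduction.isIntegral_of_mem {F K ι κ : Type*} [Field F] [Field K] [Algebra F K]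
    [Finite ι] {x : ι → K} {y : κ → K} (h : IsReduction F x y)
    {a : K} (ha : a ∈ Algebra.adjoin F (Set.range x)) :
    IsIntegral (Algebra.adjoin F (Set.range y)) a := by
  have hle : Algebra.adjoin F (Set.range x) ≤
      (integralClosure (Algebra.adjoin F (Set.range y)) K).restrictScalars F := by
    refine Algebra.adjoin_le ?_
    rintro _ ⟨k, rfl⟩
    exact h.isIntegral k
  exact hle ha

open scoped IntermediateField.algebraAdjoinAdjoin in
theorem IsReduction.exists_denominator {F K ι κ : Type*} [Field F] [Field K] [Algebra F K]
    [Finite ι] {x : ι → K} {y : κ → K} (h : IsReduction F x y)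
    (htop : IntermediateField.adjoin F (Set.range x) = ⊤) (z : K) :
    ∃ r ∈ Algebra.adjoin F (Set.range y), r ≠ 0 ∧ r * z ∈ Algebra.adjoin F (Set.range x) := by
  obtain ⟨N, hN⟩ := h.pow_le
  have hz : z ∈ Submodule.span (IntermediateField.adjoin F (Set.range y))
      ((linSpan F x ^ N : Submodule F K) : Set K) := by
    rw [span_pow_eq_top hN htop]; trivial
  induction hz using Submodule.span_induction with
  | zero => exact ⟨1, one_mem _, one_ne_zero, by simp⟩
  | add a b _ _ ha hb =>
    obtain ⟨r, hr, hr0, hra⟩ := ha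
    obtain ⟨s, hs, hs0, hsb⟩ := hb
    refine ⟨r * s, mul_mem hr hs, mul_ne_zero hr0 hs0, ?_⟩
    have : r * s * (a + b) = s * (r * a) + r * (s * b) := by ring
    rw [this]
    exact add_mem (mul_mem (h.adjoin_le hs) hra) (mul_mem (h.adjoin_le hr) hsb)
  | mem a ha =>
    refine ⟨1, one_mem _, one_ne_zero, ?_⟩
    have hle : linSpan F x ≤ Subalgebra.toSubmodule (Algebra.adjoin F (Set.range x)) :=
      linSpan_le (Algebra.adjoin F (Set.range x)).one_mem fun i => Algebra.subset_adjoin ⟨i, rfl⟩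
    have hpow : ∀ m, linSpan F x ^ m ≤ Subalgebra.toSubmodule (Algebra.adjoin F (Set.range x)) := by
      intro m
      induction m with
      | zero => rw [pow_zero, Submodule.one_le]; exact (Algebra.adjoin F (Set.range x)).one_mem
      | succ m ih =>
        rw [pow_succ, Submodule.mul_le]
        exact fun u hu v hv => (Algebra.adjoin F (Set.range x)).mul_mem (ih hu) (hle hv)
    rw [one_mul]
    exact hpow N ha
  | smul e a _ ha =>
    obtain ⟨r, hr, hr0, hra⟩ := ha
    obtain ⟨p, hp, q, hq, hpq⟩ := IntermediateField.mem_adjoin_iff_div.1 e.2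
    rcases eq_or_ne q 0 with hq0 | hq0
    · have he : (e : K) = 0 := by rw [hpq, hq0, div_zero]
      exact ⟨1, one_mem _, one_ne_zero, by rw [IntermediateField.smul_def, he]; simp⟩
    · refine ⟨q * r, mul_mem hq hr, mul_ne_zero hq0 hr0, ?_⟩
      have : q * r * (e • a) = p * (r * a) := by
        rw [IntermediateField.smul_def, smul_eq_mul, hpq]
        field_simp
      rw [this]
      exact mul_mem (h.adjoin_le hp) hra

open scoped IntermediateField.algebraAdjoinAdjoin Subalgebra.inclusion in
theorem IsReduction.exists_algHoms {ρ : ℕ} {x : ι → K} {y : Fin ρ → K} (h : IsReduction F x y)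
    (hy : AlgebraicIndependent F y) (htop : IntermediateField.adjoin F (Set.range x) = ⊤)
    [FiniteDimensional (IntermediateField.adjoin F (Set.range y)) K] :
    ∃ g : Algebra.adjoin F (Set.range y), g ≠ 0 ∧
      ∀ y₀ : Algebra.adjoin F (Set.range y) →ₐ[F] F, y₀ g ≠ 0 →
      ∃ t : Fin (Module.finrank (IntermediateField.adjoin F (Set.range y)) K) →
        Algebra.adjoin F (Set.range x) →ₐ[F] F, Function.Injective t ∧
        ∀ i r, t i (Subalgebra.inclusion h.adjoin_le r) = y₀ r := by
  have hsep := h.separable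
  have hcl : IsIntegrallyClosed (Algebra.adjoin F (Set.range y)) :=
    IsIntegrallyClosed.of_equiv hy.aevalEquiv.toRingEquiv
  have hft : Algebra.FiniteType F (Algebra.adjoin F (Set.range x)) :=
    Algebra.FiniteType.adjoin_of_finite (Set.finite_range x)
  let _ : Algebra (Algebra.adjoin F (Set.range y)) (Algebra.adjoin F (Set.range x)) :=
    (Subalgebra.inclusion h.adjoin_le).toAlgebra
  have htower : IsScalarTower F (Algebra.adjoin F (Set.range y)) (Algebra.adjoin F (Set.range x)) :=
    .of_algebraMap_eq fun _ => rfl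
  have htower' : IsScalarTower (Algebra.adjoin F (Set.range y)) (Algebra.adjoin F (Set.range x)) K :=
    Subalgebra.inclusion.isScalarTower_right h.adjoin_le K
  have hfaith : FaithfulSMul (Algebra.adjoin F (Set.range y)) (Algebra.adjoin F (Set.range x)) := by
    rw [faithfulSMul_iff_algebraMap_injective]
    exact Subalgebra.inclusion_injective _
  have hInt : Algebra.IsIntegral (Algebra.adjoin F (Set.range y)) (Algebra.adjoin F (Set.range x)) :=
    ⟨fun a => (isIntegral_algebraMap_iff (B := K) Subtype.val_injective).1 (h.isIntegral_of_mem a.2)⟩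
  exact _root_.exists_algHoms (F := F) (R := Algebra.adjoin F (Set.range y))
    (A := Algebra.adjoin F (Set.range x)) (E := IntermediateField.adjoin F (Set.range y)) (K := K)
    Subtype.val_injective (fun z => by
      obtain ⟨r, hr, hr0, hrz⟩ := h.exists_denominator htop z
      exact ⟨⟨r, hr⟩, fun h0 => hr0 (congrArg Subtype.val h0), ⟨_, hrz⟩, rfl⟩)

theorem IsReduction.exists_points {ρ : ℕ} {x : ι → K} {y : Fin ρ → K} (h : IsReduction F x y)
    (hy : AlgebraicIndependent F y) (htop : IntermediateField.adjoin F (Set.range x) = ⊤)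
    [FiniteDimensional (IntermediateField.adjoin F (Set.range y)) K] :
    ∃ g : MvPolynomial (Fin ρ) F, g ≠ 0 ∧ ∀ w, eval w g ≠ 0 →
      ∃ t : Fin (Module.finrank (IntermediateField.adjoin F (Set.range y)) K) → ι → F,
        Function.Injective t ∧
        ∀ i p q, aeval x p = aeval y q → eval (t i) p = eval w q := by
  obtain ⟨g, hg, hg'⟩ := h.exists_algHoms hy htop
  refine ⟨hy.aevalEquiv.symm g, by simpa using hg, fun w hw => ?_⟩
  obtain ⟨t, htinj, ht⟩ := hg' ((aeval w).comp hy.aevalEquiv.symm.toAlgHom) hw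
  obtain ⟨X', hXx⟩ : ∃ X' : ι → Algebra.adjoin F (Set.range x), ∀ k, (X' k : K) = x k :=
    ⟨fun k => ⟨x k, Algebra.subset_adjoin ⟨k, rfl⟩⟩, fun _ => rfl⟩
  have hX' : ∀ p : MvPolynomial ι F, ((aeval X' p : Algebra.adjoin F (Set.range x)) : K) = aeval x p :=
    fun p => by
      have := aeval_algebraMap_apply K X' p
      rw [← Subalgebra.algebraMap_apply, ← this]
      congr 1
      exact congrArg _ (funext fun k => hXx k)
  have heval : ∀ i p, eval (fun k => t i (X' k)) p = t i (aeval X' p) := by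
    intro i p
    rw [← AlgHom.comp_apply, ← MvPolynomial.aeval_eq_eval]
    refine DFunLike.congr_fun (MvPolynomial.algHom_ext fun k => ?_) p
    simp
  refine ⟨fun i k => t i (X' k), fun i j hij => htinj ?_, fun i p q hpq => ?_⟩
  · refine AlgHom.ext fun a => ?_
    obtain ⟨p, hp⟩ := (Algebra.adjoin_range_eq_range_aeval F x).le a.2
    have : a = aeval X' p := Subtype.ext (by rw [hX']; exact hp.symm)
    rw [this, ← heval, ← heval]
    exact congrArg (fun v => eval v p) hij
  · rw [heval]
    have h1 : aeval X' p = Subalgebra.inclusion h.adjoin_le (hy.aevalEquiv q) := by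
      apply Subtype.ext
      rw [hX', hpq, hy.algebraMap_aevalEquiv q |>.symm]
      rfl
    rw [h1, ht]
    simp

end reduction

end

section

variable {F : Type*} [Field F]

theorem IsReduction.exists_monic {K ι κ : Type*} [Field K] [Algebra F K] [Finite ι] [IsAlgClosed F]
    {x : ι → K} {y : κ → K} (h : IsReduction F x y) (k : ι) :
    ∃ m : Polynomial (MvPolynomial κ F), m.Monic ∧
      m.eval₂ (aeval y : MvPolynomial κ F →ₐ[F] K).toRingHom (x k) = 0 := by
  obtain ⟨p, hp, hpx⟩ := h.isIntegral k
  have hsurj : ∀ r : Algebra.adjoin F (Set.range y), ∃ q : MvPolynomial κ F, aeval y q = (r : K) :=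
    fun r => (Algebra.adjoin_range_eq_range_aeval F y).le r.2
  obtain ⟨q, hq⟩ : ∃ q : Polynomial K, q = p.map (algebraMap (Algebra.adjoin F (Set.range y)) K) :=
    ⟨_, rfl⟩
  have hlift : q ∈ Polynomial.lifts (aeval y : MvPolynomial κ F →ₐ[F] K).toRingHom := by
    rw [Polynomial.lifts_iff_coeff_lifts]
    intro i
    obtain ⟨s, hs⟩ := hsurj (p.coeff i)
    refine ⟨s, ?_⟩
    rw [hq, Polynomial.coeff_map]
    exact hs
  have hqm : q.Monic := hq ▸ hp.map _
  obtain ⟨m, hm, _, hmm⟩ := Polynomial.lifts_and_natDegree_eq_and_monic hlift hqm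
  refine ⟨m, hmm, ?_⟩
  rw [Polynomial.eval₂_eq_eval_map, hm, hq, ← Polynomial.eval₂_eq_eval_map]
  exact hpx

theorem IsReduction.finite_fiber [IsAlgClosed F] {K : Type*} [Field K] [Algebra F K] {ι κ : Type*}
    [Fintype ι] {x : ι → K} (c : κ → ι → F) (h : IsReduction F x (fun i => ∑ k, c i k • x k))
    (w : κ → F) :
    {v : ι → F | (∀ p : MvPolynomial ι F, aeval x p = 0 → eval v p = 0) ∧
      ∀ i, ∑ k, c i k * v k = w i}.Finite := by
  choose m hm hmx using h.exists_monic
  have hroot : ∀ k, {t : F | ((m k).map (eval w)).IsRoot t}.Finite := fun k =>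
    Polynomial.finite_setOfPred_isRoot ((hm k).map _).ne_zero
  refine (Set.Finite.pi' hroot).subset ?_
  rintro v ⟨hv, hw⟩ k
  obtain ⟨ψ, hψ⟩ : ∃ ψ : MvPolynomial κ F →ₐ[F] MvPolynomial ι F,
    ψ = aeval (fun i => ∑ k, C (c i k) * X k) := ⟨_, rfl⟩
  have h1 : aeval x ((m k).eval₂ ψ.toRingHom (X k)) = 0 := by
    rw [← hmx k, ← AlgHom.coe_toRingHom, Polynomial.hom_eval₂]
    congr 1
    · refine MvPolynomial.ringHom_ext (fun a => ?_) fun i => ?_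
      · simp
      · simp [hψ, Algebra.smul_def]
    · simp
  have h2 := hv _ h1
  rw [Polynomial.hom_eval₂] at h2
  have h3 : (eval v).comp ψ.toRingHom = eval w := by
    refine MvPolynomial.ringHom_ext (fun a => ?_) fun i => ?_
    · simp
    · simp [hψ, hw]
  rw [h3, eval_X] at h2
  rw [Set.mem_ofPred_eq, Polynomial.IsRoot.def, ← Polynomial.eval₂_eq_eval_map]
  exact h2

theorem IsReduction.exists_mul_eq [IsAlgClosed F] {K : Type*} [Field K] [Algebra F K] {ι κ : Type*}
    [Finite ι] {x : ι → K} {y : κ → K} (h : IsReduction F x y)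
    (htop : IntermediateField.adjoin F (Set.range x) = ⊤) {a : MvPolynomial ι F}
    (ha : aeval x a ≠ 0) :
    ∃ b : MvPolynomial ι F, ∃ g : MvPolynomial κ F, g ≠ 0 ∧ aeval x (a * b) = aeval y g := by
  obtain ⟨r, hr, hr0, hra⟩ := h.exists_denominator htop (aeval x a)⁻¹
  obtain ⟨g, hg⟩ := (Algebra.adjoin_range_eq_range_aeval F y).le hr
  obtain ⟨b, hb⟩ := (Algebra.adjoin_range_eq_range_aeval F x).le hra
  refine ⟨b, g, ?_, ?_⟩
  · rintro rfl
    exact hr0 (hg.symm.trans (map_zero _))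
  · have hb' : aeval x b = r * (aeval x a)⁻¹ := hb
    have hg' : aeval y g = r := hg
    rw [map_mul, hb', hg']
    field_simp

theorem exists_fiber_of_field [IsAlgClosed F] {J : Type*} [Fintype J] {K : J → Type*}
    [∀ j, Field (K j)] [∀ j, Algebra F (K j)] {n₀ ρ : ℕ} (x : ∀ j, Fin n₀ → K j)
    (htop : ∀ j, IntermediateField.adjoin F (Set.range (x j)) = ⊤)
    (hρ : ∀ j, Algebra.trdeg F (K j) = ρ) (hn : ρ ≤ n₀)
    (Q : J → Ideal (MvPolynomial (Fin n₀) F)) (hQ : ∀ j p, aeval (x j) p = 0 ↔ p ∈ Q j)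
    (hle : ∀ i j, Q i ≤ Q j → i = j) (D : J → ℕ) (hD : ∀ j δ, HasDeg F (x j) ρ δ → δ = D j) :
    ∃ c : Fin ρ → Fin n₀ → F,
      (∀ w : Fin ρ → F, {v : Fin n₀ → F | (∃ j, ∀ p ∈ Q j, eval v p = 0) ∧
        ∀ i, ∑ k, c i k * v k = w i}.Finite) ∧
      ∃ h : MvPolynomial (Fin ρ) F, h ≠ 0 ∧ ∀ w, eval w h ≠ 0 →
        ∑ j, D j ≤ Nat.card {v : Fin n₀ → F | (∃ j, ∀ p ∈ Q j, eval v p = 0) ∧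
          ∀ i, ∑ k, c i k * v k = w i} := by
  classical
  obtain ⟨c, hc⟩ := exists_common_reduction x htop hρ hn
  have hfin : ∀ w : Fin ρ → F, {v : Fin n₀ → F | (∃ j, ∀ p ∈ Q j, eval v p = 0) ∧
      ∀ i, ∑ k, c i k * v k = w i}.Finite := by
    intro w
    refine (Set.finite_iUnion fun j => (hc j).finite_fiber c w).subset ?_
    rintro v ⟨⟨j, hj⟩, hv⟩
    exact Set.mem_iUnion.2 ⟨j, fun p hp => hj p ((hQ j p).1 hp), hv⟩
  refine ⟨c, hfin, ?_⟩
  have hred : ∀ j, FiniteDimensional (IntermediateField.adjoin F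
      (Set.range fun i => ∑ k, c i k • x j k)) (K j) ∧
      Module.finrank (IntermediateField.adjoin F (Set.range fun i => ∑ k, c i k • x j k)) (K j) = D j := by
    intro j
    obtain ⟨N, hN⟩ := (hc j).pow_le
    obtain ⟨h1, h2⟩ := hasDeg_of_reduction ((hc j).algebraicIndependent (hρ j)) (hc j).le hN (htop j)
    exact ⟨h1, hD j _ h2⟩
  have hpts : ∀ j, ∃ g : MvPolynomial (Fin ρ) F, g ≠ 0 ∧ ∀ w, eval w g ≠ 0 →
      ∃ t : Fin (D j) → Fin n₀ → F, Function.Injective t ∧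
        ∀ i p q, aeval (x j) p = aeval (fun i => ∑ k, c i k • x j k) q →
          eval (t i) p = eval w q := by
    intro j
    have := (hred j).1
    rw [← (hred j).2]
    exact (hc j).exists_points ((hc j).algebraicIndependent (hρ j)) (htop j)
  choose g hg hg' using hpts
  have hsep : ∀ i j, ∃ q : MvPolynomial (Fin ρ) F, q ≠ 0 ∧ (i ≠ j → ∃ a b, a ∈ Q j ∧
      aeval (x i) (a * b) = aeval (fun k => ∑ l, c k l • x i l) q) := by
    intro i j
    rcases eq_or_ne i j with rfl | hij
    · exact ⟨1, one_ne_zero, fun h => absurd rfl h⟩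
    · obtain ⟨a, haj, hai⟩ := SetLike.not_le_iff_exists.1 fun h => hij.symm (hle j i h)
      obtain ⟨b, q, hq, hab⟩ := (hc i).exists_mul_eq (htop i) (a := a) (by rwa [ne_eq, hQ])
      exact ⟨q, hq, fun _ => ⟨a, b, haj, hab⟩⟩
  choose q hq hq' using hsep
  refine ⟨(∏ j, g j) * ∏ i, ∏ j, q i j, mul_ne_zero (Finset.prod_ne_zero_iff.2 fun j _ => hg j)
    (Finset.prod_ne_zero_iff.2 fun i _ => Finset.prod_ne_zero_iff.2 fun j _ => hq i j), ?_⟩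
  intro w hw
  rw [map_mul, map_prod, map_prod, mul_ne_zero_iff, Finset.prod_ne_zero_iff,
    Finset.prod_ne_zero_iff] at hw
  have hwq : ∀ i j, eval w (q i j) ≠ 0 := by
    intro i j
    have := hw.2 i (Finset.mem_univ i)
    rw [map_prod, Finset.prod_ne_zero_iff] at this
    exact this j (Finset.mem_univ j)
  choose t htinj ht using fun j => hg' j w (hw.1 j (Finset.mem_univ j))
  have hmem : ∀ j i, ∀ p ∈ Q j, eval (t j i) p = 0 := by
    intro j i p hp
    rw [ht j i p 0 (by rw [(hQ j p).2 hp, map_zero]), map_zero]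
  have := (hfin w).to_subtype
  let f : (Σ j, Fin (D j)) → {v : Fin n₀ → F | (∃ j, ∀ p ∈ Q j, eval v p = 0) ∧
      ∀ i, ∑ k, c i k * v k = w i} := fun s => ⟨t s.1 s.2, ⟨s.1, hmem s.1 s.2⟩, fun i => by
    have := ht s.1 s.2 (∑ k, C (c i k) * X k) (X i) (by simp [Algebra.smul_def])
    simpa using this⟩
  have hf : Function.Injective f := by
    rintro ⟨j, a⟩ ⟨j', a'⟩ h
    have h' : t j a = t j' a' := congrArg Subtype.val h
    obtain rfl : j = j' := by
      by_contra hjj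
      obtain ⟨p, b, hp, hpb⟩ := hq' j j' hjj
      have h1 := ht j a _ _ hpb
      rw [map_mul, h', hmem j' a' p hp, zero_mul] at h1
      exact hwq j j' h1.symm
    rw [htinj j h']
  have hcard := Nat.card_le_card_of_injective f hf
  simpa using hcard

/-- A finite family of primes of the same dimension has a finite linear projection whose generic
fiber has as many points as the sum of the degrees. -/
theorem exists_fiber [IsAlgClosed F] {n₀ ρ : ℕ} (s : Finset (Ideal (MvPolynomial (Fin n₀) F)))
    (hs : s.Nonempty) (hprime : ∀ Q ∈ s, Q.IsPrime) (hρ : ∀ Q ∈ s, pdim Q = ρ) :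
    ∃ c : Fin ρ → Fin n₀ → F,
      (∀ w : Fin ρ → F, {v : Fin n₀ → F | (∃ Q ∈ s, ∀ p ∈ Q, eval v p = 0) ∧
        ∀ i, ∑ k, c i k * v k = w i}.Finite) ∧
      ∃ h : MvPolynomial (Fin ρ) F, h ≠ 0 ∧ ∀ w, eval w h ≠ 0 →
        ∑ Q ∈ s, pdeg Q ≤ Nat.card {v : Fin n₀ → F | (∃ Q ∈ s, ∀ p ∈ Q, eval v p = 0) ∧
          ∀ i, ∑ k, c i k * v k = w i} := by
  have hp : ∀ Q : s, Q.1.IsPrime := fun Q => hprime Q.1 Q.2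
  have htr : ∀ Q : s, Algebra.trdeg F (FractionRing (MvPolynomial (Fin n₀) F ⧸ Q.1)) = ρ := by
    intro Q
    rw [trdeg_fractionRing, ← cast_dimOver]
    exact congrArg _ (hρ Q.1 Q.2)
  have htop := fun Q : s => adjoin_algebraMap_eq_top (adjoin_coord Q.1)
  have hker : ∀ (Q : s) p,
      aeval (algebraMap _ (FractionRing (MvPolynomial (Fin n₀) F ⧸ Q.1)) ∘ coord Q.1) p = 0 ↔
        p ∈ Q.1 := by
    intro Q p
    have h : aeval (algebraMap _ (FractionRing (MvPolynomial (Fin n₀) F ⧸ Q.1)) ∘ coord Q.1) p =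
        algebraMap _ (FractionRing (MvPolynomial (Fin n₀) F ⧸ Q.1)) (Ideal.Quotient.mkₐ F Q.1 p) := by
      have h3 := aeval_algebraMap_apply (FractionRing (MvPolynomial (Fin n₀) F ⧸ Q.1)) (coord Q.1) p
      refine h3.trans (congrArg _ ?_)
      refine DFunLike.congr_fun (MvPolynomial.algHom_ext fun k => ?_) p
      simp [coord]
    rw [h, FaithfulSMul.algebraMap_eq_zero_iff]
    exact Ideal.Quotient.eq_zero_iff_mem
  have hle : ∀ Q Q' : s, Q.1 ≤ Q'.1 → Q = Q' := by
    intro Q Q' h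
    by_contra hne
    have hlt : Q.1 < Q'.1 := lt_of_le_of_ne h fun h' => hne (Subtype.ext h')
    have := pdim_lt_of_lt hlt
    rw [hρ _ Q.2, hρ _ Q'.2] at this
    exact lt_irrefl _ this
  have hdeg : ∀ (Q : s) (δ : ℕ), HasDeg F
      (algebraMap _ (FractionRing (MvPolynomial (Fin n₀) F ⧸ Q.1)) ∘ coord Q.1) ρ δ →
        δ = pdeg Q.1 := by
    intro Q δ h
    have h' : HasDeg F (coord Q.1) (pdim Q.1) δ := by
      rw [hρ _ Q.2]
      exact h.of_injective (IsScalarTower.toAlgHom F _ (FractionRing (MvPolynomial (Fin n₀) F ⧸ Q.1)))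
        (IsFractionRing.injective _ _)
    exact h'.pdeg_eq.symm
  obtain ⟨Q₀, hQ₀⟩ := hs
  obtain ⟨c, h1, h2⟩ := exists_fiber_of_field (J := s)
    (K := fun Q => FractionRing (MvPolynomial (Fin n₀) F ⧸ Q.1))
    (fun Q => algebraMap _ _ ∘ coord Q.1) htop htr
    (trdeg_le_of_adjoin_eq_top (htop ⟨Q₀, hQ₀⟩) (htr ⟨Q₀, hQ₀⟩)) (fun Q => Q.1) hker hle
    (fun Q => pdeg Q.1) hdeg
  refine ⟨c, ?_, ?_⟩
  · simpa [Subtype.exists] using h1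
  · have hsum : ∑ j ∈ s.attach, pdeg j.1 = ∑ Q ∈ s, pdeg Q := Finset.sum_attach s pdeg
    simpa [hsum, Subtype.exists] using h2

end

section

variable {F σ : Type*} [Field F]

/-- The restriction of polynomial functions to the line through the origin and `v`. -/
def lineRestrict (v : σ → F) : MvPolynomial σ F →ₐ[F] Polynomial F :=
  aeval fun i => Polynomial.C (v i) * Polynomial.X

/-- The map sending a form `f` of degree `d` to `f T ^ d`. -/
def gradingHom (F σ : Type*) [Field F] : MvPolynomial σ F →ₐ[F] Polynomial (MvPolynomial σ F) :=
  aeval fun i => Polynomial.C (X i) * Polynomial.X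

theorem eval_lineRestrict (v : σ → F) (f : MvPolynomial σ F) (t : F) :
    (lineRestrict v f).eval t = eval (t • v) f := by
  induction f using MvPolynomial.induction_on with
  | C a => simp [lineRestrict]
  | add p q hp hq => simp [hp, hq]
  | mul_X p i hp =>
    rw [map_mul, Polynomial.eval_mul, hp]
    have h : lineRestrict v (X i) = Polynomial.C (v i) * Polynomial.X := by simp [lineRestrict]
    rw [h]
    simp [mul_comm t]

theorem map_gradingHom (v : σ → F) (f : MvPolynomial σ F) :
    (gradingHom F σ f).map (eval v) = lineRestrict v f := by
  induction f using MvPolynomial.induction_on with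
  | C a => simp [gradingHom, lineRestrict, Polynomial.algebraMap_apply, MvPolynomial.algebraMap_eq]
  | add p q hp hq => simp [hp, hq]
  | mul_X p i hp =>
    rw [map_mul, Polynomial.map_mul, hp]
    simp [gradingHom, lineRestrict]

theorem eval_one_gradingHom (f : MvPolynomial σ F) : (gradingHom F σ f).eval 1 = f := by
  induction f using MvPolynomial.induction_on with
  | C a => simp [gradingHom, Polynomial.algebraMap_apply, MvPolynomial.algebraMap_eq]
  | add p q hp hq => simp [hp, hq]
  | mul_X p i hp =>
    rw [map_mul, Polynomial.eval_mul, hp]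
    simp [gradingHom]

theorem isHomogeneous_coeff_gradingHom (f : MvPolynomial σ F) (d : ℕ) :
    ((gradingHom F σ f).coeff d).IsHomogeneous d := by
  induction f using MvPolynomial.induction_on generalizing d with
  | C a =>
    rw [gradingHom, aeval_C, Polynomial.algebraMap_apply, Polynomial.coeff_C]
    split_ifs with h
    · rw [h]; exact isHomogeneous_C σ a
    · exact isHomogeneous_zero σ F d
  | add p q hp hq => rw [map_add, Polynomial.coeff_add]; exact (hp d).add (hq d)
  | mul_X p i hp =>
    have h : gradingHom F σ (p * X i) =
        gradingHom F σ p * Polynomial.C (X i) * Polynomial.X := by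
      rw [map_mul, mul_assoc]
      simp [gradingHom]
    rw [h]
    cases d with
    | zero => rw [Polynomial.coeff_mul_X_zero]; exact isHomogeneous_zero σ F 0
    | succ d =>
      rw [Polynomial.coeff_mul_X, Polynomial.coeff_mul_C]
      exact (hp d).mul (isHomogeneous_X F i)

/-- The largest homogeneous ideal contained in `I`. -/
def homCore (I : Ideal (MvPolynomial σ F)) : Ideal (MvPolynomial σ F) :=
  RingHom.ker ((Polynomial.mapRingHom (Ideal.Quotient.mk I)).comp (gradingHom F σ).toRingHom)

theorem mem_homCore {I : Ideal (MvPolynomial σ F)} {f : MvPolynomial σ F} :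
    f ∈ homCore I ↔ ∀ d, (gradingHom F σ f).coeff d ∈ I := by
  rw [homCore, RingHom.mem_ker, Polynomial.ext_iff]
  refine forall_congr' fun d => ?_
  simp [Ideal.Quotient.eq_zero_iff_mem]

theorem homCore_le (I : Ideal (MvPolynomial σ F)) : homCore I ≤ I := by
  intro f hf
  rw [← eval_one_gradingHom f, Polynomial.eval_eq_sum]
  exact I.sum_mem fun d _ => I.mul_mem_right _ (mem_homCore.1 hf d)

theorem homCore_mono {I I' : Ideal (MvPolynomial σ F)} (h : I ≤ I') : homCore I ≤ homCore I' :=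
  fun _ hf => mem_homCore.2 fun d => h (mem_homCore.1 hf d)

instance isPrime_homCore (P : Ideal (MvPolynomial σ F)) [P.IsPrime] : (homCore P).IsPrime :=
  RingHom.ker_isPrime _

theorem le_homCore_of_mem_minimalPrimes {I Q : Ideal (MvPolynomial σ F)} (hI : I ≤ homCore I)
    (hQ : Q ∈ I.minimalPrimes) : Q ≤ homCore Q := by
  have := hQ.1.1
  exact hQ.2 ⟨inferInstance, hI.trans (homCore_mono hQ.1.2)⟩ (homCore_le Q)

theorem sup_le_homCore {I I' : Ideal (MvPolynomial σ F)} (hI : I ≤ homCore I)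
    (hI' : I' ≤ homCore I') : I ⊔ I' ≤ homCore (I ⊔ I') :=
  sup_le (hI.trans (homCore_mono le_sup_left)) (hI'.trans (homCore_mono le_sup_right))

theorem finset_sup_le_homCore {ι : Type*} (s : Finset ι) {I : ι → Ideal (MvPolynomial σ F)}
    (hI : ∀ i, I i ≤ homCore (I i)) : s.sup I ≤ homCore (s.sup I) :=
  Finset.sup_le fun i hi => (hI i).trans (homCore_mono (Finset.le_sup hi))

theorem span_linear_le_homCore {κ : Type*} [Fintype σ] (c : κ → σ → F) :
    Ideal.span (Set.range fun i => ∑ j, C (c i j) * X j) ≤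
      homCore (Ideal.span (Set.range fun i => ∑ j, C (c i j) * X j)) := by
  rw [Ideal.span_le]
  rintro _ ⟨i, rfl⟩
  rw [SetLike.mem_coe, mem_homCore]
  intro d
  have h : gradingHom F σ (∑ j, C (c i j) * X j) =
      Polynomial.C (∑ j, C (c i j) * X j) * Polynomial.X := by
    rw [map_sum, map_sum, Finset.sum_mul]
    refine Finset.sum_congr rfl fun j _ => ?_
    simp [gradingHom, Polynomial.algebraMap_apply, MvPolynomial.algebraMap_eq, mul_assoc]
  rw [h, Polynomial.coeff_C_mul_X]
  split_ifs
  · exact Ideal.subset_span ⟨i, rfl⟩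
  · exact Ideal.zero_mem _

end

section

variable {F : Type*} [Field F] {n : ℕ}

/-- The homogeneous ideal of a point. -/
def ptIdeal (x : ℙ F (Fin (n + 1) → F)) : Ideal (MvPolynomial (Fin (n + 1)) F) :=
  RingHom.ker (lineRestrict x.rep)

instance (x : ℙ F (Fin (n + 1) → F)) : (ptIdeal x).IsPrime := RingHom.ker_isPrime _

theorem lineRestrict_eq_zero [Infinite F] {v : Fin (n + 1) → F} (hv : v ≠ 0)
    {f : MvPolynomial (Fin (n + 1)) F} :
    lineRestrict v f = 0 ↔ PVanish f (Projectivization.mk F v hv) := by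
  constructor
  · intro h u hu hx
    obtain ⟨a, rfl⟩ := (Projectivization.mk_eq_mk_iff' F u v hu hv).1 hx
    rw [← eval_lineRestrict, h, Polynomial.eval_zero]
  · intro h
    apply Polynomial.eq_zero_of_infinite_isRoot
    refine (Set.Finite.infinite_compl (Set.finite_singleton (0 : F))).mono fun t ht => ?_
    have ht0 : t ≠ 0 := ht
    have h1 : (lineRestrict v f).eval t = 0 := by
      rw [eval_lineRestrict]
      exact h _ (smul_ne_zero ht0 hv) ((Projectivization.mk_eq_mk_iff' F _ _ _ hv).2 ⟨t, rfl⟩)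
    exact h1

theorem mem_ptIdeal [Infinite F] {x : ℙ F (Fin (n + 1) → F)} {f : MvPolynomial (Fin (n + 1)) F} :
    f ∈ ptIdeal x ↔ PVanish f x := by
  rw [ptIdeal, RingHom.mem_ker]
  have h := lineRestrict_eq_zero (f := f) x.rep_nonzero
  rwa [Projectivization.mk_rep] at h

theorem eval_zero_of_mem_ptIdeal {x : ℙ F (Fin (n + 1) → F)} {f : MvPolynomial (Fin (n + 1)) F}
    (hf : f ∈ ptIdeal x) : eval 0 f = 0 := by
  have h := eval_lineRestrict x.rep f 0
  rw [RingHom.mem_ker.1 hf, zero_smul, Polynomial.eval_zero] at h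
  exact h.symm

theorem ptIdeal_le_ker_eval_zero (x : ℙ F (Fin (n + 1) → F)) :
    ptIdeal x ≤ RingHom.ker (aeval (0 : Fin (n + 1) → F)) := fun _ hf => by
  rw [RingHom.mem_ker, MvPolynomial.aeval_eq_eval]
  exact eval_zero_of_mem_ptIdeal hf

/-- The homogeneous ideal of a set of points. -/
def pIdeal (V : Set (ℙ F (Fin (n + 1) → F))) : Ideal (MvPolynomial (Fin (n + 1)) F) :=
  ⨅ x ∈ V, ptIdeal x

/-- The zero locus of an ideal. -/
def pZero (I : Ideal (MvPolynomial (Fin (n + 1)) F)) : Set (ℙ F (Fin (n + 1) → F)) :=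
  {x | I ≤ ptIdeal x}

theorem mem_pIdeal {V : Set (ℙ F (Fin (n + 1) → F))} {f : MvPolynomial (Fin (n + 1)) F} :
    f ∈ pIdeal V ↔ ∀ x ∈ V, f ∈ ptIdeal x := by
  simp [pIdeal]

theorem pIdeal_le_ptIdeal {V : Set (ℙ F (Fin (n + 1) → F))} {x : ℙ F (Fin (n + 1) → F)}
    (hx : x ∈ V) : pIdeal V ≤ ptIdeal x := fun _ hf => mem_pIdeal.1 hf x hx

theorem le_pIdeal_iff {V : Set (ℙ F (Fin (n + 1) → F))} {I : Ideal (MvPolynomial (Fin (n + 1)) F)} :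
    I ≤ pIdeal V ↔ V ⊆ pZero I := by
  simp only [pIdeal, le_iInf_iff]
  rfl

theorem pIdeal_anti {V W : Set (ℙ F (Fin (n + 1) → F))} (h : V ⊆ W) : pIdeal W ≤ pIdeal V :=
  biInf_mono h

theorem pZero_anti {I I' : Ideal (MvPolynomial (Fin (n + 1)) F)} (h : I ≤ I') :
    pZero I' ⊆ pZero I := fun _ hx => h.trans hx

theorem pZero_sup (I I' : Ideal (MvPolynomial (Fin (n + 1)) F)) :
    pZero (I ⊔ I') = pZero I ∩ pZero I' :=
  Set.ext fun x => sup_le_iff (a := I) (b := I') (c := ptIdeal x)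

theorem pZero_finset_sup {ι : Type*} (s : Finset ι)
    (I : ι → Ideal (MvPolynomial (Fin (n + 1)) F)) :
    pZero (s.sup I) = ⋂ i ∈ s, pZero (I i) := by
  ext x
  simp [pZero, Finset.sup_le_iff]

variable [Infinite F]

theorem ptIdeal_le_homCore (x : ℙ F (Fin (n + 1) → F)) : ptIdeal x ≤ homCore (ptIdeal x) := by
  intro f hf
  rw [mem_homCore]
  intro d
  have hf' := hf
  rw [mem_ptIdeal] at hf' ⊢
  intro v hv hx
  subst hx
  rw [← lineRestrict_eq_zero, ← map_gradingHom] at hf'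
  simpa using congrArg (fun p => Polynomial.coeff p d) hf'

theorem pIdeal_le_homCore (V : Set (ℙ F (Fin (n + 1) → F))) : pIdeal V ≤ homCore (pIdeal V) := by
  intro f hf
  rw [mem_homCore]
  intro d
  rw [mem_pIdeal] at hf ⊢
  exact fun x hx => mem_homCore.1 (ptIdeal_le_homCore x (hf x hx)) d

theorem isAlgSet_pZero (I : Ideal (MvPolynomial (Fin (n + 1)) F)) : IsAlgSet (pZero I) := by
  refine ⟨{g | ∃ f ∈ I, ∃ d, g = (gradingHom F _ f).coeff d}, ?_, ?_⟩
  · rintro _ ⟨f, _, d, rfl⟩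
    exact ⟨d, isHomogeneous_coeff_gradingHom f d⟩
  · ext x
    constructor
    · rintro hx _ ⟨f, hf, d, rfl⟩
      rw [← mem_ptIdeal]
      exact mem_homCore.1 (ptIdeal_le_homCore x (hx hf)) d
    · intro hx f hf
      apply homCore_le
      rw [mem_homCore]
      intro d
      rw [mem_ptIdeal]
      exact hx _ ⟨f, hf, d, rfl⟩

theorem IsAlgSet.pZero_pIdeal {V : Set (ℙ F (Fin (n + 1) → F))} (hV : IsAlgSet V) :
    pZero (pIdeal V) = V := by
  obtain ⟨S, _, rfl⟩ := hV
  refine Set.Subset.antisymm (fun x hx f hf => ?_) (le_pIdeal_iff.1 le_rfl)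
  rw [← mem_ptIdeal]
  refine hx (mem_pIdeal.2 fun y hy => ?_)
  rw [mem_ptIdeal]
  exact hy f hf

theorem IsIrredAlg.isPrime_pIdeal {C : Set (ℙ F (Fin (n + 1) → F))} (hC : IsIrredAlg C) :
    (pIdeal C).IsPrime := by
  obtain ⟨_, ⟨x, hx⟩, h⟩ := hC
  refine ⟨fun htop => ?_, fun {f g} hfg => ?_⟩
  · have h1 : (1 : MvPolynomial (Fin (n + 1)) F) ∈ pIdeal C := by rw [htop]; trivial
    exact (Ideal.ne_top_iff_one _).1 (inferInstance : (ptIdeal x).IsPrime).ne_top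
      (mem_pIdeal.1 h1 x hx)
  · have hmem : ∀ p : MvPolynomial (Fin (n + 1)) F, p ∈ pIdeal C ↔ C ⊆ pZero (Ideal.span {p}) := by
      intro p
      rw [← le_pIdeal_iff, Ideal.span_singleton_le_iff_mem]
    rw [hmem, hmem]
    refine h _ _ (isAlgSet_pZero _) (isAlgSet_pZero _) fun y hy => ?_
    rcases (inferInstance : (ptIdeal y).IsPrime).mem_or_mem (mem_pIdeal.1 hfg y hy) with h1 | h1
    · exact Or.inl ((Ideal.span_singleton_le_iff_mem _).2 h1)
    · exact Or.inr ((Ideal.span_singleton_le_iff_mem _).2 h1)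

theorem ptIdeal_injective {x y : ℙ F (Fin (n + 1) → F)} (h : ptIdeal y ≤ ptIdeal x) : x = y := by
  induction x using Projectivization.ind with | _ v hv
  induction y using Projectivization.ind with | _ u hu
  rw [Projectivization.mk_eq_mk_iff']
  obtain ⟨i, hi⟩ : ∃ i, u i ≠ 0 := by
    by_contra! h0
    exact hu (funext h0)
  refine ⟨v i / u i, funext fun j => ?_⟩
  have h1 : C (u i) * X j - C (u j) * X i ∈ ptIdeal (Projectivization.mk F u hu) := by
    rw [mem_ptIdeal, ← lineRestrict_eq_zero]
    simp only [lineRestrict, map_sub, map_mul, aeval_X, aeval_C, Polynomial.algebraMap_apply,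
      Algebra.algebraMap_self, RingHom.id_apply]
    ring
  have h2 := mem_ptIdeal.1 (h h1) v hv rfl
  simp only [map_sub, map_mul, eval_C, eval_X, sub_eq_zero] at h2
  rw [Pi.smul_apply, smul_eq_mul, div_mul_eq_mul_div, div_eq_iff hi]
  linear_combination -h2

end

section

variable {F : Type*} [Field F] [IsAlgClosed F] {n : ℕ} {Q : Ideal (MvPolynomial (Fin (n + 1)) F)}

theorem le_ptIdeal_of_eval_eq_zero (hQ : Q ≤ homCore Q) {v : Fin (n + 1) → F} (hv : v ≠ 0)
    (h : ∀ p ∈ Q, eval v p = 0) : Q ≤ ptIdeal (Projectivization.mk F v hv) := by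
  intro f hf
  rw [mem_ptIdeal, ← lineRestrict_eq_zero, ← map_gradingHom]
  ext d
  rw [Polynomial.coeff_map, h _ (mem_homCore.1 (hQ hf) d), Polynomial.coeff_zero]

theorem mem_of_eval_eq_zero [Q.IsPrime] {f : MvPolynomial (Fin (n + 1)) F}
    (h : ∀ v, (∀ p ∈ Q, eval v p = 0) → eval v f = 0) : f ∈ Q := by
  rw [← IsPrime.vanishingIdeal_zeroLocus (K := F) Q, mem_vanishingIdeal_iff]
  intro v hv
  rw [mem_zeroLocus_iff] at hv
  simp only [MvPolynomial.aeval_eq_eval] at hv ⊢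
  exact h v hv

theorem pIdeal_pZero [Q.IsPrime] (hQ : Q ≤ homCore Q) (hne : (pZero Q).Nonempty) :
    pIdeal (pZero Q) = Q := by
  refine le_antisymm (fun f hf => mem_of_eval_eq_zero fun v hv => ?_) (le_pIdeal_iff.2 le_rfl)
  rw [mem_pIdeal] at hf
  rcases eq_or_ne v 0 with rfl | hv0
  · obtain ⟨x, hx⟩ := hne
    exact eval_zero_of_mem_ptIdeal (hf x hx)
  · exact mem_ptIdeal.1 (hf _ (le_ptIdeal_of_eval_eq_zero hQ hv0 hv)) v hv0 rfl

theorem ker_eval_zero_le_of_pZero_eq_empty [Q.IsPrime] (hQ : Q ≤ homCore Q) (h : pZero Q = ∅) :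
    RingHom.ker (aeval (0 : Fin (n + 1) → F)) ≤ Q := by
  intro f hf
  refine mem_of_eval_eq_zero fun v hv => ?_
  rcases eq_or_ne v 0 with rfl | hv0
  · simpa [RingHom.mem_ker, MvPolynomial.aeval_eq_eval] using hf
  · have h1 : Projectivization.mk F v hv0 ∈ pZero Q := le_ptIdeal_of_eval_eq_zero hQ hv0 hv
    rw [h] at h1
    exact h1.elim

theorem isIrredAlg_pZero [Q.IsPrime] (hQ : Q ≤ homCore Q) (hne : (pZero Q).Nonempty) :
    IsIrredAlg (pZero Q) := by
  refine ⟨isAlgSet_pZero Q, hne, fun A B hA hB h => ?_⟩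
  have h1 : pIdeal A * pIdeal B ≤ Q := by
    rw [← pIdeal_pZero hQ hne, le_pIdeal_iff]
    intro x hx
    change pIdeal A * pIdeal B ≤ ptIdeal x
    rcases h hx with hxA | hxB
    · exact Ideal.mul_le_left.trans (pIdeal_le_ptIdeal hxA)
    · exact Ideal.mul_le_right.trans (pIdeal_le_ptIdeal hxB)
  rcases (Ideal.IsPrime.mul_le inferInstance).1 h1 with h2 | h2
  · left; rw [← hA.pZero_pIdeal]; exact pZero_anti h2
  · right; rw [← hB.pZero_pIdeal]; exact pZero_anti h2

end

section

variable {F σ : Type*} [Field F]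

theorem gradingHom_coeff_gradingHom (f : MvPolynomial σ F) (d : ℕ) :
    gradingHom F σ ((gradingHom F σ f).coeff d) =
      Polynomial.C ((gradingHom F σ f).coeff d) * Polynomial.X ^ d := by
  induction f using MvPolynomial.induction_on generalizing d with
  | C a =>
    rw [gradingHom, aeval_C, Polynomial.algebraMap_apply, Polynomial.coeff_C]
    split_ifs with h
    · rw [h, pow_zero, mul_one, MvPolynomial.algebraMap_eq, aeval_C,
        Polynomial.algebraMap_apply, MvPolynomial.algebraMap_eq]
    · simp
  | add p q hp hq =>
    rw [map_add, Polynomial.coeff_add, map_add, hp, hq, Polynomial.C_add, add_mul]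
  | mul_X p i hp =>
    have hX : gradingHom F σ (X i) = Polynomial.C (X i) * Polynomial.X := by simp [gradingHom]
    rw [map_mul, hX, ← mul_assoc]
    cases d with
    | zero => simp
    | succ d =>
      rw [Polynomial.coeff_mul_X, Polynomial.coeff_mul_C, map_mul, hp, hX, Polynomial.C_mul]
      ring

theorem homCore_le_homCore_homCore (I : Ideal (MvPolynomial σ F)) :
    homCore I ≤ homCore (homCore I) := by
  intro f hf
  refine mem_homCore.2 fun d => mem_homCore.2 fun e => ?_
  rw [gradingHom_coeff_gradingHom, Polynomial.coeff_C_mul_X_pow]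
  split_ifs
  · exact mem_homCore.1 hf d
  · exact I.zero_mem

end

section

variable {F : Type*} [Field F] [IsAlgClosed F] {n : ℕ}

theorem IsComp.pIdeal_mem_minimalPrimes {W C : Set (ℙ F (Fin (n + 1) → F))} (hC : IsComp W C)
    {I : Ideal (MvPolynomial (Fin (n + 1)) F)} (hI : I ≤ homCore I) (hW : pZero I = W) :
    pIdeal C ∈ I.minimalPrimes := by
  refine ⟨⟨hC.1.isPrime_pIdeal, ?_⟩, fun P hP hle => ?_⟩
  · rw [le_pIdeal_iff, hW]
    exact hC.2.1
  · have := hP.1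
    have hcore := homCore_le_homCore_homCore P
    have hCP : C ⊆ pZero (homCore P) := le_pIdeal_iff.1 ((homCore_le P).trans hle)
    have hne : (pZero (homCore P)).Nonempty := hC.1.2.1.mono hCP
    have heq := hC.2.2 _ (isIrredAlg_pZero hcore hne)
      (hW ▸ pZero_anti (hI.trans (homCore_mono hP.2))) hCP
    rw [← heq, pIdeal_pZero hcore hne]
    exact homCore_le P

theorem ptIdeal_mem_minimalPrimes {I : Ideal (MvPolynomial (Fin (n + 1)) F)}
    (hI : I ≤ homCore I) (hfin : (pZero I).Finite) {x : ℙ F (Fin (n + 1) → F)}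
    (hx : x ∈ pZero I) : ptIdeal x ∈ I.minimalPrimes := by
  refine ⟨⟨inferInstance, hx⟩, fun P hP hle => ?_⟩
  have := hP.1
  have hcore := homCore_le_homCore_homCore P
  have hxP : x ∈ pZero (homCore P) := (homCore_le P).trans hle
  have hsub : pZero (homCore P) ⊆ pZero I := pZero_anti (hI.trans (homCore_mono hP.2))
  have hfin' := hfin.subset hsub
  have h1 : hfin'.toFinset.inf ptIdeal ≤ homCore P := by
    refine le_trans ?_ (pIdeal_pZero hcore ⟨x, hxP⟩).le
    rw [pIdeal, Finset.inf_eq_iInf]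
    simp
  obtain ⟨y, -, hy⟩ := (Ideal.IsPrime.inf_le' inferInstance).1 h1
  rw [ptIdeal_injective (hy.trans ((homCore_le P).trans hle))]
  exact hy.trans (homCore_le P)

theorem linSlice_eq_pZero {d : ℕ} (c : Fin d → Fin (n + 1) → F) :
    linSlice c = pZero (Ideal.span (Set.range fun i => ∑ j, C (c i j) * X j)) := by
  ext x
  change _ ↔ Ideal.span _ ≤ ptIdeal x
  rw [Ideal.span_le, Set.range_subset_iff]
  refine forall_congr' fun i => ?_
  rw [SetLike.mem_coe, mem_ptIdeal]
  simp [PVanish]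

theorem projDeg_le_pdeg {C : Set (ℙ F (Fin (n + 1) → F))} (hC : IsIrredAlg C) (d : ℕ) :
    projDeg C d ≤ pdeg (pIdeal C) := by
  have := hC.isPrime_pIdeal
  refine sSup_le ?_
  rintro _ ⟨c, hfin, rfl⟩
  rw [Nat.cast_le]
  set L : Ideal (MvPolynomial (Fin (n + 1)) F) :=
    Ideal.span (Set.range fun i => ∑ j, MvPolynomial.C (c i j) * X j) with hL
  have hZ : pZero (pIdeal C ⊔ L) = C ∩ linSlice c := by
    rw [pZero_sup, hC.1.pZero_pIdeal, linSlice_eq_pZero]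
  have hI := sup_le_homCore (pIdeal_le_homCore C) (span_linear_le_homCore c)
  classical
  have hmin : ∀ Q ∈ hfin.toFinset.image ptIdeal, Q ∈ (pIdeal C ⊔ L).minimalPrimes := by
    intro Q hQ
    obtain ⟨x, hx, rfl⟩ := Finset.mem_image.1 hQ
    rw [Set.Finite.mem_toFinset] at hx
    exact ptIdeal_mem_minimalPrimes hI (hZ ▸ hfin) (hZ ▸ hx)
  calc Nat.card ↥(C ∩ linSlice c) = hfin.toFinset.card := by
        rw [Nat.card_coe_set_eq, Set.ncard_eq_toFinset_card _ hfin]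
    _ = (hfin.toFinset.image ptIdeal).card :=
        (Finset.card_image_of_injective _ fun x y h => ptIdeal_injective h.ge).symm
    _ ≤ ∑ Q ∈ hfin.toFinset.image ptIdeal, pdeg Q := by
        rw [Finset.card_eq_sum_ones]
        refine Finset.sum_le_sum fun Q hQ => ?_
        have := (hmin Q hQ).1.1
        exact pdeg_pos
    _ ≤ idealDeg (pIdeal C ⊔ L) := sum_pdeg_le_idealDeg hmin
    _ ≤ idealDeg (pIdeal C) := by
        refine idealDeg_sup_span_range_le _ fun i => Submodule.sum_mem _ fun j _ => ?_
        rw [← MvPolynomial.smul_eq_C_mul]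
        exact Submodule.smul_mem _ _ (mem_linSpan _ _)
    _ = pdeg (pIdeal C) := idealDeg_of_isPrime _

end

section

variable {F : Type*} [Field F] [IsAlgClosed F] {n : ℕ}

theorem pdim_ker_eval_zero :
    pdim (RingHom.ker (aeval (0 : Fin (n + 1) → F) : MvPolynomial (Fin (n + 1)) F →ₐ[F] F)) = 0 := by
  rw [pdim_ker _ fun a => ⟨MvPolynomial.C a, by simp⟩, dimOver, trdeg_eq_zero,
    map_zero]

theorem exists_X_notMem_ptIdeal (x : ℙ F (Fin (n + 1) → F)) : ∃ i, X i ∉ ptIdeal x := by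
  by_contra! h
  refine x.rep_nonzero (funext fun i => ?_)
  simpa using mem_ptIdeal.1 (h i) x.rep x.rep_nonzero x.mk_rep

theorem pdim_ptIdeal_pos (x : ℙ F (Fin (n + 1) → F)) : 0 < pdim (ptIdeal x) := by
  obtain ⟨i, hi⟩ := exists_X_notMem_ptIdeal x
  have := RingHom.ker_isPrime (aeval (0 : Fin (n + 1) → F) : MvPolynomial (Fin (n + 1)) F →ₐ[F] F)
  refine (Nat.zero_le _).trans_lt (pdim_lt_of_lt
    (lt_of_le_not_ge (ptIdeal_le_ker_eval_zero x) fun hle => hi (hle ?_)))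
  simp [RingHom.mem_ker]

theorem pdim_pIdeal_pos {C : Set (ℙ F (Fin (n + 1) → F))} (hC : IsIrredAlg C) :
    0 < pdim (pIdeal C) := by
  have := hC.isPrime_pIdeal
  obtain ⟨x, hx⟩ := hC.2.1
  rcases (pIdeal_le_ptIdeal hx).eq_or_lt with h | h
  · exact h ▸ pdim_ptIdeal_pos x
  · exact (Nat.zero_le _).trans_lt (pdim_lt_of_lt h)

theorem pdim_pIdeal_lt {C D : Set (ℙ F (Fin (n + 1) → F))} (hC : IsIrredAlg C)
    (hD : IsIrredAlg D) (h : C ⊂ D) : pdim (pIdeal C) < pdim (pIdeal D) := by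
  have := hC.isPrime_pIdeal
  have := hD.isPrime_pIdeal
  refine pdim_lt_of_lt (lt_of_le_not_ge (pIdeal_anti h.1) fun hle => h.2 ?_)
  rw [← hC.1.pZero_pIdeal, ← hD.1.pZero_pIdeal]
  exact pZero_anti hle

theorem exists_isIrredAlg_ssubset {C : Set (ℙ F (Fin (n + 1) → F))} (hC : IsIrredAlg C) {k : ℕ}
    (hk : pdim (pIdeal C) = k + 2) : ∃ D, IsIrredAlg D ∧ D ⊂ C ∧ pdim (pIdeal D) = k + 1 := by
  have := hC.isPrime_pIdeal
  obtain ⟨x, hx⟩ := hC.2.1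
  obtain ⟨i, hXx⟩ := exists_X_notMem_ptIdeal x
  have hX : (X i : MvPolynomial (Fin (n + 1)) F) ∉ pIdeal C :=
    fun h => hXx (pIdeal_le_ptIdeal hx h)
  have hspan : Ideal.span {(X i : MvPolynomial (Fin (n + 1)) F)} ≤ homCore (Ideal.span {X i}) := by
    rw [Ideal.span_singleton_le_iff_mem, mem_homCore]
    intro d
    have h : gradingHom F (Fin (n + 1)) (X i) = Polynomial.C (X i) * Polynomial.X := by
      simp [gradingHom]
    rw [h, Polynomial.coeff_C_mul_X]
    split_ifs
    · exact Ideal.mem_span_singleton_self _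
    · exact Ideal.zero_mem _
  have hI := sup_le_homCore (pIdeal_le_homCore C) hspan
  have hne : pIdeal C ⊔ Ideal.span {X i} ≠ ⊤ := by
    have hle : pIdeal C ⊔ Ideal.span {X i} ≤ RingHom.ker
        (aeval (0 : Fin (n + 1) → F) : MvPolynomial (Fin (n + 1)) F →ₐ[F] F) := by
      refine sup_le ((pIdeal_le_ptIdeal hx).trans (ptIdeal_le_ker_eval_zero x)) ?_
      rw [Ideal.span_singleton_le_iff_mem, RingHom.mem_ker, aeval_X, Pi.zero_apply]
    exact ne_top_of_le_ne_top (RingHom.ker_ne_top _) hle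
  obtain ⟨Q, hQ⟩ := Ideal.nonempty_minimalPrimes hne
  have hdim := pdim_add_one hX hQ
  have := hQ.1.1
  have hcore := le_homCore_of_mem_minimalPrimes hI hQ
  have hZ : (pZero Q).Nonempty := by
    rw [Set.nonempty_iff_ne_empty]
    intro h
    have := RingHom.ker_isPrime
      (aeval (0 : Fin (n + 1) → F) : MvPolynomial (Fin (n + 1)) F →ₐ[F] F)
    have h0 := pdim_ker_eval_zero (F := F) (n := n)
    rcases (ker_eval_zero_le_of_pZero_eq_empty hcore h).eq_or_lt with h1 | h1
    · rw [h1] at h0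
      omega
    · have := pdim_lt_of_lt h1
      omega
  refine ⟨pZero Q, isIrredAlg_pZero hcore hZ, ⟨?_, fun hle => hX ?_⟩, ?_⟩
  · rw [← hC.1.pZero_pIdeal]
    exact pZero_anti (le_sup_left.trans hQ.1.2)
  · rw [← pIdeal_pZero hcore hZ] at hQ
    exact pIdeal_anti hle
      (hQ.1.2 (Ideal.mem_sup_right (Ideal.mem_span_singleton_self _)))
  · rw [pIdeal_pZero hcore hZ]
    omega

theorem exists_isIrredAlg_subset {C : Set (ℙ F (Fin (n + 1) → F))} (hC : IsIrredAlg C) {k j : ℕ}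
    (hk : pdim (pIdeal C) = k + 1 + j) : ∃ D, IsIrredAlg D ∧ D ⊆ C ∧ pdim (pIdeal D) = k + 1 := by
  induction j generalizing C with
  | zero => exact ⟨C, hC, subset_rfl, hk⟩
  | succ j ih =>
    obtain ⟨D, hD, hDC, hd⟩ := exists_isIrredAlg_ssubset hC (k := k + j) (by omega)
    obtain ⟨E, hE, hED, he⟩ := ih hD (by omega)
    exact ⟨E, hE, hED.trans hDC.1, he⟩

theorem projDim_eq {C : Set (ℙ F (Fin (n + 1) → F))} (hC : IsIrredAlg C) :
    projDim C = ((pdim (pIdeal C) - 1 : ℕ) : WithBot ℕ∞) := by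
  let f : {D : Set (ℙ F (Fin (n + 1) → F)) // IsIrredAlg D ∧ D ⊆ C} → ℕ :=
    fun D => pdim (pIdeal D.1) - 1
  have hf : StrictMono f := by
    intro D E h
    have h1 := pdim_pIdeal_lt D.2.1 E.2.1 h
    have h2 := pdim_pIdeal_pos D.2.1
    change pdim (pIdeal D.1) - 1 < pdim (pIdeal E.1) - 1
    omega
  let _ : OrderTop {D : Set (ℙ F (Fin (n + 1) → F)) // IsIrredAlg D ∧ D ⊆ C} :=
    { top := ⟨C, hC, subset_rfl⟩, le_top := fun D => D.2.2 }
  rw [projDim, ← Order.height_top_eq_krullDim, Order.height_eq_of_strictMono f hf, Order.height_nat]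
  · rfl
  · intro D b hb
    obtain ⟨D, hD, hDC⟩ := D
    have hb' : b < pdim (pIdeal D) - 1 := hb
    obtain ⟨E, hE, hED, he⟩ := exists_isIrredAlg_subset hD (k := b)
      (j := pdim (pIdeal D) - (b + 1)) (by omega)
    have hne : E ≠ D := by
      rintro rfl
      omega
    refine ⟨⟨E, hE, hED.trans hDC⟩, ?_, ?_⟩
    · exact Set.ssubset_iff_subset_ne.2 ⟨hED, hne⟩
    · change pdim (pIdeal E) - 1 = b
      omega

theorem pdim_pIdeal_eq {C : Set (ℙ F (Fin (n + 1) → F))} (hC : IsIrredAlg C) {d : ℕ}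
    (hd : projDim C = d) : pdim (pIdeal C) = d + 1 := by
  have h := pdim_pIdeal_pos hC
  rw [projDim_eq hC] at hd
  have : pdim (pIdeal C) - 1 = d := by exact_mod_cast hd
  omega

end

section

variable {F : Type*} [Field F] [IsAlgClosed F] {n : ℕ}

theorem IsAlgSet.mk_mem_iff {V : Set (ℙ F (Fin (n + 1) → F))} (hV : IsAlgSet V)
    {v : Fin (n + 1) → F} (hv : v ≠ 0) :
    Projectivization.mk F v hv ∈ V ↔ ∀ p ∈ pIdeal V, eval v p = 0 := by
  constructor
  · intro h p hp
    exact mem_ptIdeal.1 (pIdeal_le_ptIdeal h hp) v hv rfl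
  · intro h
    rw [← hV.pZero_pIdeal]
    exact le_ptIdeal_of_eval_eq_zero (pIdeal_le_homCore V) hv h

theorem mem_linSlice {F : Type*} [Field F] {n d : ℕ} {c : Fin d → Fin (n + 1) → F}
    {v : Fin (n + 1) → F} (hv : v ≠ 0) :
    Projectivization.mk F v hv ∈ linSlice c ↔ ∀ i, ∑ j, c i j * v j = 0 := by
  refine forall_congr' fun i => ⟨fun h => h v hv rfl, fun h u hu hx => ?_⟩
  obtain ⟨a, rfl⟩ := (Projectivization.mk_eq_mk_iff' F u v hu hv).1 hx
  simp only [Pi.smul_apply, smul_eq_mul, mul_left_comm _ a, ← Finset.mul_sum, h, mul_zero]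

theorem exists_linSlice_card_eq {V : Set (ℙ F (Fin (n + 1) → F))} (hV : IsAlgSet V)
    {d : ℕ} (c : Fin (d + 1) → Fin (n + 1) → F)
    (hfin : ∀ w : Fin (d + 1) → F,
      {v | (∀ p ∈ pIdeal V, eval v p = 0) ∧ ∀ i, ∑ k, c i k * v k = w i}.Finite)
    {w : Fin (d + 1) → F} (hw : w ≠ 0) :
    ∃ c' : Fin d → Fin (n + 1) → F, (V ∩ linSlice c').Finite ∧
      Nat.card {v | (∀ p ∈ pIdeal V, eval v p = 0) ∧ ∀ i, ∑ k, c i k * v k = w i} =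
        Nat.card ↥(V ∩ linSlice c') := by
  obtain ⟨i₀, hi₀⟩ : ∃ i, w i ≠ 0 := by
    by_contra! h0
    exact hw (funext h0)
  have hsmul : ∀ {v : Fin (n + 1) → F}, v ≠ 0 → (∀ p ∈ pIdeal V, eval v p = 0) → ∀ {t : F},
      t ≠ 0 → ∀ p ∈ pIdeal V, eval (t • v) p = 0 := by
    intro v hv h t ht
    rw [← hV.mk_mem_iff (smul_ne_zero ht hv)]
    rw [← hV.mk_mem_iff hv] at h
    rwa [(Projectivization.mk_eq_mk_iff' F _ _ _ hv).2 ⟨t, rfl⟩]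
  have hcsmul : ∀ (t : F) (v : Fin (n + 1) → F) i,
      ∑ k, c i k * (t • v) k = t * ∑ k, c i k * v k := by
    intro t v i
    simp only [Pi.smul_apply, smul_eq_mul, mul_left_comm _ t, ← Finset.mul_sum]
  have hzero : ∀ v : Fin (n + 1) → F, v ≠ 0 → (∀ p ∈ pIdeal V, eval v p = 0) →
      ¬ ∀ i, ∑ k, c i k * v k = 0 := by
    intro v hv h hc
    have hinj : Function.Injective fun t : F => t • v := smul_left_injective F hv
    have hinf : ({0}ᶜ : Set F).Infinite := (Set.finite_singleton (0 : F)).infinite_compl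
    refine (hinf.image hinj.injOn) ((hfin 0).subset ?_)
    rintro _ ⟨t, ht, rfl⟩
    refine ⟨hsmul hv h ht, fun i => ?_⟩
    rw [hcsmul, hc, mul_zero, Pi.zero_apply]
  refine ⟨fun k l => w i₀ * c (i₀.succAbove k) l - w (i₀.succAbove k) * c i₀ l, ?_⟩
  set S := {v : Fin (n + 1) → F |
    (∀ p ∈ pIdeal V, eval v p = 0) ∧ ∀ i, ∑ k, c i k * v k = w i} with hS
  have hS0 : ∀ v : S, v.1 ≠ 0 := by
    intro v h0
    apply hi₀
    rw [← v.2.2 i₀, h0]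
    simp
  have hslice : ∀ v : Fin (n + 1) → F, ∀ k,
      ∑ l, (w i₀ * c (i₀.succAbove k) l - w (i₀.succAbove k) * c i₀ l) * v l =
        w i₀ * ∑ l, c (i₀.succAbove k) l * v l - w (i₀.succAbove k) * ∑ l, c i₀ l * v l := by
    intro v k
    simp only [sub_mul, Finset.sum_sub_distrib, mul_assoc, Finset.mul_sum]
  let φ : S → ℙ F (Fin (n + 1) → F) := fun v => Projectivization.mk F v.1 (hS0 v)
  have hinj : Function.Injective φ := by
    intro v u h
    obtain ⟨a, ha⟩ := (Projectivization.mk_eq_mk_iff' F v.1 u.1 (hS0 v) (hS0 u)).1 h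
    have h1 := hcsmul a u.1 i₀
    rw [ha, v.2.2, u.2.2] at h1
    have ha1 : a = 1 := mul_right_cancel₀ hi₀ (by rw [one_mul, ← h1])
    rw [ha1, one_smul] at ha
    exact Subtype.ext ha.symm
  have hrange : Set.range φ =
      V ∩ linSlice fun k l => w i₀ * c (i₀.succAbove k) l - w (i₀.succAbove k) * c i₀ l := by
    ext x
    constructor
    · rintro ⟨v, rfl⟩
      refine ⟨(hV.mk_mem_iff (hS0 v)).2 v.2.1, (mem_linSlice (hS0 v)).2 fun k => ?_⟩
      rw [hslice, v.2.2, v.2.2]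
      ring
    · rintro ⟨hxV, hxs⟩
      induction x using Projectivization.ind with | _ v hv
      rw [hV.mk_mem_iff] at hxV
      rw [mem_linSlice] at hxs
      set a := (∑ l, c i₀ l * v l) / w i₀ with ha
      have hall : ∀ i, ∑ l, c i l * v l = a * w i := by
        intro i
        rcases Fin.eq_self_or_eq_succAbove i₀ i with rfl | ⟨k, rfl⟩
        · rw [ha, div_mul_cancel₀ _ hi₀]
        · have h1 := hxs k
          rw [hslice, sub_eq_zero] at h1
          rw [ha, div_mul_eq_mul_div, eq_div_iff hi₀]
          linear_combination h1
      have ha0 : a ≠ 0 := by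
        intro h0
        refine hzero v hv hxV fun i => ?_
        rw [hall, h0, zero_mul]
      refine ⟨⟨a⁻¹ • v, hsmul hv hxV (inv_ne_zero ha0), fun i => ?_⟩, ?_⟩
      · rw [hcsmul, hall, inv_mul_cancel_left₀ ha0]
      · exact (Projectivization.mk_eq_mk_iff' F _ _ _ hv).2 ⟨a⁻¹, rfl⟩
  have : Finite S := hfin w
  rw [← hrange]
  exact ⟨Set.finite_range φ, (Nat.card_range_of_injective hinj).symm⟩

theorem isComp_pZero {V : Set (ℙ F (Fin (n + 1) → F))} (hV : IsAlgSet V) (hne : V.Nonempty)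
    {Q : Ideal (MvPolynomial (Fin (n + 1)) F)} (hQ : Q ∈ (pIdeal V).minimalPrimes) :
    IsComp V (pZero Q) ∧ pIdeal (pZero Q) = Q := by
  have := hQ.1.1
  have hcore := le_homCore_of_mem_minimalPrimes (pIdeal_le_homCore V) hQ
  have hZ : (pZero Q).Nonempty := by
    rw [Set.nonempty_iff_ne_empty]
    intro h
    obtain ⟨x, hx⟩ := hne
    have hle : ptIdeal x ≤ Q :=
      (ptIdeal_le_ker_eval_zero x).trans (ker_eval_zero_le_of_pZero_eq_empty hcore h)
    have hxQ : x ∈ pZero Q := hQ.2 ⟨inferInstance, pIdeal_le_ptIdeal hx⟩ hle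
    rw [h] at hxQ
    exact hxQ
  refine ⟨⟨isIrredAlg_pZero hcore hZ, ?_, fun C hC hCV hle => ?_⟩, pIdeal_pZero hcore hZ⟩
  · rw [← hV.pZero_pIdeal]
    exact pZero_anti hQ.1.2
  · have h1 : pIdeal C ≤ Q := (pIdeal_anti hle).trans (pIdeal_pZero hcore hZ).le
    refine hle.antisymm' ?_
    rw [← hC.1.pZero_pIdeal]
    exact pZero_anti (hQ.2 ⟨hC.isPrime_pIdeal, pIdeal_anti hCV⟩ h1)

theorem idealDeg_le_projDeg {V : Set (ℙ F (Fin (n + 1) → F))} (hV : IsAlgSet V) {d : ℕ}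
    (hdim : projDim V = d) (hpure : ∀ C, IsComp V C → projDim C = d) :
    (idealDeg (pIdeal V) : ℕ∞) ≤ projDeg V d := by
  have hne : V.Nonempty := by
    have h : projDim V ≠ ⊥ := by rw [hdim]; exact WithBot.coe_ne_bot
    obtain ⟨C, hC, hCV⟩ := Order.krullDim_ne_bot_iff.1 h
    exact hC.2.1.mono hCV
  obtain ⟨x, hx⟩ := hne
  have hfinmin := (pIdeal V).finite_minimalPrimes_of_isNoetherianRing
  have hmin : ∀ {P : Ideal (MvPolynomial (Fin (n + 1)) F)}, P.IsPrime → pIdeal V ≤ P →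
      ∃ Q ∈ hfinmin.toFinset, Q ≤ P := by
    intro P hP hle
    obtain ⟨Q, hQ, hQP⟩ := Ideal.exists_minimalPrimes_le hle
    exact ⟨Q, hfinmin.mem_toFinset.2 hQ, hQP⟩
  have hcone : ∀ v : Fin (n + 1) → F, (∃ Q ∈ hfinmin.toFinset, ∀ p ∈ Q, eval v p = 0) ↔
      ∀ p ∈ pIdeal V, eval v p = 0 := by
    intro v
    constructor
    · rintro ⟨Q, hQ, h⟩ p hp
      exact h p ((hfinmin.mem_toFinset.1 hQ).1.2 hp)
    · intro h
      obtain ⟨Q, hQ, hle⟩ := hmin (RingHom.ker_isPrime (eval v)) fun p hp => h p hp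
      exact ⟨Q, hQ, fun p hp => hle hp⟩
  obtain ⟨Q₀, hQ₀, -⟩ := hmin inferInstance (pIdeal_le_ptIdeal hx)
  obtain ⟨c, hfin, h, hh0, hh⟩ := exists_fiber (ρ := d + 1) hfinmin.toFinset ⟨Q₀, hQ₀⟩
    (fun Q hQ => (hfinmin.mem_toFinset.1 hQ).1.1) fun Q hQ => by
      obtain ⟨hC, hQe⟩ := isComp_pZero hV ⟨x, hx⟩ (hfinmin.mem_toFinset.1 hQ)
      rw [← pdim_pIdeal_eq hC.1 (hpure _ hC), hQe]
  simp only [hcone] at hfin hh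
  obtain ⟨w, hw⟩ : ∃ w : Fin (d + 1) → F, eval w (h * X 0) ≠ 0 := by
    by_contra! h0
    refine mul_ne_zero hh0 (X_ne_zero (0 : Fin (d + 1))) (MvPolynomial.funext fun w => ?_)
    rw [h0, map_zero]
  rw [map_mul, eval_X] at hw
  have hw0 : w ≠ 0 := by
    rintro rfl
    simp at hw
  obtain ⟨c', hfin', hcard⟩ := exists_linSlice_card_eq hV c hfin hw0
  have h1 := hh w (left_ne_zero_of_mul hw)
  rw [hcard, ← idealDeg_eq_sum] at h1
  exact (Nat.cast_le.2 h1).trans (le_sSup ⟨c', hfin', rfl⟩)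

end

/-- **Refined Bézout inequality (Vogel).**  Let `V₁,…,V_r ⊆ ℙⁿ` (`r ≥ 2`) be pure
dimensional projective algebraic sets over an algebraically closed field, with
`dim V_i = d i`.  Then `∏ᵢ deg(V_i) ≥ ∑_C deg(C)` where `C` runs through the
irreducible components of `V₁ ∩ ⋯ ∩ V_r` (of dimensions `dC C`); equivalently,
every finite collection of such components satisfies the inequality. -/
theorem stmt15 (F : Type*) [Field F] [IsAlgClosed F] (n r : ℕ) (hr : 2 ≤ r)
    (V : Fin r → Set (ℙ F (Fin (n + 1) → F))) (d : Fin r → ℕ)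
    (halg : ∀ i, IsAlgSet (V i))
    (hdim : ∀ i, projDim (V i) = (d i : WithBot ℕ∞))
    (hpure : ∀ i, ∀ C, IsComp (V i) C → projDim C = (d i : WithBot ℕ∞)) :
    ∀ (𝒞 : Finset (Set (ℙ F (Fin (n + 1) → F))))
      (dC : Set (ℙ F (Fin (n + 1) → F)) → ℕ),
      (∀ C ∈ 𝒞, IsComp (⋂ i, V i) C ∧ projDim C = (dC C : WithBot ℕ∞)) →
      ∑ C ∈ 𝒞, projDeg C (dC C) ≤ ∏ i, projDeg (V i) (d i) := by
  classical
  intro 𝒞 dC h𝒞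
  have : Nonempty (Fin r) := ⟨⟨0, by omega⟩⟩
  set I := Finset.univ.sup fun i => pIdeal (V i) with hI
  have hcore : I ≤ homCore I := finset_sup_le_homCore _ fun i => pIdeal_le_homCore (V i)
  have hZ : pZero I = ⋂ i, V i := by
    rw [hI, pZero_finset_sup]
    simp [(halg _).pZero_pIdeal]
  have hinj : Set.InjOn pIdeal (𝒞 : Set (Set (ℙ F (Fin (n + 1) → F)))) := by
    intro C hC D hD h
    rw [← (h𝒞 C hC).1.1.1.pZero_pIdeal, ← (h𝒞 D hD).1.1.1.pZero_pIdeal, h]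
  have hsum : ∑ C ∈ 𝒞, pdeg (pIdeal C) ≤ ∏ i, idealDeg (pIdeal (V i)) := by
    rw [← Finset.sum_image hinj]
    refine (sum_pdeg_le_idealDeg fun Q hQ => ?_).trans
      (idealDeg_sup_finset_le Finset.univ_nonempty fun i => pIdeal (V i))
    obtain ⟨C, hC, rfl⟩ := Finset.mem_image.1 hQ
    exact (h𝒞 C hC).1.pIdeal_mem_minimalPrimes hcore hZ
  calc ∑ C ∈ 𝒞, projDeg C (dC C) ≤ ∑ C ∈ 𝒞, (pdeg (pIdeal C) : ℕ∞) :=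
        Finset.sum_le_sum fun C hC => projDeg_le_pdeg (h𝒞 C hC).1.1 _
    _ ≤ ∏ i, (idealDeg (pIdeal (V i)) : ℕ∞) := by exact_mod_cast hsum
    _ ≤ ∏ i, projDeg (V i) (d i) := Finset.prod_le_prod' fun i _ =>
        idealDeg_le_projDeg (halg i) (hdim i) (hpure i)

end
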